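/- Let P_1, P_2, P_3 be three d-polytopes in ℝ^d, d ≥ 2, with n_i ≥ d+1 vertices (i = 1,2,3). Then for every 1 ≤ k ≤ d, f_{k−1}(P_1+P_2+P_3) ≤ f_{k+1}(C_{d+2}(n_{[3]})) − Σ_{i=0}^{⌊(d+2)/2⌋} C(d+2−i, k+2−i) · Σ_{∅⊂S⊊[3]} (−1)^{|S|} C(n_S−d−3+i, i) − (d−2⌊d/2⌋) · C(⌊d/2⌋+1, k−⌊d/2⌋) · Σ_{i=1}^{3} C(n_i−⌊d/2⌋−2, ⌊d/2⌋+1), where [3] = {1,2,3} and n_S = Σ_{i∈S} n_i. -/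

import Mathlib

open Finset Pointwise

noncomputable section

/-- The ambient space `ℝ^d`. -/
abbrev Vec (d : ℕ) := Fin d → ℝ

/-- Dimension of a set of points: the dimension of its affine span,
with the convention that the empty set has dimension `-1`. -/
noncomputable def sdim {D : ℕ} (s : Set (Vec D)) : ℤ :=
  open scoped Classical in
  if s = ∅ then -1 else (Module.finrank ℝ (affineSpan ℝ s).direction : ℤ)

/-- `F` is a proper (nonempty) face of `P`: a nonempty exposed face distinct from `P`. -/
def IsProperFace {D : ℕ} (P F : Set (Vec D)) : Prop :=
  IsExposed ℝ P F ∧ F.Nonempty ∧ F ≠ P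

/-- The number of `k`-dimensional (proper, nonempty) faces of `P`. -/
noncomputable def fPoly {D : ℕ} (P : Set (Vec D)) (k : ℤ) : ℕ :=
  Nat.card {F : Set (Vec D) // IsProperFace P F ∧ sdim F = k}

/-- `P` is the (convex) polytope with vertex set `V`. -/
def IsPolytopeWithVertexSet {D : ℕ} (P : Set (Vec D)) (V : Finset (Vec D)) : Prop :=
  P = convexHull ℝ (V : Set (Vec D)) ∧
    ∀ v ∈ V, v ∉ convexHull ℝ ((V.erase v : Finset (Vec D)) : Set (Vec D))

/-- The (generalized) binomial coefficient `C(a,b)` for integers `a b`, equal to `0`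
for `b < 0` (and, in particular, equal to `0` when `b > a ≥ 0`). -/
noncomputable def ch (a b : ℤ) : ℤ := if 0 ≤ b then Ring.choose a b.toNat else 0

/-- The moment curve in `ℝ^m`. -/
def momentCurve (m : ℕ) (t : ℝ) : Vec m := fun i => t ^ ((i : ℕ) + 1)

/-- The cyclic polytope `C_m(N)`: the convex hull of `N` distinct points on the
moment curve in `ℝ^m`. -/
noncomputable def cyclicPolytope (m N : ℕ) : Set (Vec m) :=
  convexHull ℝ (Set.range fun j : Fin N => momentCurve m ((j : ℕ) + 1))

/-- The upper bound expression for `f_{k-1}(P₁+P₂+P₃)` from Theorem `thm:ms3ub`. -/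
noncomputable def UB3 (d : ℕ) (n : Fin 3 → ℕ) (k : ℕ) : ℤ :=
  (fPoly (cyclicPolytope (d + 2) (n 0 + n 1 + n 2)) ((k : ℤ) + 1) : ℤ) -
    (∑ i ∈ Finset.range ((d + 2) / 2 + 1),
      ch ((d : ℤ) + 2 - (i : ℤ)) ((k : ℤ) + 2 - (i : ℤ)) *
        ∑ S ∈ (Finset.univ : Finset (Fin 3)).powerset.filter
            (fun S => S ≠ ∅ ∧ S ≠ Finset.univ),
          (-1 : ℤ) ^ S.card * ch ((∑ j ∈ S, (n j : ℤ)) - (d : ℤ) - 3 + (i : ℤ)) (i : ℤ)) -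
    ((d : ℤ) - 2 * ((d / 2 : ℕ) : ℤ)) *
      ch (((d / 2 : ℕ) : ℤ) + 1) ((k : ℤ) - ((d / 2 : ℕ) : ℤ)) *
      ∑ i : Fin 3, ch ((n i : ℤ) - ((d / 2 : ℕ) : ℤ) - 2) (((d / 2 : ℕ) : ℤ) + 1)

set_option linter.unusedSectionVars false

section LinearAlgebra

variable {m ι : Type*}

section Dot

variable [Fintype m]

theorem exists_dotProduct_eq (f : (m → ℝ) →ₗ[ℝ] ℝ) : ∃ z : m → ℝ, ∀ x, z ⬝ᵥ x = f x := by
  classical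
  exact ⟨(dotProductEquiv ℝ m).symm f, fun x => by
    conv_rhs => rw [← (dotProductEquiv ℝ m).apply_symm_apply f]
    rfl⟩

theorem LinearIndepOn.exists_dotProduct_eq {v : ι → m → ℝ} {s : Set ι}
    (h : LinearIndepOn ℝ v s) (g : ι → ℝ) : ∃ z : m → ℝ, ∀ a ∈ s, z ⬝ᵥ v a = g a := by
  replace h : LinearIndependent ℝ fun x : s => v x := h
  obtain ⟨f, hf⟩ := LinearMap.exists_extend
    ((Module.Basis.span h).constr ℝ fun a : s => g a)
  obtain ⟨z, hz⟩ := _root_.exists_dotProduct_eq f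
  refine ⟨z, fun a ha => ?_⟩
  have h1 := LinearMap.congr_fun hf (Module.Basis.span h ⟨a, ha⟩)
  rw [Module.Basis.constr_basis] at h1
  rw [hz, ← h1]
  change f (v a) = f ↑((Module.Basis.span h) ⟨a, ha⟩)
  rw [Module.Basis.span_apply]

theorem mem_of_forall_dotProduct_eq_zero {U : Submodule ℝ (m → ℝ)} {x : m → ℝ}
    (h : ∀ z : m → ℝ, (∀ u ∈ U, z ⬝ᵥ u = 0) → z ⬝ᵥ x = 0) : x ∈ U := by
  by_contra hx
  obtain ⟨f, hf, hU⟩ := Submodule.exists_le_ker_of_notMem hx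
  obtain ⟨z, hz⟩ := _root_.exists_dotProduct_eq f
  exact hf (by rw [← hz]; exact h z fun u hu => by rw [hz]; exact hU hu)

theorem mem_span_image_of_forall {v : ι → m → ℝ} {s : Set ι} {x : m → ℝ}
    (h : ∀ z : m → ℝ, (∀ a ∈ s, z ⬝ᵥ v a = 0) → z ⬝ᵥ x = 0) :
    x ∈ Submodule.span ℝ (v '' s) :=
  mem_of_forall_dotProduct_eq_zero fun z hz =>
    h z fun a ha => hz _ (Submodule.subset_span ⟨a, ha, rfl⟩)

theorem dotProduct_eq_zero_of_mem_span {v : ι → m → ℝ} {s : Set ι} {x z : m → ℝ}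
    (hx : x ∈ Submodule.span ℝ (v '' s)) (hz : ∀ a ∈ s, z ⬝ᵥ v a = 0) : z ⬝ᵥ x = 0 := by
  induction hx using Submodule.span_induction with
  | mem x hx => obtain ⟨a, ha, rfl⟩ := hx; exact hz a ha
  | zero => simp
  | add x y _ _ hx hy => rw [dotProduct_add, hx, hy, add_zero]
  | smul c x _ hx => rw [dotProduct_smul, hx, smul_zero]

theorem continuous_dotProduct_right (x : m → ℝ) : Continuous fun y : m → ℝ => y ⬝ᵥ x := by
  unfold dotProduct; fun_prop

open Filter Topology in
theorem eventually_pos_add_smul (y z x : m → ℝ) (h : 0 < y ⬝ᵥ x) :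
    ∀ᶠ ε in 𝓝[>] (0 : ℝ), 0 < (y + ε • z) ⬝ᵥ x := by
  have : Tendsto (fun ε : ℝ => (y + ε • z) ⬝ᵥ x) (𝓝 0) (𝓝 ((y + (0 : ℝ) • z) ⬝ᵥ x)) := by
    apply Continuous.tendsto (f := fun ε : ℝ => (y + ε • z) ⬝ᵥ x)
    unfold dotProduct; fun_prop
  simp only [zero_smul, add_zero] at this
  exact (this.mono_left nhdsWithin_le_nhds).eventually (lt_mem_nhds h)

end Dot

theorem LinearIndepOn.finrank_span_image {v : ι → m → ℝ} {s : Finset ι}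
    (h : LinearIndepOn ℝ v (s : Set ι)) :
    Module.finrank ℝ (Submodule.span ℝ (v '' (s : Set ι))) = s.card := by
  have := finrank_span_eq_card h
  rw [← Set.image_eq_range] at this
  simpa using this

theorem finrank_span_image_le (v : ι → m → ℝ) (s : Finset ι) :
    Module.finrank ℝ (Submodule.span ℝ (v '' (s : Set ι))) ≤ s.card := by
  classical
  rw [← Finset.coe_image]
  exact (finrank_span_finset_le_card _).trans Finset.card_image_le

theorem exists_sum_of_mem_span {v : ι → m → ℝ} {s : Finset ι} {x : m → ℝ}
    (hx : x ∈ Submodule.span ℝ (v '' (s : Set ι))) : ∃ μ : ι → ℝ, x = ∑ a ∈ s, μ a • v a := by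
  obtain ⟨l, hl, rfl⟩ := (Finsupp.mem_span_image_iff_linearCombination ℝ).1 hx
  refine ⟨l, ?_⟩
  rw [Finsupp.linearCombination_apply, Finsupp.sum]
  refine Finset.sum_subset (by exact_mod_cast hl) fun a _ ha => ?_
  rw [Finsupp.notMem_support_iff.1 ha, zero_smul]

end LinearAlgebra

section Config

/-- A finite family of points of `ℝ^d`, each carrying a colour. -/
structure ColConfig (d : ℕ) (κ ι : Type*) where
  /-- the points -/
  pt : ι → Fin d → ℝ
  /-- the colours -/
  col : ι → κ

/-- A vector of `ℝ^d × ℝ^κ` whose `ℝ^d` part is not zero. -/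
def Proper {d : ℕ} {κ : Type*} (y : Fin d ⊕ κ → ℝ) : Prop := ∃ i, y (Sum.inl i) ≠ 0

namespace ColConfig

variable {d : ℕ} {κ ι : Type*} [Fintype κ] [DecidableEq κ] [Fintype ι] [DecidableEq ι]

/-- The Cayley lift of a coloured point. -/
def vec (C : ColConfig d κ ι) (a : ι) : Fin d ⊕ κ → ℝ :=
  Sum.elim (C.pt a) (Pi.single (C.col a) 1)

/-- The functional `y` is nonnegative on the configuration. -/
def Feas (C : ColConfig d κ ι) (y : Fin d ⊕ κ → ℝ) : Prop := ∀ a, 0 ≤ y ⬝ᵥ C.vec a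

open scoped Classical in
/-- The members of the configuration on which `y` vanishes. -/
def zeros (C : ColConfig d κ ι) (y : Fin d ⊕ κ → ℝ) : Finset ι :=
  univ.filter fun a => y ⬝ᵥ C.vec a = 0

/-- `A` is the zero set of a feasible functional with nonzero `ℝ^d` part. -/
def IsFace (C : ColConfig d κ ι) (A : Finset ι) : Prop :=
  ∃ y, C.Feas y ∧ Proper y ∧ C.zeros y = A

/-- The colours occurring in `A`. -/
def colors (C : ColConfig d κ ι) (A : Finset ι) : Finset κ := A.image C.col

/-- The span of the Cayley lifts of the members of `A`. -/
def spn (C : ColConfig d κ ι) (A : Finset ι) : Submodule ℝ (Fin d ⊕ κ → ℝ) :=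
  Submodule.span ℝ (C.vec '' (A : Set ι))

/-- Genericity: every set which is not obviously dependent is independent. -/
def Gen (C : ColConfig d κ ι) : Prop :=
  ∀ B : Finset ι, B.card ≤ d + (C.colors B).card → LinearIndepOn ℝ C.vec (B : Set ι)

variable (C : ColConfig d κ ι)

theorem mem_zeros {y : Fin d ⊕ κ → ℝ} {a : ι} : a ∈ C.zeros y ↔ y ⬝ᵥ C.vec a = 0 := by
  simp [zeros]

theorem dotProduct_vec (y : Fin d ⊕ κ → ℝ) (a : ι) :
    y ⬝ᵥ C.vec a = (fun i => y (Sum.inl i)) ⬝ᵥ C.pt a + y (Sum.inr (C.col a)) := by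
  simp [dotProduct, vec, Fintype.sum_sum_type, Pi.single_apply]

theorem vec_mem_spn {A : Finset ι} {a : ι} (ha : a ∈ A) : C.vec a ∈ C.spn A :=
  Submodule.subset_span ⟨a, ha, rfl⟩

theorem col_mem_colors {A : Finset ι} {a : ι} (ha : a ∈ A) : C.col a ∈ C.colors A :=
  mem_image_of_mem _ ha

theorem colors_mono {A B : Finset ι} (h : A ⊆ B) : C.colors A ⊆ C.colors B :=
  image_subset_image h

/-- The vectors supported on the first factor and the colours in `J`. -/
theorem finrank_span_single (J : Finset κ) :
    Module.finrank ℝ (Submodule.span ℝ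
      ((fun j => Pi.single j (1 : ℝ) : Fin d ⊕ κ → Fin d ⊕ κ → ℝ) ''
        ((univ.disjSum J : Finset (Fin d ⊕ κ)) : Set (Fin d ⊕ κ)))) = d + J.card := by
  rw [LinearIndepOn.finrank_span_image, card_disjSum, card_univ, Fintype.card_fin]
  have := (Pi.basisFun ℝ (Fin d ⊕ κ)).linearIndependent
  have h2 : (Pi.basisFun ℝ (Fin d ⊕ κ) : Fin d ⊕ κ → Fin d ⊕ κ → ℝ)
      = fun j => Pi.single j (1 : ℝ) := by
    ext1 j; simp
  rw [h2] at this
  exact this.linearIndepOn _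

theorem vec_eq_sum (a : ι) : C.vec a =
    (∑ i, C.pt a i • (Pi.single (Sum.inl i) 1 : Fin d ⊕ κ → ℝ)) +
      Pi.single (Sum.inr (C.col a)) 1 := by
  ext j
  rcases j with j | j <;> simp [vec, Finset.sum_apply, Pi.single_apply]

theorem le_finrank_of_forall_mem {U : Submodule ℝ (Fin d ⊕ κ → ℝ)}
    (hU : ∀ i, (Pi.single (Sum.inl i) 1 : Fin d ⊕ κ → ℝ) ∈ U) {S : Finset ι}
    (hS : ∀ a ∈ S, C.vec a ∈ U) : d + (C.colors S).card ≤ Module.finrank ℝ U := by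
  rw [← finrank_span_single (d := d) (C.colors S)]
  refine Submodule.finrank_mono (Submodule.span_le.2 ?_)
  rintro _ ⟨j | c, hj, rfl⟩
  · exact hU j
  · obtain ⟨a, ha, rfl⟩ := mem_image.1 (inr_mem_disjSum.1 hj)
    have := hS a ha
    rw [vec_eq_sum] at this
    exact (Submodule.add_mem_iff_right _
      (Submodule.sum_mem _ fun i _ => Submodule.smul_mem _ _ (hU i))).1 this

theorem spn_le_span_single (S : Finset ι) : C.spn S ≤ Submodule.span ℝ
      ((fun j => Pi.single j (1 : ℝ) : Fin d ⊕ κ → Fin d ⊕ κ → ℝ) ''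
        ((univ.disjSum (C.colors S) : Finset (Fin d ⊕ κ)) : Set (Fin d ⊕ κ))) := by
  refine Submodule.span_le.2 ?_
  rintro _ ⟨a, ha, rfl⟩
  rw [vec_eq_sum]
  refine Submodule.add_mem _ (Submodule.sum_mem _ fun i _ => Submodule.smul_mem _ _ ?_) ?_
  · exact Submodule.subset_span ⟨Sum.inl i, by simp, rfl⟩
  · exact Submodule.subset_span ⟨Sum.inr _, by simpa using C.col_mem_colors ha, rfl⟩

theorem exists_subset_card_eq (A : Finset ι) (h : d + (C.colors A).card ≤ A.card) :
    ∃ B ⊆ A, C.colors B = C.colors A ∧ B.card = d + (C.colors A).card := by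
  obtain ⟨R, hR, hc, hi⟩ : ∃ R ⊆ A, R.image C.col = A.image C.col ∧
      R.card = (A.image C.col).card := by
    obtain ⟨R, hR, h1, h2⟩ := Finset.exists_subset_injOn_image_eq_of_surjOn (f := C.col)
      (A : Set ι) (A.image C.col) (by simp [Set.SurjOn])
    exact ⟨R, by exact_mod_cast hR, h2, by rw [← h2, card_image_of_injOn h1]⟩
  obtain ⟨B, h1, h2, h3⟩ := Finset.exists_subsuperset_card_eq hR
    (n := d + (C.colors A).card) (by rw [hi]; unfold colors; omega) h
  exact ⟨B, h2, (C.colors_mono h2).antisymm (by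
    have := C.colors_mono h1
    unfold colors at *
    rwa [hc] at this), h3⟩

variable {C}

theorem Gen.single_mem_spn (hC : C.Gen) {A : Finset ι} (h : d + (C.colors A).card ≤ A.card)
    (i : Fin d) : (Pi.single (Sum.inl i) 1 : Fin d ⊕ κ → ℝ) ∈ C.spn A := by
  obtain ⟨B, hBA, hcol, hcard⟩ := C.exists_subset_card_eq A h
  have hind := hC B (by rw [hcol, hcard])
  have hfr : Module.finrank ℝ (C.spn B) = d + (C.colors B).card := by
    rw [hcol, ← hcard]; exact hind.finrank_span_image
  have heq := Submodule.eq_of_le_of_finrank_le (C.spn_le_span_single B)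
    (by rw [finrank_span_single, hfr])
  have hmem : (Pi.single (Sum.inl i) 1 : Fin d ⊕ κ → ℝ) ∈ C.spn B := by
    rw [heq]; exact Submodule.subset_span ⟨Sum.inl i, by simp, rfl⟩
  exact Submodule.span_mono (Set.image_mono (by exact_mod_cast hBA)) hmem

theorem Gen.not_proper_of_vanish (hC : C.Gen) {A : Finset ι}
    (h : d + (C.colors A).card ≤ A.card) {y : Fin d ⊕ κ → ℝ}
    (hy : ∀ a ∈ A, y ⬝ᵥ C.vec a = 0) : ¬ Proper y := by
  rintro ⟨i, hi⟩
  have := dotProduct_eq_zero_of_mem_span (hC.single_mem_spn h i) (z := y) hy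
  simp at this
  exact hi this

theorem Gen.card_lt (hC : C.Gen) {A : Finset ι} (hA : C.IsFace A) :
    A.card < d + (C.colors A).card := by
  by_contra! hlt
  obtain ⟨y, -, hp, rfl⟩ := hA
  exact hC.not_proper_of_vanish hlt (fun a ha => C.mem_zeros.1 ha) hp

theorem Gen.indep (hC : C.Gen) {A : Finset ι} (hA : C.IsFace A) :
    LinearIndepOn ℝ C.vec (A : Set ι) := hC A (hC.card_lt hA).le

open Filter Topology in
theorem eventually_perturb {y z : Fin d ⊕ κ → ℝ} (hy : C.Feas y)
    (hz : ∀ a, y ⬝ᵥ C.vec a = 0 → 0 ≤ z ⬝ᵥ C.vec a) :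
    ∀ᶠ ε in 𝓝[>] (0 : ℝ), C.Feas (y + ε • z) ∧
      ∀ a, (y + ε • z) ⬝ᵥ C.vec a = 0 ↔ y ⬝ᵥ C.vec a = 0 ∧ z ⬝ᵥ C.vec a = 0 := by
  have h1 : ∀ᶠ ε in 𝓝[>] (0 : ℝ), ∀ a, y ⬝ᵥ C.vec a ≠ 0 → 0 < (y + ε • z) ⬝ᵥ C.vec a := by
    refine eventually_all.2 fun a => ?_
    by_cases h : y ⬝ᵥ C.vec a = 0
    · simp [h]
    · filter_upwards [eventually_pos_add_smul y z (C.vec a) ((hy a).lt_of_ne' h)] with ε h' _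
        using h'
  filter_upwards [h1, self_mem_nhdsWithin] with ε hε hpos
  have hpos : (0 : ℝ) < ε := hpos
  refine ⟨fun a => ?_, fun a => ?_⟩
  · by_cases h : y ⬝ᵥ C.vec a = 0
    · rw [add_dotProduct, h, smul_dotProduct, zero_add]
      exact mul_nonneg hpos.le (hz a h)
    · exact (hε a h).le
  · by_cases h : y ⬝ᵥ C.vec a = 0
    · simp [add_dotProduct, h, smul_dotProduct, hpos.ne']
    · simp only [h, (hε a h).ne', false_and]

open Filter Topology in
theorem eventually_proper {y : Fin d ⊕ κ → ℝ} (z : Fin d ⊕ κ → ℝ) (hy : Proper y) :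
    ∀ᶠ ε in 𝓝[>] (0 : ℝ), Proper (y + ε • z) := by
  obtain ⟨i, hi⟩ := hy
  have : Tendsto (fun ε : ℝ => (y + ε • z) (Sum.inl i)) (𝓝 0)
      (𝓝 ((y + (0 : ℝ) • z) (Sum.inl i))) := by
    apply Continuous.tendsto (f := fun ε : ℝ => (y + ε • z) (Sum.inl i))
    simp only [Pi.add_apply, Pi.smul_apply]; fun_prop
  simp only [zero_smul, add_zero] at this
  filter_upwards [(this.mono_left nhdsWithin_le_nhds).eventually_ne hi] with ε h
  exact ⟨i, h⟩

theorem Gen.isFace_subset (hC : C.Gen) {A B : Finset ι} (hA : C.IsFace A) (hB : B ⊆ A) :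
    C.IsFace B := by
  obtain ⟨z, hz⟩ := (hC.indep hA).exists_dotProduct_eq fun a => if a ∈ B then 0 else 1
  obtain ⟨y, hy, hp, rfl⟩ := hA
  have hz' : ∀ a, y ⬝ᵥ C.vec a = 0 → z ⬝ᵥ C.vec a = if a ∈ B then 0 else 1 :=
    fun a ha => hz a (C.mem_zeros.2 ha)
  obtain ⟨ε, ⟨h1, h2⟩, h3⟩ := ((eventually_perturb hy (z := z) fun a ha => by
    rw [hz' a ha]; split_ifs <;> norm_num).and (eventually_proper z hp)).exists
  refine ⟨_, h1, h3, ?_⟩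
  ext a
  rw [mem_zeros, h2]
  constructor
  · rintro ⟨h, h'⟩
    rw [hz' a h] at h'
    by_contra hh
    simp [hh] at h'
  · intro ha
    have := C.mem_zeros.1 (hB ha)
    exact ⟨this, by rw [hz' a this, if_pos ha]⟩

/-- A linear functional attains its maximum over a compact slice of the cone of feasible
functionals, with the first order optimality condition. -/
theorem exists_maximizer (A : Finset ι) (c₁ c₂ : Fin d ⊕ κ → ℝ)
    (hpos : ∀ y, C.Feas y → (∀ a ∈ A, y ⬝ᵥ C.vec a = 0) → y ≠ 0 → 0 < y ⬝ᵥ c₁)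
    (hne : ∃ y, C.Feas y ∧ (∀ a ∈ A, y ⬝ᵥ C.vec a = 0) ∧ y ≠ 0) :
    ∃ y, C.Feas y ∧ (∀ a ∈ A, y ⬝ᵥ C.vec a = 0) ∧ y ⬝ᵥ c₁ = 1 ∧
      (∀ x, C.Feas x → (∀ a ∈ A, x ⬝ᵥ C.vec a = 0) → x ⬝ᵥ c₂ ≤ (y ⬝ᵥ c₂) * (x ⬝ᵥ c₁)) ∧
      ∀ z, (∀ a, y ⬝ᵥ C.vec a = 0 → 0 ≤ z ⬝ᵥ C.vec a) → (∀ a ∈ A, z ⬝ᵥ C.vec a = 0) →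
        z ⬝ᵥ c₂ ≤ (y ⬝ᵥ c₂) * (z ⬝ᵥ c₁) := by
  have hsmul : ∀ (t : ℝ) x, 0 ≤ t → C.Feas x → C.Feas (t • x) := fun t x ht hx a => by
    rw [smul_dotProduct]; exact mul_nonneg ht (hx a)
  have hsmul0 : ∀ (t : ℝ) x, (∀ a ∈ A, x ⬝ᵥ C.vec a = 0) → ∀ a ∈ A, (t • x) ⬝ᵥ C.vec a = 0 :=
    fun t x hx a ha => by rw [smul_dotProduct, hx a ha, smul_zero]
  let K : Set (Fin d ⊕ κ → ℝ) := {y | C.Feas y ∧ ∀ a ∈ A, y ⬝ᵥ C.vec a = 0}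
  have hK : IsClosed K := by
    have : K = (⋂ a, {y | 0 ≤ y ⬝ᵥ C.vec a}) ∩ ⋂ a ∈ A, {y | y ⬝ᵥ C.vec a = 0} := by
      ext; simp [K, Feas]
    rw [this]
    refine (isClosed_iInter fun a => isClosed_le continuous_const
      (continuous_dotProduct_right _)).inter (isClosed_biInter fun a _ => isClosed_eq
      (continuous_dotProduct_right _) continuous_const)
  have hcpt : IsCompact (Metric.sphere (0 : Fin d ⊕ κ → ℝ) 1 ∩ K) :=
    (isCompact_sphere _ _).inter_right hK
  have hnorm : ∀ x ∈ K, x ≠ 0 → ‖x‖⁻¹ • x ∈ Metric.sphere (0 : Fin d ⊕ κ → ℝ) 1 ∩ K :=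
    fun x hx h0 => ⟨by simp [norm_smul, h0],
      hsmul _ _ (by positivity) hx.1, hsmul0 _ _ hx.2⟩
  have hne0 : ∀ x ∈ Metric.sphere (0 : Fin d ⊕ κ → ℝ) 1 ∩ K, x ≠ 0 := by
    rintro x ⟨hx, -⟩ rfl
    simp at hx
  obtain ⟨y₀, hy₀, hmax⟩ := hcpt.exists_isMaxOn
    (f := fun x => (x ⬝ᵥ c₂) / (x ⬝ᵥ c₁)) (by
      obtain ⟨y, h1, h2, h3⟩ := hne
      exact ⟨_, hnorm y ⟨h1, h2⟩ h3⟩)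
    ((continuous_dotProduct_right _).continuousOn.div
      (continuous_dotProduct_right _).continuousOn
      fun x hx => (hpos x hx.2.1 hx.2.2 (hne0 x hx)).ne')
  have hp := hpos y₀ hy₀.2.1 hy₀.2.2 (hne0 y₀ hy₀)
  have key : ∀ x, C.Feas x → (∀ a ∈ A, x ⬝ᵥ C.vec a = 0) →
      x ⬝ᵥ c₂ ≤ (((y₀ ⬝ᵥ c₁)⁻¹ • y₀) ⬝ᵥ c₂) * (x ⬝ᵥ c₁) := by
    intro x hx hxA
    by_cases h0 : x = 0
    · simp [h0]
    have hx1 := hpos x hx hxA h0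
    have := hmax (hnorm x ⟨hx, hxA⟩ h0)
    simp only [Set.mem_ofPred_eq, smul_dotProduct, smul_eq_mul] at this ⊢
    have hn : ‖x‖⁻¹ ≠ 0 := by simpa using h0
    rw [mul_div_mul_left _ _ hn, div_le_iff₀ hx1] at this
    calc x ⬝ᵥ c₂ ≤ _ := this
      _ = _ := by ring
  refine ⟨(y₀ ⬝ᵥ c₁)⁻¹ • y₀, hsmul _ _ (by positivity) hy₀.2.1, hsmul0 _ _ hy₀.2.2, ?_, key, ?_⟩
  · rw [smul_dotProduct, smul_eq_mul, inv_mul_cancel₀ hp.ne']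
  · intro z hz hzA
    obtain ⟨ε, ⟨h1, -⟩, h2⟩ := ((eventually_perturb
      (hsmul ((y₀ ⬝ᵥ c₁)⁻¹) _ (by positivity) hy₀.2.1) hz).and
      (self_mem_nhdsWithin)).exists
    have h2 : (0 : ℝ) < ε := h2
    have := key _ h1 (fun a ha => by
      rw [add_dotProduct, hsmul0 _ _ hy₀.2.2 a ha, smul_dotProduct, hzA a ha]; simp)
    set y := (y₀ ⬝ᵥ c₁)⁻¹ • y₀
    have hy1 : y ⬝ᵥ c₁ = 1 := by
      simp only [y]; rw [smul_dotProduct, smul_eq_mul, inv_mul_cancel₀ hp.ne']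
    clear_value y
    rw [add_dotProduct, add_dotProduct, hy1, smul_dotProduct, smul_dotProduct] at this
    simp only [smul_eq_mul] at this
    have h3 : ε * (z ⬝ᵥ c₂) ≤ ε * ((y ⬝ᵥ c₂) * (z ⬝ᵥ c₁)) := by linarith
    exact le_of_mul_le_mul_left h3 h2

end ColConfig

end Config

section Sweep

open Polynomial

theorem sum_Icc_pow_mul_pow {ι : Type*} [DecidableEq ι] {N T : Finset ι} (h : N ⊆ T) {j : ℕ}
    (hj : j ≤ N.card) :
    ∑ A ∈ Icc N T, (X : ℤ[X]) ^ (A.card - j) * (1 - X) ^ (T.card - A.card) =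
      X ^ (N.card - j) := by
  rw [Finset.Icc_eq_image_powerset h, sum_image]
  · have h1 : ∀ B ∈ (T \ N).powerset, (X : ℤ[X]) ^ ((N ∪ B).card - j) *
        (1 - X) ^ (T.card - (N ∪ B).card) =
        X ^ (N.card - j) * (X ^ B.card * (1 - X) ^ ((T \ N).card - B.card)) := by
      intro B hB
      have hB := mem_powerset.1 hB
      have hd : Disjoint N B := disjoint_of_subset_right hB disjoint_sdiff
      have h2 := card_le_card hB
      rw [card_union_of_disjoint hd, card_sdiff_of_subset h, ← mul_assoc, ← pow_add]
      congr 2 <;> omega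
    rw [sum_congr rfl h1, ← mul_sum, Finset.sum_pow_mul_eq_add_pow]
    simp
  · intro A hA B hB hAB
    have hA : A ⊆ T \ N := mem_powerset.1 hA
    have hB : B ⊆ T \ N := mem_powerset.1 hB
    have hAB : N ∪ A = N ∪ B := hAB
    ext a
    have := congrArg (a ∈ ·) hAB
    simp only [mem_union, eq_iff_iff] at this
    constructor
    · intro ha
      have := this.1 (Or.inr ha)
      exact this.resolve_left (mem_sdiff.1 (hA ha)).2
    · intro ha
      have := this.2 (Or.inr ha)
      exact this.resolve_left (mem_sdiff.1 (hB ha)).2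

theorem reflect_sum_X_pow {α : Type*} (s : Finset α) (f : α → ℕ) (D : ℕ)
    (hf : ∀ a ∈ s, f a ≤ D) :
    reflect D (∑ a ∈ s, (X : ℤ[X]) ^ f a) = ∑ a ∈ s, X ^ (D - f a) := by
  classical
  induction s using Finset.induction_on with
  | empty => simp
  | insert a s ha ih =>
    rw [sum_insert ha, sum_insert ha, reflect_add, ih fun b hb => hf b (mem_insert_of_mem hb),
      reflect_monomial, revAt_le (hf a (mem_insert_self _ _))]

namespace ColConfig

variable {d : ℕ} {κ ι : Type*} [Fintype κ] [DecidableEq κ] [Fintype ι] [DecidableEq ι]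
  {C : ColConfig d κ ι}

open scoped Classical in
/-- The faces with as many elements as possible. -/
def facets (C : ColConfig d κ ι) : Finset (Finset ι) :=
  univ.filter fun T => C.IsFace T ∧ T.card + 1 = d + Fintype.card κ

open scoped Classical in
/-- The faces `A` such that `c` is positive on the nonzero feasible functionals vanishing
on `A`. -/
def posFaces (C : ColConfig d κ ι) (c : Fin d ⊕ κ → ℝ) : Finset (Finset ι) :=
  univ.filter fun A => C.IsFace A ∧
    ∀ y, C.Feas y → (∀ a ∈ A, y ⬝ᵥ C.vec a = 0) → y ⬝ᵥ c = 0 → y = 0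

theorem mem_facets {T : Finset ι} :
    T ∈ C.facets ↔ C.IsFace T ∧ T.card + 1 = d + Fintype.card κ := by simp [facets]

theorem mem_posFaces {A : Finset ι} {c : Fin d ⊕ κ → ℝ} : A ∈ C.posFaces c ↔ C.IsFace A ∧
    ∀ y, C.Feas y → (∀ a ∈ A, y ⬝ᵥ C.vec a = 0) → y ⬝ᵥ c = 0 → y = 0 := by simp [posFaces]

/-- A pair of functionals on the dual cone whose pencil is in general position. -/
structure Sweep (C : ColConfig d κ ι) (c₁ c₂ : Fin d ⊕ κ → ℝ) : Prop where
  gen : C.Gen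
  nonneg₁ : ∀ y, C.Feas y → 0 ≤ y ⬝ᵥ c₁
  nonneg₂ : ∀ y, C.Feas y → 0 ≤ y ⬝ᵥ c₂
  pos₁ : ∀ y, C.Feas y → Proper y → 0 < y ⬝ᵥ c₁
  pos₂ : ∀ y, C.Feas y → Proper y → 0 < y ⬝ᵥ c₂
  span : ∀ ρ : ℝ, 0 < ρ → ∀ S, c₁ - ρ • c₂ ∈ C.spn S →
    (∀ c, c ∈ C.colors S) ∧ d + Fintype.card κ ≤ Module.finrank ℝ (C.spn S) + 1

namespace Sweep

variable {c₁ c₂ : Fin d ⊕ κ → ℝ}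

theorem symm (h : C.Sweep c₁ c₂) : C.Sweep c₂ c₁ where
  gen := h.gen
  nonneg₁ := h.nonneg₂
  nonneg₂ := h.nonneg₁
  pos₁ := h.pos₂
  pos₂ := h.pos₁
  span ρ hρ S hS := by
    refine h.span ρ⁻¹ (by positivity) S ?_
    have : c₁ - ρ⁻¹ • c₂ = (-ρ⁻¹) • (c₂ - ρ • c₁) := by
      rw [smul_sub, smul_smul, neg_mul, inv_mul_cancel₀ hρ.ne']
      simp [sub_eq_add_neg, add_comm]
    rw [this]
    exact Submodule.smul_mem _ _ hS

theorem eq_smul_of_vanish (h : C.Sweep c₁ c₂) {T : Finset ι} (hT : T ∈ C.facets)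
    {y z : Fin d ⊕ κ → ℝ} (hy : C.Feas y) (hp : Proper y) (hy0 : ∀ a ∈ T, y ⬝ᵥ C.vec a = 0)
    (hz : ∀ a ∈ T, z ⬝ᵥ C.vec a = 0) : z = ((z ⬝ᵥ c₁) / (y ⬝ᵥ c₁)) • y := by
  obtain ⟨hT, hcard⟩ := mem_facets.1 hT
  have hpos := h.pos₁ y hy hp
  have htop : C.spn T ⊔ Submodule.span ℝ {c₁} = ⊤ := by
    apply Submodule.eq_top_of_finrank_eq
    have h1 : C.spn T < C.spn T ⊔ Submodule.span ℝ {c₁} := by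
      refine lt_of_le_of_ne le_sup_left fun he => ?_
      have : c₁ ∈ C.spn T := by
        rw [he]; exact Submodule.mem_sup_right (Submodule.mem_span_singleton_self _)
      exact hpos.ne' (dotProduct_eq_zero_of_mem_span this hy0)
    have h2 := Submodule.finrank_lt_finrank_of_lt h1
    have h3 : Module.finrank ℝ (C.spn T) = T.card := (h.gen.indep hT).finrank_span_image
    have h4 := Submodule.finrank_le (C.spn T ⊔ Submodule.span ℝ {c₁})
    have h5 : Module.finrank ℝ (Fin d ⊕ κ → ℝ) = d + Fintype.card κ := by simp
    omega
  set x := z - ((z ⬝ᵥ c₁) / (y ⬝ᵥ c₁)) • y with hx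
  have hxT : ∀ a ∈ T, x ⬝ᵥ C.vec a = 0 := fun a ha => by
    rw [hx, sub_dotProduct, smul_dotProduct, hz a ha, hy0 a ha]; simp
  have hxc : x ⬝ᵥ c₁ = 0 := by
    rw [hx, sub_dotProduct, smul_dotProduct, smul_eq_mul, div_mul_cancel₀ _ hpos.ne', sub_self]
  have : x = 0 := by
    refine dotProduct_eq_zero x fun w => ?_
    have hw : w ∈ C.spn T ⊔ Submodule.span ℝ {c₁} := htop ▸ Submodule.mem_top
    obtain ⟨u, hu, v, hv, rfl⟩ := Submodule.mem_sup.1 hw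
    obtain ⟨t, rfl⟩ := Submodule.mem_span_singleton.1 hv
    rw [dotProduct_add, dotProduct_smul, hxc, dotProduct_eq_zero_of_mem_span hu hxT]
    simp
  exact sub_eq_zero.1 this

theorem exists_coeff (h : C.Sweep c₁ c₂) {T : Finset ι} (hT : T ∈ C.facets) :
    ∃ ρ : ℝ, 0 < ρ ∧ ∃ μ : ι → ℝ, c₁ = ρ • c₂ + ∑ a ∈ T, μ a • C.vec a ∧ ∀ a ∈ T, μ a ≠ 0 := by
  obtain ⟨hT', hcard⟩ := mem_facets.1 hT
  obtain ⟨y, hy, hp, rfl⟩ := hT'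
  have h1 := h.pos₁ y hy hp
  have h2 := h.pos₂ y hy hp
  have hρ : 0 < (y ⬝ᵥ c₁) / (y ⬝ᵥ c₂) := by positivity
  have hmem : c₁ - ((y ⬝ᵥ c₁) / (y ⬝ᵥ c₂)) • c₂ ∈ C.spn (C.zeros y) := by
    refine mem_span_image_of_forall fun z hz => ?_
    rw [h.eq_smul_of_vanish hT hy hp (fun a ha => C.mem_zeros.1 ha) hz, smul_dotProduct,
      dotProduct_sub, dotProduct_smul, smul_eq_mul, smul_eq_mul, div_mul_cancel₀ _ h2.ne', sub_self, mul_zero]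
  obtain ⟨μ, hμ⟩ := exists_sum_of_mem_span hmem
  refine ⟨_, hρ, μ, by rw [← hμ]; abel, fun a ha h0 => ?_⟩
  have hmem' : c₁ - ((y ⬝ᵥ c₁) / (y ⬝ᵥ c₂)) • c₂ ∈ C.spn ((C.zeros y).erase a) := by
    rw [hμ, ← Finset.add_sum_erase _ _ ha, h0, zero_smul, zero_add]
    exact Submodule.sum_mem _ fun b hb => Submodule.smul_mem _ _ (C.vec_mem_spn hb)
  have h3 := (h.span _ hρ _ hmem').2
  have h4 : Module.finrank ℝ (C.spn ((C.zeros y).erase a)) ≤ _ := finrank_span_image_le _ _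
  rw [card_erase_of_mem ha] at h4
  have := card_pos.2 ⟨a, ha⟩
  omega

variable {ρ : Finset ι → ℝ} {μ : Finset ι → ι → ℝ}

theorem dot_eq {T : Finset ι} (hμ : c₁ = ρ T • c₂ + ∑ a ∈ T, μ T a • C.vec a)
    (y : Fin d ⊕ κ → ℝ) :
    y ⬝ᵥ c₁ = ρ T * (y ⬝ᵥ c₂) + ∑ a ∈ T, μ T a * (y ⬝ᵥ C.vec a) := by
  conv_lhs => rw [hμ]
  rw [dotProduct_add, dotProduct_smul, dotProduct_sum]
  simp [dotProduct_smul]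

theorem nonneg_term {T A : Finset ι} {μ : ι → ℝ} (hN : (T.filter fun a => μ a < 0) ⊆ A)
    {y : Fin d ⊕ κ → ℝ} (hy : C.Feas y) (hyA : ∀ a ∈ A, y ⬝ᵥ C.vec a = 0) :
    ∀ a ∈ T, 0 ≤ μ a * (y ⬝ᵥ C.vec a) := by
  intro a ha
  by_cases h : μ a < 0
  · rw [hyA a (hN (mem_filter.2 ⟨ha, h⟩)), mul_zero]
  · exact mul_nonneg (not_lt.1 h) (hy a)

theorem vanish_of_sum_eq_zero {T A : Finset ι} {μ : ι → ℝ} (h0 : ∀ a ∈ T, μ a ≠ 0)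
    (hN : (T.filter fun a => μ a < 0) ⊆ A)
    {y : Fin d ⊕ κ → ℝ} (hy : C.Feas y) (hyA : ∀ a ∈ A, y ⬝ᵥ C.vec a = 0)
    (hs : ∑ a ∈ T, μ a * (y ⬝ᵥ C.vec a) = 0) : ∀ a ∈ T, y ⬝ᵥ C.vec a = 0 := by
  intro a ha
  have := (sum_eq_zero_iff_of_nonneg (nonneg_term hN hy hyA)).1 hs a ha
  exact (mul_eq_zero.1 this).resolve_left (h0 a ha)

theorem exists_facet (h : C.Sweep c₁ c₂) (hρ : ∀ T ∈ C.facets, 0 < ρ T)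
    (hμ : ∀ T ∈ C.facets, c₁ = ρ T • c₂ + ∑ a ∈ T, μ T a • C.vec a)
    {A : Finset ι} (hA : A ∈ C.posFaces c₁) :
    ∃ T ∈ C.facets, (T.filter fun a => μ T a < 0) ⊆ A ∧ A ⊆ T := by
  obtain ⟨hA, hA'⟩ := mem_posFaces.1 hA
  obtain ⟨x, hx, hxp, hxA⟩ := hA
  have hxA' : ∀ a ∈ A, x ⬝ᵥ C.vec a = 0 := fun a ha => C.mem_zeros.1 (hxA ▸ ha)
  obtain ⟨y, hy, hyA, hy1, hmax, hopt⟩ := exists_maximizer (C := C) A c₁ c₂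
    (fun y hy hyA h0 => (h.nonneg₁ y hy).lt_of_ne' fun hh => h0 (hA' y hy hyA hh))
    ⟨x, hx, hxA', by rintro rfl; obtain ⟨i, hi⟩ := hxp; exact hi rfl⟩
  have hτ : 0 < y ⬝ᵥ c₂ := by
    have h1 := hmax x hx hxA'
    have h2 := h.pos₂ x hx hxp
    have h3 := h.pos₁ x hx hxp
    by_contra! hh
    nlinarith
  have hopt0 : ∀ z, (∀ a ∈ C.zeros y, z ⬝ᵥ C.vec a = 0) → z ⬝ᵥ c₂ = (y ⬝ᵥ c₂) * (z ⬝ᵥ c₁) := by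
    intro z hz
    have h1 := hopt z (fun a ha => (hz a (C.mem_zeros.2 ha)).ge)
      fun a ha => hz a (C.mem_zeros.2 (hyA a ha))
    have h2 := hopt (-z) (fun a ha => by rw [neg_dotProduct, hz a (C.mem_zeros.2 ha)]; simp)
      fun a ha => by rw [neg_dotProduct, hz a (C.mem_zeros.2 (hyA a ha))]; simp
    rw [neg_dotProduct, neg_dotProduct] at h2
    linarith
  obtain ⟨hcol, hrank⟩ := h.span (y ⬝ᵥ c₂)⁻¹ (by positivity) (C.zeros y)
    (mem_span_image_of_forall fun z hz => by
      rw [dotProduct_sub, dotProduct_smul, hopt0 z hz, smul_eq_mul, inv_mul_cancel_left₀ hτ.ne',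
        sub_self])
  have hyp : Proper y := by
    by_contra hnp
    have h0 : ∀ i, y (Sum.inl i) = 0 := fun i => by
      by_contra hi; exact hnp ⟨i, hi⟩
    have : y = 0 := by
      ext j
      rcases j with i | c
      · exact h0 i
      · obtain ⟨a, ha, rfl⟩ := mem_image.1 (hcol c)
        have := C.mem_zeros.1 ha
        rw [dotProduct_vec] at this
        simpa [h0, dotProduct] using this
    rw [this] at hy1
    simp at hy1
  have hZ : C.IsFace (C.zeros y) := ⟨y, hy, hyp, rfl⟩
  have hind := h.gen.indep hZ
  have hfr : Module.finrank ℝ (C.spn (C.zeros y)) = (C.zeros y).card := hind.finrank_span_image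
  have hlt := h.gen.card_lt hZ
  have hle : (C.colors (C.zeros y)).card ≤ Fintype.card κ := card_le_univ _
  have hT : C.zeros y ∈ C.facets := mem_facets.2 ⟨hZ, by omega⟩
  refine ⟨_, hT, fun a ha => ?_, fun a ha => C.mem_zeros.2 (hyA a ha)⟩
  obtain ⟨haZ, hneg⟩ := mem_filter.1 ha
  by_contra haA
  obtain ⟨z, hz⟩ := hind.exists_dotProduct_eq fun b => if b = a then 1 else 0
  have h1 := hopt z (fun b hb => by
      rw [hz b (C.mem_zeros.2 hb)]; split_ifs <;> norm_num)
    fun b hb => by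
      rw [hz b (C.mem_zeros.2 (hyA b hb)), if_neg]
      rintro rfl; exact haA hb
  have h2 := dot_eq (hμ _ hT) y
  have h3 := dot_eq (hμ _ hT) z
  rw [sum_eq_zero fun a ha => by rw [C.mem_zeros.1 ha, mul_zero], hy1, add_zero] at h2
  rw [sum_eq_single_of_mem a haZ fun b hb hba => by rw [hz b hb, if_neg hba, mul_zero],
    hz a haZ, if_pos rfl, mul_one] at h3
  have h4 := hρ _ hT
  have h6 := mul_le_mul_of_nonneg_left h1 h4.le
  rw [← mul_assoc, ← h2, one_mul] at h6
  linarith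

theorem facet_unique (h : C.Sweep c₁ c₂)
    (hμ : ∀ T ∈ C.facets, c₁ = ρ T • c₂ + ∑ a ∈ T, μ T a • C.vec a)
    (h0 : ∀ T ∈ C.facets, ∀ a ∈ T, μ T a ≠ 0)
    {A T T' : Finset ι} (hT : T ∈ C.facets) (hT' : T' ∈ C.facets)
    (hN : (T.filter fun a => μ T a < 0) ⊆ A) (hAT : A ⊆ T)
    (hN' : (T'.filter fun a => μ T' a < 0) ⊆ A) (hAT' : A ⊆ T') : T = T' := by
  obtain ⟨⟨y, hy, hyp, hyT⟩, hc⟩ := mem_facets.1 hT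
  obtain ⟨⟨y', hy', hyp', hyT'⟩, hc'⟩ := mem_facets.1 hT'
  have hz : ∀ a ∈ T, y ⬝ᵥ C.vec a = 0 := fun a ha => C.mem_zeros.1 (hyT ▸ ha)
  have hz' : ∀ a ∈ T', y' ⬝ᵥ C.vec a = 0 := fun a ha => C.mem_zeros.1 (hyT' ▸ ha)
  have e1 := dot_eq (hμ _ hT) y
  have e2 := dot_eq (hμ _ hT) y'
  have e3 := dot_eq (hμ _ hT') y
  have e4 := dot_eq (hμ _ hT') y'
  rw [sum_eq_zero fun a ha => by rw [hz a ha, mul_zero]] at e1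
  rw [sum_eq_zero fun a ha => by rw [hz' a ha, mul_zero]] at e4
  have n2 := sum_nonneg (nonneg_term hN hy' fun a ha => hz' a (hAT' ha))
  have n3 := sum_nonneg (nonneg_term hN' hy fun a ha => hz a (hAT ha))
  have p := h.pos₂ y hy hyp
  have p' := h.pos₂ y' hy' hyp'
  have l1 : ρ T ≤ ρ T' := le_of_mul_le_mul_right (by linarith) p'
  have l2 : ρ T' ≤ ρ T := le_of_mul_le_mul_right (by linarith) p
  have l3 : ρ T = ρ T' := le_antisymm l1 l2
  rw [l3] at e2
  have hv := vanish_of_sum_eq_zero (h0 _ hT) hN hy' (fun a ha => hz' a (hAT' ha)) (by linarith)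
  refine eq_of_subset_of_card_le (fun a ha => ?_) (by omega)
  rw [← hyT']
  exact C.mem_zeros.2 (hv a ha)

theorem mem_posFaces_of_facet (h : C.Sweep c₁ c₂) (hρ : ∀ T ∈ C.facets, 0 < ρ T)
    (hμ : ∀ T ∈ C.facets, c₁ = ρ T • c₂ + ∑ a ∈ T, μ T a • C.vec a)
    (h0 : ∀ T ∈ C.facets, ∀ a ∈ T, μ T a ≠ 0)
    {A T : Finset ι} (hT : T ∈ C.facets)
    (hN : (T.filter fun a => μ T a < 0) ⊆ A) (hAT : A ⊆ T) : A ∈ C.posFaces c₁ := by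
  obtain ⟨hF, hc⟩ := mem_facets.1 hT
  refine mem_posFaces.2 ⟨h.gen.isFace_subset hF hAT, fun y hy hyA hy1 => ?_⟩
  have e := dot_eq (hμ _ hT) y
  have n := sum_nonneg (nonneg_term hN hy hyA)
  have p := mul_nonneg (hρ _ hT).le (h.nonneg₂ y hy)
  have hv := vanish_of_sum_eq_zero (h0 _ hT) hN hy hyA (by linarith)
  obtain ⟨x, hx, hxp, hxT⟩ := hF
  have := h.eq_smul_of_vanish hT hx hxp (fun a ha => C.mem_zeros.1 (hxT ▸ ha)) hv
  rw [this, hy1, zero_div, zero_smul]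

theorem posFaces_eq (h : C.Sweep c₁ c₂) (hρ : ∀ T ∈ C.facets, 0 < ρ T)
    (hμ : ∀ T ∈ C.facets, c₁ = ρ T • c₂ + ∑ a ∈ T, μ T a • C.vec a)
    (h0 : ∀ T ∈ C.facets, ∀ a ∈ T, μ T a ≠ 0) :
    C.posFaces c₁ = C.facets.biUnion fun T => Icc (T.filter fun a => μ T a < 0) T := by
  ext A
  simp only [mem_biUnion, mem_Icc]
  constructor
  · intro hA
    exact h.exists_facet hρ hμ hA
  · rintro ⟨T, hT, h1, h2⟩
    exact h.mem_posFaces_of_facet hρ hμ h0 hT h1 h2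

theorem sum_posFaces (h : C.Sweep c₁ c₂) (hρ : ∀ T ∈ C.facets, 0 < ρ T)
    (hμ : ∀ T ∈ C.facets, c₁ = ρ T • c₂ + ∑ a ∈ T, μ T a • C.vec a)
    (h0 : ∀ T ∈ C.facets, ∀ a ∈ T, μ T a ≠ 0) (f : Finset ι → ℤ[X]) :
    ∑ A ∈ C.posFaces c₁, f A =
      ∑ T ∈ C.facets, ∑ A ∈ Icc (T.filter fun a => μ T a < 0) T, f A := by
  rw [h.posFaces_eq hρ hμ h0, sum_biUnion]
  intro T hT T' hT' hne
  refine disjoint_left.2 fun A hA hA' => hne ?_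
  rw [mem_Icc] at hA hA'
  exact h.facet_unique hμ h0 hT hT' hA.1 hA.2 hA'.1 hA'.2

theorem reflect_posFaces (h : C.Sweep c₁ c₂) {D : ℕ} (hD : D + 1 = d + Fintype.card κ) :
    reflect D (∑ A ∈ C.posFaces c₁, (X : ℤ[X]) ^ A.card * (1 - X) ^ (D - A.card)) =
      ∑ A ∈ C.posFaces c₂, (X : ℤ[X]) ^ A.card * (1 - X) ^ (D - A.card) := by
  choose! ρ hρ μ hμ h0 using fun T (hT : T ∈ C.facets) => h.exists_coeff hT
  have hcard : ∀ T ∈ C.facets, T.card = D := fun T hT => by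
    have := (mem_facets.1 hT).2; omega
  have key : ∀ T ∈ C.facets, ∀ N ⊆ T,
      ∑ A ∈ Icc N T, (X : ℤ[X]) ^ A.card * (1 - X) ^ (D - A.card) = X ^ N.card := by
    intro T hT N hN
    have := sum_Icc_pow_mul_pow hN (Nat.zero_le _)
    rwa [hcard T hT] at this
  rw [h.sum_posFaces hρ hμ h0, h.symm.sum_posFaces (ρ := fun T => (ρ T)⁻¹)
    (μ := fun T a => - (ρ T)⁻¹ * μ T a) (fun T hT => inv_pos.2 (hρ T hT)),
    sum_congr rfl fun T hT => key T hT _ (filter_subset _ _),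
    sum_congr rfl fun T hT => key T hT _ (filter_subset _ _),
    reflect_sum_X_pow]
  · refine sum_congr rfl fun T hT => ?_
    congr 1
    have hsplit := card_filter_add_card_filter_not (s := T) (fun a => μ T a < 0)
    rw [hcard T hT] at hsplit
    have : (T.filter fun a => - (ρ T)⁻¹ * μ T a < 0) = T.filter fun a => ¬ μ T a < 0 := by
      refine filter_congr fun a ha => ?_
      have h1 := inv_pos.2 (hρ T hT)
      have h2 := h0 T hT a ha
      constructor
      · intro h3 h4
        nlinarith
      · intro h3
        have : 0 < μ T a := (not_lt.1 h3).lt_of_ne' h2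
        nlinarith
    rw [this]
    omega
  · intro T hT
    rw [← hcard T hT]
    exact card_filter_le _ _
  · intro T hT
    have h1 := (hρ T hT).ne'
    have h2 := hμ T hT
    have h3 : ∑ a ∈ T, (-(ρ T)⁻¹ * μ T a) • C.vec a =
        (-(ρ T)⁻¹) • ∑ a ∈ T, μ T a • C.vec a := by
      rw [smul_sum]; simp only [smul_smul]
    rw [h3]
    conv_rhs => rw [h2]
    rw [smul_add, smul_smul, inv_mul_cancel₀ h1, one_smul, neg_smul, add_assoc, add_neg_cancel,
      add_zero]
  · intro T hT a ha
    exact mul_ne_zero (neg_ne_zero.2 (inv_ne_zero (hρ T hT).ne')) (h0 T hT a ha)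

theorem coeff_link_le (h : C.Sweep c₁ c₂) {D : ℕ} (hD : D + 1 = d + Fintype.card κ) (v : ι)
    (hv : ∀ T ∈ C.facets, v ∈ T → ∀ ρ : ℝ, 0 < ρ → ∀ μ : ι → ℝ,
      c₁ = ρ • c₂ + ∑ a ∈ T, μ a • C.vec a → 0 ≤ μ v) (k : ℕ) :
    (∑ A ∈ C.posFaces c₁ with v ∈ A, (X : ℤ[X]) ^ (A.card - 1) * (1 - X) ^ (D - A.card)).coeff k ≤
      (∑ A ∈ C.posFaces c₁, (X : ℤ[X]) ^ A.card * (1 - X) ^ (D - A.card)).coeff k := by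
  choose! ρ hρ μ hμ h0 using fun T (hT : T ∈ C.facets) => h.exists_coeff hT
  have hcard : ∀ T ∈ C.facets, T.card = D := fun T hT => by
    have := (mem_facets.1 hT).2; omega
  rw [sum_filter, h.sum_posFaces hρ hμ h0, h.sum_posFaces hρ hμ h0, finsetSum_coeff,
    finsetSum_coeff]
  refine sum_le_sum fun T hT => ?_
  have key := sum_Icc_pow_mul_pow (filter_subset (fun a => μ T a < 0) T) (Nat.zero_le _)
  rw [hcard T hT] at key
  simp only [Nat.sub_zero] at key
  rw [key, ← sum_filter]
  by_cases hvT : v ∈ T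
  · have hnot : v ∉ T.filter fun a => μ T a < 0 := by
      rw [mem_filter, not_and, not_lt]
      exact fun _ => hv T hT hvT _ (hρ T hT) _ (hμ T hT)
    have hI : (Icc (T.filter fun a => μ T a < 0) T).filter (fun A => v ∈ A) =
        Icc (insert v (T.filter fun a => μ T a < 0)) T := by
      ext A
      simp only [mem_filter, mem_Icc, insert_subset_iff]
      tauto
    have key' := sum_Icc_pow_mul_pow (N := insert v (T.filter fun a => μ T a < 0)) (T := T)
      (insert_subset hvT (filter_subset _ _)) (j := 1) (by rw [card_insert_of_notMem hnot]; omega)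
    rw [hcard T hT, card_insert_of_notMem hnot, Nat.add_sub_cancel] at key'
    rw [hI, key']
  · have hI : (Icc (T.filter fun a => μ T a < 0) T).filter (fun A => v ∈ A) = ∅ := by
      refine filter_eq_empty_iff.2 fun A hA hvA => hvT ((mem_Icc.1 hA).2 hvA)
    rw [hI, sum_empty, coeff_zero, coeff_X_pow]
    split_ifs <;> norm_num

end Sweep

end ColConfig

end Sweep

section Generic

open Polynomial Filter Topology

namespace ColConfig

variable {d : ℕ} {κ ι : Type*} [Fintype κ] [DecidableEq κ] [Fintype ι] [DecidableEq ι]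
  {C : ColConfig d κ ι}

/-- The members of colour `c`. -/
def cls (C : ColConfig d κ ι) (c : κ) : Finset ι := univ.filter fun a => C.col a = c

theorem mem_cls {c : κ} {a : ι} : a ∈ C.cls c ↔ C.col a = c := by simp [cls]

/-- Every colour is used at least `d + 1` times. -/
def Full (C : ColConfig d κ ι) : Prop := ∀ c, d + 1 ≤ (C.cls c).card

theorem Full.colors_cls (hF : C.Full) (c : κ) : C.colors (C.cls c) = {c} := by
  ext b
  simp only [colors, mem_image, mem_cls, mem_singleton]
  constructor
  · rintro ⟨a, rfl, rfl⟩; rfl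
  · rintro rfl
    obtain ⟨a, ha⟩ := card_pos.1 (show 0 < (C.cls b).card by have := hF b; omega)
    exact ⟨a, mem_cls.1 ha, mem_cls.1 ha⟩

theorem Gen.not_proper_of_cls (hC : C.Gen) (hF : C.Full) (c : κ) {y : Fin d ⊕ κ → ℝ}
    (hy : ∀ a ∈ C.cls c, y ⬝ᵥ C.vec a = 0) : ¬ Proper y :=
  hC.not_proper_of_vanish (by rw [hF.colors_cls, card_singleton]; exact hF c) hy

theorem eq_zero_of_not_proper {y : Fin d ⊕ κ → ℝ} (hp : ¬ Proper y)
    (h : ∀ c, ∃ a, C.col a = c ∧ y ⬝ᵥ C.vec a = 0) : y = 0 := by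
  have h0 : ∀ i, y (Sum.inl i) = 0 := fun i => by
    by_contra hi; exact hp ⟨i, hi⟩
  ext j
  rcases j with i | c
  · exact h0 i
  · obtain ⟨a, rfl, ha⟩ := h c
    rw [dotProduct_vec] at ha
    simpa [h0, dotProduct] using ha

/-- The weighted sum of all Cayley lifts. -/
def comb (C : ColConfig d κ ι) (γ : ι → ℝ) : Fin d ⊕ κ → ℝ := ∑ a, γ a • C.vec a

theorem dotProduct_comb (γ : ι → ℝ) (y : Fin d ⊕ κ → ℝ) :
    y ⬝ᵥ C.comb γ = ∑ a, γ a * (y ⬝ᵥ C.vec a) := by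
  simp [comb, dotProduct_sum, dotProduct_smul]

/-- The weight function `γ` is nonnegative with support the colours in `J`. -/
def SuppOn (C : ColConfig d κ ι) (γ : ι → ℝ) (J : Finset κ) : Prop :=
  ∀ a, (C.col a ∈ J → 0 < γ a) ∧ (C.col a ∉ J → γ a = 0)

variable {γ : ι → ℝ} {J : Finset κ}

theorem SuppOn.nonneg (hγ : C.SuppOn γ J) (a : ι) : 0 ≤ γ a := by
  by_cases h : C.col a ∈ J
  · exact ((hγ a).1 h).le
  · exact ((hγ a).2 h).ge

theorem SuppOn.dot_nonneg (hγ : C.SuppOn γ J) {y : Fin d ⊕ κ → ℝ} (hy : C.Feas y) :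
    0 ≤ y ⬝ᵥ C.comb γ := by
  rw [dotProduct_comb]
  exact sum_nonneg fun a _ => mul_nonneg (hγ.nonneg a) (hy a)

theorem SuppOn.vanish (hγ : C.SuppOn γ J) {y : Fin d ⊕ κ → ℝ} (hy : C.Feas y)
    (h : y ⬝ᵥ C.comb γ = 0) {a : ι} (ha : C.col a ∈ J) : y ⬝ᵥ C.vec a = 0 := by
  rw [dotProduct_comb] at h
  have := (sum_eq_zero_iff_of_nonneg fun a _ => mul_nonneg (hγ.nonneg a) (hy a)).1 h a
    (mem_univ a)
  exact (mul_eq_zero.1 this).resolve_left ((hγ a).1 ha).ne'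

theorem SuppOn.dot_pos (hγ : C.SuppOn γ J) (hC : C.Gen) (hF : C.Full) (hJ : J.Nonempty)
    {y : Fin d ⊕ κ → ℝ} (hy : C.Feas y) (hp : Proper y) : 0 < y ⬝ᵥ C.comb γ := by
  refine (hγ.dot_nonneg hy).lt_of_ne' fun h => ?_
  obtain ⟨c, hc⟩ := hJ
  refine hC.not_proper_of_cls hF c (fun a ha => hγ.vanish hy h ?_) hp
  rwa [mem_cls.1 ha]

theorem SuppOn.mem_posFaces (hγ : C.SuppOn γ J) (hC : C.Gen) (hF : C.Full) (hJ : J.Nonempty)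
    {A : Finset ι} : A ∈ C.posFaces (C.comb γ) ↔ C.IsFace A ∧ ∀ c, c ∈ J ∨ c ∈ C.colors A := by
  rw [ColConfig.mem_posFaces]
  refine and_congr_right fun _ => ⟨fun h c => ?_, fun h y hy hyA h0 => ?_⟩
  · by_contra! hc
    have hval : ∀ a, (Pi.single (Sum.inr c) 1 : Fin d ⊕ κ → ℝ) ⬝ᵥ C.vec a =
        if C.col a = c then 1 else 0 := by
      intro a
      simp [vec, Pi.single_apply, eq_comm]
    have := h (Pi.single (Sum.inr c) 1) (fun a => by rw [hval]; split_ifs <;> norm_num)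
      (fun a ha => by
        rw [hval, if_neg]
        rintro rfl
        exact hc.2 (C.col_mem_colors ha))
      (by
        rw [dotProduct_comb]
        refine sum_eq_zero fun a _ => ?_
        rw [hval]
        split_ifs with h'
        · rw [(hγ a).2 (by rw [h']; exact hc.1), zero_mul]
        · rw [mul_zero])
    simpa using congrFun this (Sum.inr c)
  · obtain ⟨c₀, hc₀⟩ := hJ
    refine eq_zero_of_not_proper (C := C) (hC.not_proper_of_cls hF c₀ fun a ha =>
      hγ.vanish hy h0 (by rwa [mem_cls.1 ha])) fun c => ?_
    rcases h c with hc | hc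
    · obtain ⟨a, ha⟩ := card_pos.1 (show 0 < (C.cls c).card by have := hF c; omega)
      have ha := mem_cls.1 ha
      exact ⟨a, ha, hγ.vanish hy h0 (by rwa [ha])⟩
    · obtain ⟨a, ha, rfl⟩ := mem_image.1 hc
      exact ⟨a, rfl, hyA a ha⟩

theorem comb_inr (γ : ι → ℝ) (c : κ) : C.comb γ (Sum.inr c) = ∑ a ∈ C.cls c, γ a := by
  simp [comb, vec, cls, sum_filter, Pi.single_apply, eq_comm]

theorem inr_eq_zero_of_mem_spn {S : Finset ι} {c : κ} (hc : c ∉ C.colors S)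
    {x : Fin d ⊕ κ → ℝ} (hx : x ∈ C.spn S) : x (Sum.inr c) = 0 := by
  have := dotProduct_eq_zero_of_mem_span hx (z := Pi.single (Sum.inr c) 1) fun a ha => by
    have : C.col a ≠ c := by rintro rfl; exact hc (C.col_mem_colors ha)
    simp [vec, this.symm]
  simpa using this

/-- A weight concentrated near `v` and supported on its colour. -/
def wt (C : ColConfig d κ ι) (v : ι) (ε : ℝ) (a : ι) : ℝ :=
  if C.col a = C.col v then ε ^ ((Fintype.equivFin ι a : ℕ) + 1) + (if a = v then 1 else 0) else 0

theorem suppOn_wt (v : ι) {ε : ℝ} (hε : 0 < ε) : C.SuppOn (C.wt v ε) {C.col v} := by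
  intro a
  rw [mem_singleton, wt]
  refine ⟨fun h => ?_, fun h => if_neg h⟩
  rw [if_pos h]
  split_ifs <;> positivity

theorem dotProduct_comb_wt (v : ι) (ε : ℝ) (z : Fin d ⊕ κ → ℝ) :
    z ⬝ᵥ C.comb (C.wt v ε) = z ⬝ᵥ C.vec v +
      ∑ a ∈ C.cls (C.col v), ε ^ ((Fintype.equivFin ι a : ℕ) + 1) * (z ⬝ᵥ C.vec a) := by
  rw [dotProduct_comb]
  simp only [wt, ite_mul, zero_mul, ← sum_filter, add_mul, sum_add_distrib, one_mul]
  rw [add_comm]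
  congr 1
  rw [filter_filter]
  rw [sum_eq_single_of_mem v (by simp)]
  intro b hb hbv
  simp [hbv] at hb

theorem tendsto_dotProduct_comb_wt (v : ι) (z : Fin d ⊕ κ → ℝ) :
    Tendsto (fun ε => z ⬝ᵥ C.comb (C.wt v ε)) (𝓝[>] 0) (𝓝 (z ⬝ᵥ C.vec v)) := by
  have h : Continuous fun ε => z ⬝ᵥ C.comb (C.wt v ε) := by
    simp only [dotProduct_comb_wt]; fun_prop
  have := h.tendsto 0
  rw [dotProduct_comb_wt] at this
  simpa using this.mono_left nhdsWithin_le_nhds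

theorem _root_.eventually_sum_pow_ne_zero {α : Type*} (s : Finset α) (g : α → ℝ) (e : α → ℕ)
    (he : Set.InjOn e s) (c : ℝ) {b : α} (hb : b ∈ s) (hg : g b ≠ 0) :
    ∀ᶠ ε in 𝓝[>] (0 : ℝ), c + ∑ a ∈ s, ε ^ (e a + 1) * g a ≠ 0 := by
  set p : ℝ[X] := Polynomial.C c + ∑ a ∈ s, monomial (e a + 1) (g a) with hp
  have hcoeff : p.coeff (e b + 1) = g b := by
    rw [hp, coeff_add, coeff_C_succ, zero_add, finsetSum_coeff, sum_eq_single_of_mem b hb]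
    · simp
    · intro a ha hab
      rw [coeff_monomial, if_neg]
      intro h
      exact hab (he ha hb (by omega))
  have hp0 : p ≠ 0 := by
    intro h; rw [h, coeff_zero] at hcoeff; exact hg hcoeff.symm
  have hfin : (↑p.roots.toFinset : Set ℝ)ᶜ ∪ {0} ∈ 𝓝 (0 : ℝ) := by
    have : ((↑(p.roots.toFinset.erase 0) : Set ℝ)ᶜ) ∈ 𝓝 (0 : ℝ) :=
      (p.roots.toFinset.erase 0).finite_toSet.isClosed.isOpen_compl.mem_nhds (by simp)
    refine mem_of_superset this fun x hx => ?_
    by_cases h0 : x = 0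
    · exact Or.inr h0
    · exact Or.inl fun hh => hx (by simpa [h0] using hh)
  filter_upwards [mem_nhdsWithin_of_mem_nhds hfin, self_mem_nhdsWithin] with ε h1 h2
  have h2 : (0 : ℝ) < ε := h2
  rcases h1 with h1 | h1
  · intro h
    refine h1 ?_
    simp only [mem_coe, Multiset.mem_toFinset, mem_roots hp0, IsRoot.def]
    rw [hp, eval_add, eval_finsetSum, eval_C, ← h]
    simp [mul_comm]
  · exact absurd h1 h2.ne'

theorem Gen.eventually_notMem (hC : C.Gen) (hF : C.Full) (v : ι)
    (L : Submodule ℝ (Fin d ⊕ κ → ℝ))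
    (hL : ∃ i, (Pi.single (Sum.inl i) 1 : Fin d ⊕ κ → ℝ) ∉ L) :
    ∀ᶠ ε in 𝓝[>] (0 : ℝ), C.comb (C.wt v ε) ∉ L := by
  obtain ⟨i, hi⟩ := hL
  obtain ⟨b, hb, hbL⟩ : ∃ b ∈ C.cls (C.col v), C.vec b ∉ L := by
    by_contra! h
    refine hi ((Submodule.span_le.2 ?_ : C.spn (C.cls (C.col v)) ≤ L)
      (hC.single_mem_spn (by rw [hF.colors_cls, card_singleton]; exact hF _) i))
    rintro _ ⟨a, ha, rfl⟩
    exact h a ha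
  obtain ⟨z, hzL, hzb⟩ : ∃ z : Fin d ⊕ κ → ℝ, (∀ u ∈ L, z ⬝ᵥ u = 0) ∧ z ⬝ᵥ C.vec b ≠ 0 := by
    by_contra! h
    exact hbL (mem_of_forall_dotProduct_eq_zero h)
  filter_upwards [eventually_sum_pow_ne_zero (C.cls (C.col v)) (fun a => z ⬝ᵥ C.vec a)
    (fun a => (Fintype.equivFin ι a : ℕ))
    (fun a _ b _ h => (Fintype.equivFin ι).injective (Fin.ext h)) (z ⬝ᵥ C.vec v) hb hzb]
    with ε hε hmem
  apply hε
  rw [← dotProduct_comb_wt]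
  exact hzL _ hmem

/-- The colour set used for the second functional of the sweep. -/
def Opp (c₀ : κ) (J : Finset κ) : Prop :=
  (J = univ.erase c₀ ∧ ∃ c, c ≠ c₀) ∨ (J = univ ∧ ∀ c, c = c₀)

theorem Opp.nonempty {c₀ : κ} {J : Finset κ} (h : Opp c₀ J) : J.Nonempty := by
  rcases h with ⟨rfl, c, hc⟩ | ⟨rfl, h⟩
  · exact ⟨c, by simp [hc]⟩
  · exact ⟨c₀, mem_univ _⟩

/-- The indicator weight of a set of colours. -/
def ind (C : ColConfig d κ ι) (J : Finset κ) (a : ι) : ℝ := if C.col a ∈ J then 1 else 0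

theorem suppOn_ind (J : Finset κ) : C.SuppOn (C.ind J) J := fun a =>
  ⟨fun h => by rw [ind, if_pos h]; exact one_pos, fun h => if_neg h⟩

theorem SuppOn.inr_pos (hγ : C.SuppOn γ J) (hF : C.Full) {c : κ} (hc : c ∈ J) :
    0 < C.comb γ (Sum.inr c) := by
  rw [comb_inr]
  refine sum_pos (fun a ha => (hγ a).1 (by rwa [mem_cls.1 ha])) ?_
  have := hF c
  exact card_pos.1 (by omega)

theorem SuppOn.inr_eq_zero (hγ : C.SuppOn γ J) {c : κ} (hc : c ∉ J) :
    C.comb γ (Sum.inr c) = 0 := by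
  rw [comb_inr]
  exact sum_eq_zero fun a ha => (hγ a).2 (by rwa [mem_cls.1 ha])

theorem Gen.eventually_sweep (hC : C.Gen) (hF : C.Full) (hd : 2 ≤ d) (v : ι) {J : Finset κ}
    (hJ : Opp (C.col v) J) :
    ∀ᶠ ε in 𝓝[>] (0 : ℝ), C.Sweep (C.comb (C.wt v ε)) (C.comb (C.ind J)) := by
  have h1 : ∀ᶠ ε in 𝓝[>] (0 : ℝ), ∀ S : Finset ι,
      (∃ i, (Pi.single (Sum.inl i) 1 : Fin d ⊕ κ → ℝ) ∉
        C.spn S ⊔ Submodule.span ℝ {C.comb (C.ind J)}) →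
      C.comb (C.wt v ε) ∉ C.spn S ⊔ Submodule.span ℝ {C.comb (C.ind J)} := by
    refine eventually_all.2 fun S => ?_
    by_cases h : ∃ i, (Pi.single (Sum.inl i) 1 : Fin d ⊕ κ → ℝ) ∉
        C.spn S ⊔ Submodule.span ℝ {C.comb (C.ind J)}
    · filter_upwards [hC.eventually_notMem hF v _ h] with ε hε _ using hε
    · exact Eventually.of_forall fun ε h' => absurd h' h
  filter_upwards [h1, self_mem_nhdsWithin] with ε hε hpos
  have hpos : (0 : ℝ) < ε := hpos
  have s1 := C.suppOn_wt v hpos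
  have s2 := C.suppOn_ind J
  refine ⟨hC, fun y hy => s1.dot_nonneg hy, fun y hy => s2.dot_nonneg hy,
    fun y hy hp => s1.dot_pos hC hF (singleton_nonempty _) hy hp,
    fun y hy hp => s2.dot_pos hC hF hJ.nonempty hy hp, fun ρ hρ S hS => ?_⟩
  have hmem : C.comb (C.wt v ε) ∈ C.spn S ⊔ Submodule.span ℝ {C.comb (C.ind J)} := by
    have := Submodule.add_mem_sup hS (Submodule.smul_mem _ ρ
      (Submodule.mem_span_singleton_self (C.comb (C.ind J))))
    simpa using this
  have hall : ∀ i, (Pi.single (Sum.inl i) 1 : Fin d ⊕ κ → ℝ) ∈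
        C.spn S ⊔ Submodule.span ℝ {C.comb (C.ind J)} := by
    by_contra! h
    exact hε S h hmem
  have hrank := C.le_finrank_of_forall_mem hall (S := S)
    fun a ha => Submodule.mem_sup_left (C.vec_mem_spn ha)
  have hle := Submodule.finrank_add_le_finrank_add_finrank (C.spn S)
    (Submodule.span ℝ {C.comb (C.ind J)})
  have hle1 : Module.finrank ℝ (Submodule.span ℝ {C.comb (C.ind J)}) ≤ 1 :=
    (finrank_span_le_card _).trans (by simp)
  have hcol : ∀ c, c ∈ C.colors S := by
    by_contra! hc
    obtain ⟨c, hc⟩ := hc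
    have h0 := inr_eq_zero_of_mem_spn hc hS
    rw [Pi.sub_apply, Pi.smul_apply, smul_eq_mul] at h0
    rcases hJ with ⟨rfl, -⟩ | ⟨rfl, hone⟩
    · by_cases hcv : c = C.col v
      · have p1 := s1.inr_pos hF (mem_singleton.2 hcv)
        rw [s2.inr_eq_zero (by simp [hcv])] at h0
        linarith
      · have p1 := s2.inr_pos hF (mem_erase.2 ⟨hcv, mem_univ c⟩)
        rw [s1.inr_eq_zero (by simpa using hcv)] at h0
        nlinarith
    · have hS0 : S = ∅ := by
        refine eq_empty_of_forall_notMem fun a ha => hc ?_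
        rw [hone c, ← hone (C.col a)]
        exact C.col_mem_colors ha
      subst hS0
      have : Module.finrank ℝ (C.spn ∅) ≤ (∅ : Finset ι).card := finrank_span_image_le _ _
      rw [card_empty] at this
      omega
  refine ⟨hcol, ?_⟩
  have : C.colors S = univ := eq_univ_of_forall hcol
  rw [this, card_univ] at hrank
  omega

theorem Gen.eventually_nonneg (hC : C.Gen) (hF : C.Full) (v : ι) {J : Finset κ}
    (hJ : J.Nonempty) :
    ∀ᶠ ε in 𝓝[>] (0 : ℝ), ∀ T ∈ C.facets, v ∈ T → ∀ ρ : ℝ, 0 < ρ → ∀ μ : ι → ℝ,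
      C.comb (C.wt v ε) = ρ • C.comb (C.ind J) + ∑ a ∈ T, μ a • C.vec a → 0 ≤ μ v := by
  refine eventually_all.2 fun T => ?_
  by_cases hT : T ∈ C.facets
  swap
  · exact Eventually.of_forall fun ε h => absurd h hT
  by_cases hv : v ∈ T
  swap
  · exact Eventually.of_forall fun ε _ h => absurd h hv
  obtain ⟨hface, -⟩ := mem_facets.1 hT
  obtain ⟨z, hz⟩ := (hC.indep hface).exists_dotProduct_eq fun a => if a = v then 1 else 0
  obtain ⟨y, hy, hyp, rfl⟩ := hface
  have hp := (C.suppOn_ind J).dot_pos hC hF hJ hy hyp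
  have hlim := ((tendsto_dotProduct_comb_wt (C := C) v z).sub
    (((tendsto_dotProduct_comb_wt (C := C) v y).div_const (y ⬝ᵥ C.comb (C.ind J))).mul_const
      (z ⬝ᵥ C.comb (C.ind J))))
  rw [C.mem_zeros.1 hv, hz v hv, if_pos rfl, zero_div, zero_mul, sub_zero] at hlim
  filter_upwards [hlim.eventually (lt_mem_nhds one_pos)] with ε hε _ _ ρ hρ μ hμ
  have e1 : y ⬝ᵥ C.comb (C.wt v ε) = ρ * (y ⬝ᵥ C.comb (C.ind J)) := by
    rw [hμ, dotProduct_add, dotProduct_smul, dotProduct_sum, sum_eq_zero, add_zero, smul_eq_mul]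
    intro a ha
    rw [dotProduct_smul, C.mem_zeros.1 ha, smul_zero]
  have e2 : z ⬝ᵥ C.comb (C.wt v ε) = ρ * (z ⬝ᵥ C.comb (C.ind J)) + μ v := by
    rw [hμ, dotProduct_add, dotProduct_smul, dotProduct_sum, sum_eq_single_of_mem v hv,
      dotProduct_smul, hz v hv, if_pos rfl, smul_eq_mul, smul_eq_mul, mul_one]
    intro a ha hav
    rw [dotProduct_smul, hz a ha, if_neg hav, smul_zero]
  rw [e1, e2, mul_div_cancel_right₀ _ hp.ne'] at hε
  linarith

open scoped Classical in
/-- The generating polynomial of the faces whose colour set satisfies `P`. -/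
def hpol (C : ColConfig d κ ι) (D : ℕ) (P : Finset κ → Prop) : ℤ[X] :=
  ∑ A : Finset ι with C.IsFace A ∧ P (C.colors A), X ^ A.card * (1 - X) ^ (D - A.card)

open scoped Classical in
/-- The generating polynomial of the link of `v` in the faces whose colour set satisfies `P`. -/
def linkpol (C : ColConfig d κ ι) (D : ℕ) (v : ι) (P : Finset κ → Prop) : ℤ[X] :=
  ∑ A : Finset ι with (C.IsFace A ∧ P (C.colors A)) ∧ v ∈ A,
    X ^ (A.card - 1) * (1 - X) ^ (D - A.card)

theorem hpol_eq_sum {D : ℕ} {P : Finset κ → Prop} {S : Finset (Finset ι)}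
    (hS : ∀ A, A ∈ S ↔ C.IsFace A ∧ P (C.colors A)) :
    C.hpol D P = ∑ A ∈ S, X ^ A.card * (1 - X) ^ (D - A.card) :=
  sum_congr (by ext A; simp [hS]) fun _ _ => rfl

theorem linkpol_eq_sum {D : ℕ} {v : ι} {P : Finset κ → Prop} {S : Finset (Finset ι)}
    (hS : ∀ A, A ∈ S ↔ (C.IsFace A ∧ P (C.colors A)) ∧ v ∈ A) :
    C.linkpol D v P = ∑ A ∈ S, X ^ (A.card - 1) * (1 - X) ^ (D - A.card) :=
  sum_congr (by ext A; simp [hS]) fun _ _ => rfl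

theorem Gen.reflect_hpol (hC : C.Gen) (hF : C.Full) (hd : 2 ≤ d) {D : ℕ}
    (hD : D + 1 = d + Fintype.card κ) (c₀ : κ) {J : Finset κ} (hJ : Opp c₀ J) :
    reflect D (C.hpol D fun Q => ∀ c, c ∈ ({c₀} : Finset κ) ∨ c ∈ Q) =
      C.hpol D fun Q => ∀ c, c ∈ J ∨ c ∈ Q := by
  classical
  obtain ⟨v, hv⟩ := card_pos.1 (show 0 < (C.cls c₀).card by have := hF c₀; omega)
  obtain rfl := mem_cls.1 hv
  obtain ⟨ε, h, hε⟩ := ((hC.eventually_sweep hF hd v hJ).and self_mem_nhdsWithin).exists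
  have := h.reflect_posFaces hD
  rwa [← hpol_eq_sum (P := fun Q => ∀ c, c ∈ ({C.col v} : Finset κ) ∨ c ∈ Q)
      fun A => (C.suppOn_wt v hε).mem_posFaces hC hF (singleton_nonempty _),
    ← hpol_eq_sum (P := fun Q => ∀ c, c ∈ J ∨ c ∈ Q)
      fun A => (C.suppOn_ind J).mem_posFaces hC hF hJ.nonempty] at this

theorem Gen.linkpol_le (hC : C.Gen) (hF : C.Full) (hd : 2 ≤ d) {D : ℕ}
    (hD : D + 1 = d + Fintype.card κ) (v : ι) (k : ℕ) :
    (C.linkpol D v fun Q => ∀ c, c ∈ Q).coeff k ≤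
      (C.hpol D fun Q => ∀ c, c ∈ ({C.col v} : Finset κ) ∨ c ∈ Q).coeff k := by
  classical
  obtain ⟨J, hJ⟩ : ∃ J, Opp (C.col v) J := by
    by_cases h : ∃ c, c ≠ C.col v
    · exact ⟨_, Or.inl ⟨rfl, h⟩⟩
    · push Not at h
      exact ⟨_, Or.inr ⟨rfl, h⟩⟩
  obtain ⟨ε, ⟨h, hε⟩, hn⟩ := (((hC.eventually_sweep hF hd v hJ).and self_mem_nhdsWithin).and
    (hC.eventually_nonneg hF v hJ.nonempty)).exists
  have := h.coeff_link_le hD v hn k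
  rw [← hpol_eq_sum (P := fun Q => ∀ c, c ∈ ({C.col v} : Finset κ) ∨ c ∈ Q)
      fun A => (C.suppOn_wt v hε).mem_posFaces hC hF (singleton_nonempty _)] at this
  rwa [linkpol_eq_sum (P := fun Q => ∀ c, c ∈ Q)]
  intro A
  rw [mem_filter, (C.suppOn_wt v hε).mem_posFaces hC hF (singleton_nonempty _)]
  refine and_congr_left fun hvA => and_congr_right fun _ => forall_congr' fun c => ?_
  refine ⟨fun h => h.elim (fun h => ?_) id, Or.inr⟩
  rw [mem_singleton.1 h]
  exact C.col_mem_colors hvA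

end ColConfig

end Generic

section Restriction

open Polynomial

namespace ColConfig

variable {d : ℕ} {κ ι : Type*} [Fintype κ] [DecidableEq κ] [Fintype ι] [DecidableEq ι]
  {C : ColConfig d κ ι}

/-- The members of the configuration whose colour lies in `R`. -/
def restr (C : ColConfig d κ ι) (R : Finset κ) :
    ColConfig d {c // c ∈ R} {a // C.col a ∈ R} where
  pt a := C.pt a.1
  col a := ⟨C.col a.1, a.2⟩

/-- Extension by zero of a vector indexed by the colours in `R`. -/
def extendZero (d : ℕ) (R : Finset κ) :
    (Fin d ⊕ {c // c ∈ R} → ℝ) →ₗ[ℝ] (Fin d ⊕ κ → ℝ) where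
  toFun y := Sum.elim (fun i => y (Sum.inl i))
    fun c => if h : c ∈ R then y (Sum.inr ⟨c, h⟩) else 0
  map_add' x y := by ext j; rcases j with i | c <;> simp; split_ifs <;> simp
  map_smul' t y := by ext j; rcases j with i | c <;> simp

theorem extendZero_vec (R : Finset κ) (a : {a // C.col a ∈ R}) :
    extendZero d R ((C.restr R).vec a) = C.vec a.1 := by
  ext j
  rcases j with i | c
  · simp [extendZero, vec, restr]
  · by_cases hc : c ∈ R
    · simp [extendZero, vec, restr, hc, Pi.single_apply, Subtype.ext_iff]
    · have : c ≠ C.col a.1 := by rintro rfl; exact hc a.2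
      simp [extendZero, vec, hc, this]

theorem map_colors_restr (R : Finset κ) (B : Finset {a // C.col a ∈ R}) :
    C.colors (B.map (Function.Embedding.subtype _)) =
      ((C.restr R).colors B).map (Function.Embedding.subtype _) := by
  ext c
  simp only [colors, restr, mem_image, mem_map, Function.Embedding.subtype_apply]
  constructor
  · rintro ⟨_, ⟨a, ha, rfl⟩, rfl⟩; exact ⟨_, ⟨a, ha, rfl⟩, rfl⟩
  · rintro ⟨_, ⟨a, ha, rfl⟩, rfl⟩; exact ⟨_, ⟨a, ha, rfl⟩, rfl⟩

theorem Gen.restr (hC : C.Gen) (R : Finset κ) : (C.restr R).Gen := by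
  intro B hB
  have h := hC (B.map (Function.Embedding.subtype _)) (by
    rwa [card_map, map_colors_restr, card_map])
  have h1 : LinearIndepOn ℝ (C.vec ∘ Subtype.val) (B : Set {a // C.col a ∈ R}) := by
    rw [coe_map] at h
    exact h.comp_of_image Subtype.val_injective.injOn
  have h2 : C.vec ∘ Subtype.val = extendZero d R ∘ (C.restr R).vec := by
    ext1 a; exact (extendZero_vec R a).symm
  rw [h2] at h1
  exact LinearIndependent.of_comp (extendZero d R) h1

theorem Full.restr (hF : C.Full) (R : Finset κ) : (C.restr R).Full := by
  intro c
  have h : ((C.restr R).cls c).map (Function.Embedding.subtype _) = C.cls c.1 := by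
    ext a
    simp only [mem_map, mem_cls, ColConfig.restr, Function.Embedding.subtype_apply,
      Subtype.exists, Subtype.ext_iff]
    constructor
    · rintro ⟨a, ha, h1, rfl⟩; exact h1
    · intro h; exact ⟨a, h ▸ c.2, h, rfl⟩
  rw [← card_map (Function.Embedding.subtype _), h]
  exact hF c.1

theorem isFace_restr (R : Finset κ) (A : Finset {a // C.col a ∈ R}) :
    (C.restr R).IsFace A ↔ C.IsFace (A.map (Function.Embedding.subtype _)) := by
  constructor
  · rintro ⟨y, hy, ⟨i, hi⟩, rfl⟩
    obtain ⟨M, hM⟩ : ∃ M : ℝ, ∀ a, -((fun i => y (Sum.inl i)) ⬝ᵥ C.pt a) < M := by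
      obtain ⟨M, hM⟩ := Finite.bddAbove_range
        fun a => -((fun i => y (Sum.inl i)) ⬝ᵥ C.pt a)
      exact ⟨M + 1, fun a => (hM ⟨a, rfl⟩).trans_lt (lt_add_one M)⟩
    set y' : Fin d ⊕ κ → ℝ := Sum.elim (fun i => y (Sum.inl i))
      fun c => if h : c ∈ R then y (Sum.inr ⟨c, h⟩) else M with hy'
    have h1 : ∀ a (h : C.col a ∈ R), y' ⬝ᵥ C.vec a = y ⬝ᵥ (C.restr R).vec ⟨a, h⟩ := by
      intro a h
      simp [dotProduct_vec, hy', h, ColConfig.restr]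
    have h2 : ∀ a, C.col a ∉ R → 0 < y' ⬝ᵥ C.vec a := by
      intro a h
      rw [dotProduct_vec]
      simp only [hy', Sum.elim_inl, Sum.elim_inr, h, dite_false]
      linarith [hM a]
    refine ⟨y', fun a => ?_, ⟨i, by simpa [hy'] using hi⟩, ?_⟩
    · by_cases h : C.col a ∈ R
      · rw [h1 a h]; exact hy _
      · exact (h2 a h).le
    · ext a
      simp only [mem_zeros, mem_map, Function.Embedding.subtype_apply, Subtype.exists,
        exists_and_right, exists_eq_right]
      by_cases h : C.col a ∈ R
      · simp [h1 a h, h]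
      · simp [(h2 a h).ne', h]
  · rintro ⟨y, hy, ⟨i, hi⟩, hA⟩
    set y' : Fin d ⊕ {c // c ∈ R} → ℝ := Sum.elim (fun i => y (Sum.inl i))
      fun c => y (Sum.inr c.1) with hy'
    have h1 : ∀ a, y' ⬝ᵥ (C.restr R).vec a = y ⬝ᵥ C.vec a.1 := by
      intro a
      simp [dotProduct_vec, hy', ColConfig.restr]
    refine ⟨y', fun a => by rw [h1]; exact hy _, ⟨i, by simpa [hy'] using hi⟩, ?_⟩
    ext a
    rw [mem_zeros, h1, ← mem_zeros, hA]
    exact mem_map' (Function.Embedding.subtype _)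

/-- Transport of a family of faces from the restriction to the whole configuration. -/
theorem sum_restr {M : Type*} [AddCommMonoid M] (R : Finset κ)
    {S : Finset (Finset {a // C.col a ∈ R})} {S' : Finset (Finset ι)}
    (hS : ∀ A, A ∈ S ↔ A.map (Function.Embedding.subtype _) ∈ S')
    (hS' : ∀ A ∈ S', C.colors A ⊆ R) (f : Finset ι → M) :
    ∑ A ∈ S, f (A.map (Function.Embedding.subtype _)) = ∑ A ∈ S', f A := by
  refine sum_bij (fun A _ => A.map (Function.Embedding.subtype _)) (fun A hA => (hS A).1 hA)
    (fun A _ B _ h => map_injective _ h) (fun A hA => ?_) fun _ _ => rfl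
  have : (A.subtype (C.col · ∈ R)).map (Function.Embedding.subtype _) = A := by
    rw [subtype_map, filter_true_of_mem]
    exact fun a ha => hS' A hA (C.col_mem_colors ha)
  exact ⟨A.subtype _, (hS _).2 (by rwa [this]), this⟩

theorem hpol_restr (R : Finset κ) (D : ℕ) {P : Finset {c // c ∈ R} → Prop}
    {P' : Finset κ → Prop}
    (hP : ∀ Q : Finset {c // c ∈ R}, P Q ↔ P' (Q.map (Function.Embedding.subtype _))) :
    (C.restr R).hpol D P = C.hpol D fun Q => Q ⊆ R ∧ P' Q := by
  classical
  have h := sum_restr (C := C) R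
    (S := univ.filter fun A => (C.restr R).IsFace A ∧ P ((C.restr R).colors A))
    (S' := univ.filter fun A => C.IsFace A ∧ C.colors A ⊆ R ∧ P' (C.colors A)) (fun A => by
      simp only [mem_filter, mem_univ, true_and, isFace_restr, hP, map_colors_restr]
      refine and_congr_right fun _ => (and_iff_right ?_).symm
      intro c; simp; tauto)
    (fun A hA => (mem_filter.1 hA).2.2.1)
    fun A => (X : ℤ[X]) ^ A.card * (1 - X) ^ (D - A.card)
  rw [hpol_eq_sum (P := P) (S := univ.filter fun A => (C.restr R).IsFace A ∧
    P ((C.restr R).colors A)) (by simp), hpol_eq_sum (P := fun Q => Q ⊆ R ∧ P' Q)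
    (S := univ.filter fun A => C.IsFace A ∧ C.colors A ⊆ R ∧ P' (C.colors A)) (by simp), ← h]
  simp only [card_map]

theorem linkpol_restr (R : Finset κ) (D : ℕ) (v : {a // C.col a ∈ R})
    {P : Finset {c // c ∈ R} → Prop} {P' : Finset κ → Prop}
    (hP : ∀ Q : Finset {c // c ∈ R}, P Q ↔ P' (Q.map (Function.Embedding.subtype _))) :
    (C.restr R).linkpol D v P = C.linkpol D v.1 fun Q => Q ⊆ R ∧ P' Q := by
  classical
  have h := sum_restr (C := C) R
    (S := univ.filter fun A => ((C.restr R).IsFace A ∧ P ((C.restr R).colors A)) ∧ v ∈ A)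
    (S' := univ.filter fun A => (C.IsFace A ∧ C.colors A ⊆ R ∧ P' (C.colors A)) ∧ v.1 ∈ A)
    (fun A => by
      simp only [mem_filter, mem_univ, true_and, isFace_restr, hP, map_colors_restr]
      refine and_congr (and_congr_right fun _ => (and_iff_right ?_).symm)
        (mem_map' (Function.Embedding.subtype _) (a := v) (s := A)).symm
      intro c; simp; tauto)
    (fun A hA => (mem_filter.1 hA).2.1.2.1)
    fun A => (X : ℤ[X]) ^ (A.card - 1) * (1 - X) ^ (D - A.card)
  rw [linkpol_eq_sum (P := P) (S := univ.filter fun A => ((C.restr R).IsFace A ∧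
    P ((C.restr R).colors A)) ∧ v ∈ A) (by simp), linkpol_eq_sum (P := fun Q => Q ⊆ R ∧ P' Q)
    (S := univ.filter fun A => (C.IsFace A ∧ C.colors A ⊆ R ∧ P' (C.colors A)) ∧ v.1 ∈ A)
    (by simp), ← h]
  simp only [card_map]

theorem hpol_congr {D : ℕ} {P P' : Finset κ → Prop} (h : ∀ Q, P Q ↔ P' Q) :
    C.hpol D P = C.hpol D P' := by
  have : P = P' := by ext Q; exact h Q
  rw [this]

theorem linkpol_congr {D : ℕ} {v : ι} {P P' : Finset κ → Prop} (h : ∀ Q, P Q ↔ P' Q) :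
    C.linkpol D v P = C.linkpol D v P' := by
  have : P = P' := by ext Q; exact h Q
  rw [this]

theorem Gen.reflect_hpol_restr (hC : C.Gen) (hF : C.Full) (hd : 2 ≤ d) {D : ℕ} {R : Finset κ}
    (hD : D + 1 = d + R.card) {c₀ : κ} (hc₀ : c₀ ∈ R) (hR : 2 ≤ R.card) :
    reflect D (C.hpol D fun Q => Q ⊆ R ∧ R.erase c₀ ⊆ Q) =
      C.hpol D fun Q => Q ⊆ R ∧ c₀ ∈ Q := by
  have h := (hC.restr R).reflect_hpol (hF.restr R) hd (D := D) (by simpa using hD)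
    ⟨c₀, hc₀⟩ (J := univ.erase ⟨c₀, hc₀⟩) (Or.inl ⟨rfl, by
      obtain ⟨c, hc, hne⟩ := exists_mem_ne hR c₀
      exact ⟨⟨c, hc⟩, by simpa using hne⟩⟩)
  rw [hpol_restr (P' := fun Q => R.erase c₀ ⊆ Q) R D, hpol_restr (P' := fun Q => c₀ ∈ Q) R D] at h
  · exact h
  · intro Q
    simp only [mem_erase, mem_univ, ne_eq, and_true, mem_map, Function.Embedding.subtype_apply,
      Subtype.exists, exists_and_right, exists_eq_right, hc₀, exists_true_left, Subtype.forall,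
      Subtype.ext_iff]
    constructor
    · intro h; simpa using h c₀ hc₀
    · intro h c hc
      by_cases hcc : c = c₀
      · subst hcc; exact Or.inr h
      · exact Or.inl hcc
  · intro Q
    simp only [mem_singleton, Subtype.forall, subset_iff, mem_erase, mem_map,
      Function.Embedding.subtype_apply, Subtype.exists, exists_and_right, exists_eq_right,
      Subtype.ext_iff]
    constructor
    · rintro h c ⟨hne, hc⟩
      exact ⟨hc, (h c hc).resolve_left hne⟩
    · intro h c hc
      by_cases hcc : c = c₀
      · exact Or.inl hcc
      · exact Or.inr (h ⟨hcc, hc⟩).2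

theorem Gen.reflect_hpol_singleton (hC : C.Gen) (hF : C.Full) (hd : 2 ≤ d) (c₀ : κ) :
    reflect d (C.hpol d fun Q => Q ⊆ {c₀}) = C.hpol d fun Q => Q ⊆ {c₀} := by
  have h := (hC.restr {c₀}).reflect_hpol (hF.restr {c₀}) hd (D := d) (by simp)
    ⟨c₀, mem_singleton_self _⟩ (J := univ) (Or.inr ⟨rfl, by
      rintro ⟨c, hc⟩; simpa using hc⟩)
  rw [hpol_restr (P' := fun Q => True) _ d, hpol_restr (P' := fun Q => True) _ d] at h
  · simpa using h
  · exact fun Q => iff_of_true (fun c => Or.inl (mem_univ c)) trivial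
  · intro Q
    simp only [mem_singleton, Subtype.forall, Subtype.ext_iff, iff_true]
    exact fun c hc => Or.inl hc

theorem Gen.linkpol_le_restr (hC : C.Gen) (hF : C.Full) (hd : 2 ≤ d) {D : ℕ} {R : Finset κ}
    (hD : D + 1 = d + R.card) {v : ι} (hv : C.col v ∈ R) (k : ℕ) :
    (C.linkpol D v fun Q => Q = R).coeff k ≤
      (C.hpol D fun Q => Q ⊆ R ∧ R.erase (C.col v) ⊆ Q).coeff k := by
  have h := (hC.restr R).linkpol_le (hF.restr R) hd (D := D) (by simpa using hD) ⟨v, hv⟩ k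
  rw [hpol_restr (P' := fun Q => R.erase (C.col v) ⊆ Q) R D,
    linkpol_restr (P' := fun Q => R ⊆ Q) R D] at h
  · rwa [linkpol_congr fun Q => subset_antisymm_iff]
  · intro Q
    simp only [subset_iff, mem_map, Function.Embedding.subtype_apply, Subtype.exists,
      exists_and_right, exists_eq_right, Subtype.forall]
    exact ⟨fun h x hx => ⟨hx, h x hx⟩, fun h a b => (h b).2⟩
  · intro Q
    simp only [mem_singleton, Subtype.forall, subset_iff, mem_erase, mem_map,
      Function.Embedding.subtype_apply, Subtype.exists, exists_and_right, exists_eq_right,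
      Subtype.ext_iff]
    constructor
    · rintro h c ⟨hne, hc⟩
      exact ⟨hc, (h c hc).resolve_left hne⟩
    · intro h c hc
      by_cases hcc : c = C.col v
      · exact Or.inl hcc
      · exact Or.inr (h ⟨hcc, hc⟩).2

end ColConfig

end Restriction

section HPolynomial

open Polynomial

/-- The operator recovering face numbers from `h`-vectors is dual to the basis
`X ^ a * (1 - X) ^ e`. -/
theorem sum_coeff_mul_choose (a e m : ℕ) :
    ∑ i ∈ range (m + 1), ((X : ℤ[X]) ^ a * (1 - X) ^ e).coeff i * ((a + e - i).choose (m - i) : ℤ)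
      = if a = m then 1 else 0 := by
  induction e generalizing a m with
  | zero =>
    simp only [pow_zero, mul_one, add_zero, coeff_X_pow, ite_mul, one_mul, zero_mul]
    rw [sum_ite_eq' (range (m + 1)) a]
    by_cases h : a = m
    · simp [h]
    · simp only [mem_range, h, if_false]
      split_ifs with h1
      · rw [Nat.sub_self, Nat.choose_eq_zero_of_lt (by omega)]; rfl
      · rfl
  | succ e ih =>
    set p : ℤ[X] := (X : ℤ[X]) ^ a * (1 - X) ^ e with hp
    have hpe : (X : ℤ[X]) ^ a * (1 - X) ^ (e + 1) = p - p * X := by rw [hp]; ring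
    rw [← ih a m, hpe, ← hp]
    have hdeg : ∀ i, a + e < i → p.coeff i = 0 := fun i hi => by
      refine coeff_eq_zero_of_natDegree_lt (lt_of_le_of_lt ?_ hi)
      refine natDegree_mul_le.trans (add_le_add (natDegree_X_pow_le a) ?_)
      refine natDegree_pow_le.trans ?_
      calc e * (1 - X : ℤ[X]).natDegree ≤ e * 1 := Nat.mul_le_mul_left _
            ((natDegree_sub_le _ _).trans (by simp))
        _ = e := mul_one e
    simp only [coeff_sub, sub_mul, sum_sub_distrib]
    have hX : ∑ i ∈ range (m + 1), (p * X).coeff i * ((a + (e + 1) - i).choose (m - i) : ℤ) =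
        ∑ i ∈ range m, p.coeff i * ((a + (e + 1) - (i + 1)).choose (m - (i + 1)) : ℤ) := by
      rw [sum_range_succ']; simp
    rw [hX, sum_range_succ, sum_range_succ]
    simp only [Nat.sub_self, Nat.choose_zero_right]
    rw [add_sub_right_comm, ← sum_sub_distrib]
    congr 1
    refine sum_congr rfl fun i hi => ?_
    rw [mem_range] at hi
    by_cases hie : a + e < i
    · rw [hdeg i hie]; simp
    · have e1 : a + (e + 1) - i = (a + e - i) + 1 := by omega
      have e2 : a + (e + 1) - (i + 1) = a + e - i := by omega
      have e3 : m - i = (m - (i + 1)) + 1 := by omega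
      rw [e1, e2, e3, Nat.choose_succ_succ]
      push_cast; ring

theorem coeff_one_sub_X_mul_zero (p : ℤ[X]) : ((1 - X) * p).coeff 0 = p.coeff 0 := by
  simp [sub_mul]

theorem coeff_one_sub_X_mul_succ (p : ℤ[X]) (i : ℕ) :
    ((1 - X) * p).coeff (i + 1) = p.coeff (i + 1) - p.coeff i := by
  simp [sub_mul]

theorem natDegree_X_pow_mul_one_sub_X_pow_le (a e : ℕ) :
    ((X : ℤ[X]) ^ a * (1 - X) ^ e).natDegree ≤ a + e := by
  refine natDegree_mul_le.trans (add_le_add (natDegree_X_pow_le a) ?_)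
  refine natDegree_pow_le.trans ?_
  calc e * (1 - X : ℤ[X]).natDegree ≤ e * 1 := Nat.mul_le_mul_left _
        ((natDegree_sub_le _ _).trans (by simp))
    _ = e := mul_one e

theorem reflect_one_sub_X_mul {p : ℤ[X]} {D : ℕ} (hp : p.natDegree ≤ D) :
    reflect (D + 1) ((1 - X) * p) = -((1 - X) * reflect D p) := by
  rw [add_comm, reflect_mul (1 - X) p ((natDegree_sub_le _ _).trans (by simp)) hp]
  have : reflect 1 (1 - X : ℤ[X]) = X - 1 := by
    rw [sub_eq_add_neg, reflect_add, reflect_neg]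
    have h1 : reflect 1 (1 : ℤ[X]) = X := by
      simp
    have h2 : reflect 1 (X : ℤ[X]) = 1 := by
      simp
    rw [h1, h2]; ring
  rw [this]; ring

/-- The coefficientwise form of the operator `(1 - X) d/dX + D`. -/
def euler (D : ℕ) (p : ℤ[X]) (k : ℕ) : ℤ := (k + 1) * p.coeff (k + 1) + (D - k) * p.coeff k

theorem euler_eq (D : ℕ) (p : ℤ[X]) (k : ℕ) :
    euler D p k = ((1 - X) * derivative p + (D : ℤ[X]) * p).coeff k := by
  have h : ((D : ℤ[X]) * p).coeff k = D * p.coeff k := by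
    rw [← C_eq_natCast, coeff_C_mul]
  rw [coeff_add, h]
  cases k with
  | zero => rw [coeff_one_sub_X_mul_zero, coeff_derivative, euler]; push_cast; ring
  | succ k =>
    rw [coeff_one_sub_X_mul_succ, coeff_derivative, coeff_derivative, euler]; push_cast; ring

theorem euler_X_pow_mul {D m : ℕ} (h : m ≤ D) (k : ℕ) :
    euler D (X ^ m * (1 - X) ^ (D - m)) k =
      ((m : ℤ[X]) * (X ^ (m - 1) * (1 - X) ^ (D - m))).coeff k := by
  rw [euler_eq]
  congr 1
  obtain ⟨e, rfl⟩ := Nat.exists_eq_add_of_le h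
  rw [Nat.add_sub_cancel_left, derivative_mul, derivative_pow, derivative_pow]
  cases e with
  | zero =>
    cases m <;> simp
    ring_nf
  | succ e =>
    cases m with
    | zero => simp; ring
    | succ m => simp; ring

namespace ColConfig

variable {d : ℕ} {κ ι : Type*} [Fintype κ] [DecidableEq κ] [Fintype ι] [DecidableEq ι]
  {C : ColConfig d κ ι}

theorem hpol_or {D : ℕ} {P Q : Finset κ → Prop} (h : ∀ S, P S → ¬ Q S) :
    C.hpol D (fun S => P S ∨ Q S) = C.hpol D P + C.hpol D Q := by
  classical
  rw [hpol_eq_sum (P := fun S => P S ∨ Q S) (S := (univ.filter fun A => C.IsFace A ∧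
    P (C.colors A)) ∪ univ.filter fun A => C.IsFace A ∧ Q (C.colors A))
    (fun A => by simp only [mem_union, mem_filter, mem_univ, true_and]; tauto), sum_union,
    ← hpol_eq_sum (C := C) (P := P) (by simp), ← hpol_eq_sum (C := C) (P := Q) (by simp)]
  rw [disjoint_left]
  intro A hA hB
  simp only [mem_filter, mem_univ, true_and] at hA hB
  exact h _ hA.2 hB.2

theorem Gen.hpol_succ (hC : C.Gen) {D : ℕ} {R : Finset κ} (h : d + R.card ≤ D + 1) :
    C.hpol (D + 1) (· = R) = (1 - X) * C.hpol D (· = R) := by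
  rw [hpol, hpol, mul_sum]
  refine sum_congr rfl fun A hA => ?_
  simp only [mem_filter, mem_univ, true_and] at hA
  obtain ⟨hA, rfl⟩ := hA
  have := hC.card_lt hA
  rw [Nat.succ_sub (by omega : A.card ≤ D), pow_succ]
  ring

theorem Gen.natDegree_hpol_le (hC : C.Gen) {D : ℕ} {R : Finset κ} (h : d + R.card ≤ D + 1) :
    (C.hpol D (· = R)).natDegree ≤ D := by
  refine natDegree_sum_le_of_forall_le _ _ fun A hA => ?_
  simp only [mem_filter, mem_univ, true_and] at hA
  obtain ⟨hA, rfl⟩ := hA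
  have := hC.card_lt hA
  refine (natDegree_X_pow_mul_one_sub_X_pow_le _ _).trans ?_
  omega

theorem isFace_empty [NeZero d] : C.IsFace ∅ := by
  obtain ⟨M, hM⟩ : ∃ M : ℝ, ∀ a, -((Pi.single 0 1 : Fin d → ℝ) ⬝ᵥ C.pt a) < M := by
    obtain ⟨M, hM⟩ := Finite.bddAbove_range
      fun a => -((Pi.single 0 1 : Fin d → ℝ) ⬝ᵥ C.pt a)
    exact ⟨M + 1, fun a => (hM ⟨a, rfl⟩).trans_lt (lt_add_one M)⟩
  have h : ∀ a, 0 < (Sum.elim (Pi.single 0 1 : Fin d → ℝ) fun _ : κ => M) ⬝ᵥ C.vec a := by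
    intro a
    rw [dotProduct_vec]
    simp only [Sum.elim_inl, Sum.elim_inr]
    linarith [hM a]
  refine ⟨_, fun a => (h a).le, ⟨0, by simp⟩, ?_⟩
  ext a
  simpa [mem_zeros] using (h a).ne'

theorem hpol_empty (hd : 2 ≤ d) (D : ℕ) : C.hpol D (· = ∅) = (1 - X) ^ D := by
  have : NeZero d := ⟨by omega⟩
  rw [hpol_eq_sum (S := {∅}), sum_singleton]
  · simp
  · intro A
    rw [mem_singleton]
    constructor
    · rintro rfl; exact ⟨isFace_empty, by simp [colors]⟩
    · rintro ⟨-, h⟩; simpa [colors] using h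

/-- The modified `h`-polynomial of the faces with colour set exactly `R`. -/
def hmod (C : ColConfig d κ ι) (R : Finset κ) : ℤ[X] :=
  C.hpol (d + R.card - 1) (· = R) - (-1) ^ R.card * (1 - X) ^ (d + R.card - 1)

theorem hmod_empty (hd : 2 ≤ d) : C.hmod ∅ = 0 := by
  simp [hmod, hpol_empty hd]

theorem Gen.hpol_add_eq (hC : C.Gen) {R : Finset κ} (e : ℕ) :
    C.hpol (d + R.card - 1 + e) (· = R) =
      (1 - X) ^ e * C.hmod R + (-1) ^ R.card * (1 - X) ^ (d + R.card - 1 + e) := by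
  induction e with
  | zero => rw [hmod]; ring_nf
  | succ e ih => rw [← add_assoc, hC.hpol_succ (by omega), ih]; ring

theorem Gen.hpol_eq (hC : C.Gen) (hd : 2 ≤ d) {R : Finset κ} {D e : ℕ}
    (h : d + R.card + e = D + 1) :
    C.hpol D (· = R) = (1 - X) ^ e * C.hmod R + (-1) ^ R.card * (1 - X) ^ D := by
  obtain rfl : D = d + R.card - 1 + e := by omega
  exact hC.hpol_add_eq e

theorem Gen.natDegree_hmod_le (hC : C.Gen) (hd : 2 ≤ d) (R : Finset κ) :
    (C.hmod R).natDegree ≤ d + R.card - 1 := by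
  refine (natDegree_sub_le _ _).trans (max_le (hC.natDegree_hpol_le (by omega)) ?_)
  have := natDegree_X_pow_mul_one_sub_X_pow_le 0 (d + R.card - 1)
  rcases neg_one_pow_eq_or ℤ[X] R.card with h | h <;> rw [h] <;> simpa using this

theorem coeff_hmod_zero {R : Finset κ} (hR : R.Nonempty) :
    (C.hmod R).coeff 0 = -(-1) ^ R.card := by
  rw [coeff_zero_eq_eval_zero, hmod, hpol, eval_sub, eval_finsetSum, sum_eq_zero]
  · simp
  · intro A hA
    simp only [mem_filter, mem_univ, true_and] at hA
    obtain ⟨hA, rfl⟩ := hA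
    have : A.Nonempty := by simpa [colors] using hR
    simp [this.ne_empty]

/-- The faces whose colour set is `R` or `R` without `c`. -/
theorem Gen.hpol_erase (hC : C.Gen) (hd : 2 ≤ d) {D : ℕ} {R : Finset κ}
    (hD : D + 1 = d + R.card) {c : κ} (hc : c ∈ R) :
    C.hpol D (fun Q => Q ⊆ R ∧ R.erase c ⊆ Q) = C.hmod R + (1 - X) * C.hmod (R.erase c) := by
  have h1 : ∀ Q, Q ⊆ R ∧ R.erase c ⊆ Q ↔ Q = R ∨ Q = R.erase c := by
    intro Q
    constructor
    · rintro ⟨h1, h2⟩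
      by_cases hcQ : c ∈ Q
      · left
        refine h1.antisymm fun x hx => ?_
        by_cases hxc : x = c
        · exact hxc ▸ hcQ
        · exact h2 (mem_erase.2 ⟨hxc, hx⟩)
      · right
        exact Subset.antisymm (fun x hx => mem_erase.2 ⟨fun h => hcQ (h ▸ hx), h1 hx⟩) h2
    · rintro (rfl | rfl)
      · exact ⟨Subset.rfl, erase_subset _ _⟩
      · exact ⟨erase_subset _ _, Subset.rfl⟩
  have hcard := card_erase_add_one hc
  rw [hpol_congr h1, hpol_or, hC.hpol_eq hd (e := 0) (by omega), hC.hpol_eq hd (e := 1) (by omega),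
    ← hcard, pow_succ]
  · ring
  · rintro S rfl h
    rw [← h] at hcard; omega

/-- Summing the link inequality over the vertices of all colours. -/
theorem Gen.hmod_succ_le (hC : C.Gen) (hF : C.Full) (hd : 2 ≤ d) {R : Finset κ}
    (k : ℕ) :
    ((k : ℤ) + 1) * (C.hmod R).coeff (k + 1) ≤
      (∑ c ∈ R, ((C.cls c).card : ℤ) - (d + R.card - 1) + k) * (C.hmod R).coeff k +
        ∑ c ∈ R, ((C.cls c).card : ℤ) * ((1 - X) * C.hmod (R.erase c)).coeff k := by
  classical
  set D := d + R.card - 1 with hD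
  have hD' : D + 1 = d + R.card := by omega
  have hF0 := hC.hpol_eq hd (R := R) (D := D) (e := 0) (by omega)
  rw [pow_zero, one_mul] at hF0
  have h1 : euler D (C.hpol D (· = R)) k = euler D (C.hmod R) k := by
    have h2 : euler D ((1 - X) ^ D) k = 0 := by
      simpa using euler_X_pow_mul (Nat.zero_le D) k
    rw [euler] at h2
    rcases neg_one_pow_eq_or ℤ[X] R.card with h | h
    · rw [hF0, h, one_mul, euler, euler, coeff_add, coeff_add]; linear_combination h2
    · rw [hF0, h, neg_one_mul, euler, euler, coeff_add, coeff_add, coeff_neg, coeff_neg]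
      linear_combination -h2
  have h2 : ∑ v with C.col v ∈ R, (C.linkpol D v (· = R)).coeff k =
      euler D (C.hpol D (· = R)) k := by
    have h3 : ∀ S : Finset (Finset ι), (∀ A ∈ S, A.card ≤ D) → 
        euler D (∑ A ∈ S, X ^ A.card * (1 - X) ^ (D - A.card)) k =
          ∑ A ∈ S, ((A.card : ℤ[X]) * (X ^ (A.card - 1) * (1 - X) ^ (D - A.card))).coeff k := by
      intro S hS
      rw [euler, finsetSum_coeff, finsetSum_coeff, mul_sum, mul_sum, ← sum_add_distrib]
      exact sum_congr rfl fun A hA => euler_X_pow_mul (hS A hA) k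
    rw [hpol, h3]
    · have h4 : ∀ v, (C.linkpol D v (· = R)).coeff k = ∑ A, if (C.IsFace A ∧ C.colors A = R) ∧
          v ∈ A then (X ^ (A.card - 1) * (1 - X) ^ (D - A.card) : ℤ[X]).coeff k else 0 := by
        intro v
        rw [linkpol, finsetSum_coeff, sum_filter]
        exact sum_congr rfl fun A _ => by congr
      simp only [h4]
      rw [sum_comm, sum_filter]
      refine sum_congr rfl fun A _ => ?_
      by_cases hA : C.IsFace A ∧ C.colors A = R
      · rw [if_pos hA, ← C_eq_natCast, coeff_C_mul]
        simp only [hA, true_and]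
        rw [← sum_filter, sum_const, filter_filter, nsmul_eq_mul]
        congr 2
        rw [← hA.2]
        congr 1
        ext a
        simpa using fun ha => C.col_mem_colors ha
      · rw [if_neg hA]
        refine sum_eq_zero fun a _ => ?_
        rw [if_neg (fun h => hA h.1)]
    · intro A hA
      simp only [mem_filter, mem_univ, true_and] at hA
      obtain ⟨hA, rfl⟩ := hA
      have := hC.card_lt hA
      omega
  have h3 : ∑ v with C.col v ∈ R, (C.linkpol D v (· = R)).coeff k ≤
      ∑ v with C.col v ∈ R, (C.hmod R + (1 - X) * C.hmod (R.erase (C.col v))).coeff k := by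
    refine sum_le_sum fun v hv => ?_
    rw [mem_filter] at hv
    rw [← hC.hpol_erase hd hD' hv.2]
    exact hC.linkpol_le_restr hF hd hD' hv.2 k
  have h4 : ∑ v with C.col v ∈ R, (C.hmod R + (1 - X) * C.hmod (R.erase (C.col v))).coeff k =
      ∑ c ∈ R, ((C.cls c).card : ℤ) *
        (C.hmod R + (1 - X) * C.hmod (R.erase c)).coeff k := by
    rw [← sum_fiberwise_of_maps_to (t := R) (g := C.col) (by simp)]
    refine sum_congr rfl fun c hc => ?_
    rw [← nsmul_eq_mul, ← sum_const]
    refine sum_congr ?_ ?_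
    · ext a
      simp only [mem_filter, mem_univ, true_and, mem_cls]
      exact ⟨fun h => h.2, fun h => ⟨h ▸ hc, h⟩⟩
    · intro a ha
      rw [mem_cls.1 ha]
  rw [h2, h1, h4] at h3
  simp only [coeff_add, mul_add, sum_add_distrib, ← sum_mul] at h3
  rw [euler] at h3
  have hDz : (D : ℤ) = d + R.card - 1 := by
    have : (D : ℤ) + 1 = d + R.card := by exact_mod_cast hD'
    linarith
  rw [hDz] at h3
  linarith

theorem Gen.reflect_hmod_singleton (hC : C.Gen) (hF : C.Full) (hd : 2 ≤ d) (a : κ) :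
    reflect d (C.hmod {a}) = C.hmod {a} := by
  have h := hC.reflect_hpol_singleton hF hd a
  have h1 : C.hpol d (fun Q => Q ⊆ {a}) = C.hmod {a} := by
    have := hC.hpol_erase hd (D := d) (R := {a}) (by simp) (mem_singleton_self a)
    rw [erase_singleton, hmod_empty hd, mul_zero, add_zero] at this
    rw [← this]
    exact hpol_congr fun Q => by simp
  rwa [h1] at h

theorem Gen.reflect_hmod_pair (hC : C.Gen) (hF : C.Full) (hd : 2 ≤ d) {a b : κ} (hab : a ≠ b) :
    reflect (d + 1) (C.hmod {a, b}) =
      C.hmod {a, b} + (1 - X) * (C.hmod {a} + C.hmod {b}) := by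
  have hc : ({a, b} : Finset κ).card = 2 := card_pair hab
  have h := hC.reflect_hpol_restr hF hd (R := {a, b}) (D := d + 1) (by omega)
    (c₀ := a) (by simp) (by omega)
  have he : ({a, b} : Finset κ).erase a = {b} := by
    ext x; simp only [mem_erase, mem_insert, mem_singleton]; grind
  rw [hC.hpol_erase hd (by omega) (by simp), he, reflect_add,
    reflect_one_sub_X_mul ((hC.natDegree_hmod_le hd _).trans (by simp)),
    hC.reflect_hmod_singleton hF hd] at h
  have h1 : ∀ Q : Finset κ, Q ⊆ {a, b} ∧ a ∈ Q ↔ Q = {a, b} ∨ Q = {a} := by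
    intro Q
    constructor
    · rintro ⟨h1, h2⟩
      by_cases hb : b ∈ Q
      · exact Or.inl (h1.antisymm (by simp [insert_subset_iff, h2, hb]))
      · refine Or.inr (Subset.antisymm (fun x hx => ?_) (by simpa using h2))
        have := h1 hx
        simp only [mem_insert, mem_singleton] at this ⊢
        exact this.resolve_right fun h => hb (h ▸ hx)
    · rintro (rfl | rfl) <;> simp
  rw [hpol_congr h1, hpol_or, hC.hpol_eq hd (e := 0) (by omega),
    hC.hpol_eq hd (e := 1) (by simp), hc, card_singleton] at h
  · linear_combination h
  · rintro S rfl h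
    rw [h, card_singleton] at hc; omega

theorem Gen.reflect_hmod_triple (hC : C.Gen) (hF : C.Full) (hd : 2 ≤ d) {a b c : κ}
    (hab : a ≠ b) (hac : a ≠ c) (hbc : b ≠ c) :
    reflect (d + 2) (C.hmod {a, b, c}) =
      C.hmod {a, b, c} + (1 - X) * (C.hmod {a, b} + C.hmod {a, c} + C.hmod {b, c}) +
        (1 - X) ^ 2 * (C.hmod {a} + C.hmod {b} + C.hmod {c}) := by
  have hc3 : ({a, b, c} : Finset κ).card = 3 := card_eq_three.2 ⟨a, b, c, hab, hac, hbc, rfl⟩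
  have hcb : ({a, b} : Finset κ).card = 2 := card_pair hab
  have hcc : ({a, c} : Finset κ).card = 2 := card_pair hac
  have h := hC.reflect_hpol_restr hF hd (R := {a, b, c}) (D := d + 2) (by omega)
    (c₀ := a) (by simp) (by omega)
  have he : ({a, b, c} : Finset κ).erase a = {b, c} := by
    ext x; simp only [mem_erase, mem_insert, mem_singleton]; grind
  rw [hC.hpol_erase hd (by omega) (by simp), he, reflect_add,
    reflect_one_sub_X_mul (D := d + 1) ((hC.natDegree_hmod_le hd _).trans
      (by rw [card_pair hbc]; omega)), hC.reflect_hmod_pair hF hd hbc] at h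
  have h1 : ∀ Q : Finset κ, Q ⊆ {a, b, c} ∧ a ∈ Q ↔
      Q = {a, b, c} ∨ Q = {a, b} ∨ Q = {a, c} ∨ Q = {a} := by
    intro Q
    constructor
    · rintro ⟨h1, h2⟩
      have h3 : Q = ({a, b, c} : Finset κ).filter (· ∈ Q) := by
        ext x; simp only [mem_filter]; exact ⟨fun h => ⟨h1 h, h⟩, fun h => h.2⟩
      rw [h3]
      by_cases hb : b ∈ Q <;> by_cases hc : c ∈ Q <;>
        simp [filter_insert, filter_singleton, h2, hb, hc]
    · rintro (rfl | rfl | rfl | rfl) <;> simp [insert_subset_iff]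
  rw [hpol_congr h1, hpol_or, hpol_or, hpol_or, hC.hpol_eq hd (e := 0) (by omega),
    hC.hpol_eq hd (e := 1) (by omega), hC.hpol_eq hd (e := 1) (by omega),
    hC.hpol_eq hd (e := 2) (by simp), hc3, hcb, hcc, card_singleton] at h
  · linear_combination h
  · rintro S rfl h
    rw [h, card_singleton] at hcc; omega
  · rintro S rfl (h | h)
    · have : b ∈ ({a, c} : Finset κ) := h ▸ by simp
      simp [hab.symm, hbc] at this
    · rw [h, card_singleton] at hcb; omega
  · rintro S rfl (h | h | h) <;> rw [h] at hc3
    · omega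
    · omega
    · simp at hc3

/-- Face numbers in terms of the `h`-polynomial. -/
theorem Gen.card_faces_eq (hC : C.Gen) (hd : 2 ≤ d) {R : Finset κ} {D m : ℕ}
    (hD : D + 1 = d + R.card) (hm : 1 ≤ m) :
    (Nat.card {A : Finset ι // C.IsFace A ∧ C.colors A = R ∧ A.card = m} : ℤ) =
      ∑ i ∈ range (m + 1), (C.hmod R).coeff i * ((D - i).choose (m - i) : ℤ) := by
  classical
  have hF0 := hC.hpol_eq hd (R := R) (D := D) (e := 0) (by omega)
  rw [pow_zero, one_mul] at hF0
  have h2 : ∑ i ∈ range (m + 1), ((1 - X : ℤ[X]) ^ D).coeff i * ((D - i).choose (m - i) : ℤ)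
      = 0 := by
    have := sum_coeff_mul_choose 0 D m
    rw [if_neg (by omega)] at this
    simpa using this
  have h1 : ∑ i ∈ range (m + 1), (C.hpol D (· = R)).coeff i * ((D - i).choose (m - i) : ℤ) =
      ∑ i ∈ range (m + 1), (C.hmod R).coeff i * ((D - i).choose (m - i) : ℤ) := by
    rcases neg_one_pow_eq_or ℤ[X] R.card with h | h
    · rw [hF0, h, one_mul]
      simp only [coeff_add, add_mul, sum_add_distrib, h2, add_zero]
    · rw [hF0, h, neg_one_mul]
      simp only [coeff_add, coeff_neg, add_mul, neg_mul, sum_add_distrib, sum_neg_distrib, h2,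
        neg_zero, add_zero]
  rw [← h1, hpol]
  simp only [finsetSum_coeff, sum_mul]
  rw [sum_comm]
  rw [Nat.card_eq_fintype_card, Fintype.card_subtype]
  rw [card_eq_sum_ones, sum_filter, sum_filter]
  push_cast
  refine sum_congr rfl fun A _ => ?_
  by_cases hA : C.IsFace A ∧ C.colors A = R
  · have h3 : A.card ≤ D := by
      have := hC.card_lt hA.1
      rw [hA.2] at this; omega
    have h4 := sum_coeff_mul_choose A.card (D - A.card) m
    rw [Nat.add_sub_cancel' h3] at h4
    rw [if_pos hA, h4]
    simp [hA]
  · rw [if_neg hA, if_neg fun h => hA ⟨h.1, h.2.1⟩]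

end ColConfig
end HPolynomial

section Numerics

/-- The backward difference of a sequence. -/
def bdiff (f : ℕ → ℤ) : ℕ → ℤ
  | 0 => f 0
  | i + 1 => f (i + 1) - f i

@[simp] theorem bdiff_zero (f : ℕ → ℤ) : bdiff f 0 = f 0 := rfl

@[simp] theorem bdiff_succ (f : ℕ → ℤ) (i : ℕ) : bdiff f (i + 1) = f (i + 1) - f i := rfl

theorem bdiff_nonneg {f : ℕ → ℤ} (h0 : 0 ≤ f 0) (h : ∀ i, f i ≤ f (i + 1)) (i : ℕ) :
    0 ≤ bdiff f i := by
  cases i with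
  | zero => exact h0
  | succ i => rw [bdiff_succ]; linarith [h i]

theorem succ_mul_multichoose (N : ℤ) (i : ℕ) :
    ((i : ℤ) + 1) * Ring.multichoose N (i + 1) = (N + i) * Ring.multichoose N i := by
  have h1 := Ring.factorial_nsmul_multichoose_eq_ascPochhammer N (i + 1)
  have h2 := Ring.factorial_nsmul_multichoose_eq_ascPochhammer N i
  rw [ascPochhammer_succ_right, Polynomial.smeval_mul, ← h2] at h1
  have h3 : (Polynomial.X + (i : Polynomial ℕ)).smeval N = N + i := by
    rw [Polynomial.smeval_add, Polynomial.smeval_X, Polynomial.smeval_natCast]; simp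
  rw [h3, Nat.factorial_succ] at h1
  simp only [nsmul_eq_mul] at h1
  push_cast at h1
  have h4 : ((i.factorial : ℕ) : ℤ) ≠ 0 := by exact_mod_cast i.factorial_ne_zero
  apply mul_left_cancel₀ h4
  linear_combination h1

theorem bdiff_multichoose (N : ℤ) (i : ℕ) :
    bdiff (Ring.multichoose N) i = Ring.multichoose (N - 1) i := by
  cases i with
  | zero => simp
  | succ i =>
    have := Ring.multichoose_succ_succ (N - 1) i
    rw [sub_add_cancel] at this
    rw [bdiff_succ, this]; ring

theorem sub_one_mul_multichoose (N : ℤ) (i : ℕ) :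
    (N - 1) * Ring.multichoose N i = (i + 1) * Ring.multichoose (N - 1) (i + 1) := by
  have h1 := succ_mul_multichoose N i
  have h2 := bdiff_multichoose N (i + 1)
  rw [bdiff_succ] at h2
  rw [← h2]; linear_combination -h1

/-- A sequence growing by a recursion with nonnegative slack is nonnegative and monotone. -/
theorem nonneg_and_mono_of_recursion {A s : ℕ → ℤ} {N : ℤ} (hN : 1 ≤ N) (h0 : A 0 = 0)
    (hs : ∀ i, 0 ≤ s i) (h : ∀ i : ℕ, ((i : ℤ) + 1) * A (i + 1) = (N + i) * A i + s i) (i : ℕ) :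
    0 ≤ A i ∧ A i ≤ A (i + 1) := by
  have key : ∀ i, 0 ≤ A i → A i ≤ A (i + 1) := by
    intro i hi
    have h1 := h i
    have h2 := hs i
    have h3 : (0 : ℤ) < (i : ℤ) + 1 := by positivity
    nlinarith [mul_nonneg (sub_nonneg.2 hN) hi]
  have hnn : ∀ i, 0 ≤ A i := by
    intro i
    induction i with
    | zero => rw [h0]
    | succ i ih => exact ih.trans (key i ih)
  exact ⟨hnn i, key i (hnn i)⟩

/-- The inequalities satisfied by the modified `h`-vectors of a three-coloured configuration. -/
structure HSystem (d n₁ n₂ n₃ : ℤ) (a₁ a₂ a₃ b₁₂ b₁₃ b₂₃ t : ℕ → ℤ) : Prop where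
  d_pos : 2 ≤ d
  n₁_le : d + 1 ≤ n₁
  n₂_le : d + 1 ≤ n₂
  n₃_le : d + 1 ≤ n₃
  a₁_zero : a₁ 0 = 1
  a₂_zero : a₂ 0 = 1
  a₃_zero : a₃ 0 = 1
  b₁₂_zero : b₁₂ 0 = -1
  b₁₃_zero : b₁₃ 0 = -1
  b₂₃_zero : b₂₃ 0 = -1
  t_zero : t 0 = 1
  a₁_le : ∀ i : ℕ, ((i : ℤ) + 1) * a₁ (i + 1) ≤ (n₁ - d + i) * a₁ i
  a₂_le : ∀ i : ℕ, ((i : ℤ) + 1) * a₂ (i + 1) ≤ (n₂ - d + i) * a₂ i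
  a₃_le : ∀ i : ℕ, ((i : ℤ) + 1) * a₃ (i + 1) ≤ (n₃ - d + i) * a₃ i
  b₁₂_le : ∀ i : ℕ, ((i : ℤ) + 1) * b₁₂ (i + 1) ≤ (n₁ + n₂ - d - 1 + i) * b₁₂ i +
    n₁ * bdiff a₂ i + n₂ * bdiff a₁ i
  b₁₃_le : ∀ i : ℕ, ((i : ℤ) + 1) * b₁₃ (i + 1) ≤ (n₁ + n₃ - d - 1 + i) * b₁₃ i +
    n₁ * bdiff a₃ i + n₃ * bdiff a₁ i
  b₂₃_le : ∀ i : ℕ, ((i : ℤ) + 1) * b₂₃ (i + 1) ≤ (n₂ + n₃ - d - 1 + i) * b₂₃ i +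
    n₂ * bdiff a₃ i + n₃ * bdiff a₂ i
  t_le : ∀ i : ℕ, ((i : ℤ) + 1) * t (i + 1) ≤ (n₁ + n₂ + n₃ - d - 2 + i) * t i +
    n₁ * bdiff b₂₃ i + n₂ * bdiff b₁₃ i + n₃ * bdiff b₁₂ i

/-- The deficit of a one-coloured `h`-vector. -/
def singleDef (d n : ℤ) (a : ℕ → ℤ) (i : ℕ) : ℤ := Ring.multichoose (n - d) i - a i

/-- The slack of the one-coloured recursion. -/
def singleSlack (d n : ℤ) (a : ℕ → ℤ) (i : ℕ) : ℤ := (n - d + i) * a i - (i + 1) * a (i + 1)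

theorem singleDef_succ (d n : ℤ) (a : ℕ → ℤ) (i : ℕ) :
    ((i : ℤ) + 1) * singleDef d n a (i + 1) =
      (n - d + i) * singleDef d n a i + singleSlack d n a i := by
  rw [singleDef, singleDef, singleSlack]
  linear_combination succ_mul_multichoose (n - d) i

/-- The deficit of a two-coloured `h`-vector. -/
def pairDef (d n m : ℤ) (b : ℕ → ℤ) (i : ℕ) : ℤ :=
  Ring.multichoose (n + m - d - 1) i - Ring.multichoose (n - d - 1) i -
    Ring.multichoose (m - d - 1) i - b i

/-- The slack of the two-coloured recursion. -/
def pairSlack (d n m : ℤ) (a a' b : ℕ → ℤ) (i : ℕ) : ℤ :=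
  (n + m - d - 1 + i) * b i + n * bdiff a' i + m * bdiff a i - (i + 1) * b (i + 1)

theorem bdiff_singleDef (d n : ℤ) (a : ℕ → ℤ) (i : ℕ) :
    bdiff (singleDef d n a) i = Ring.multichoose (n - d - 1) i - bdiff a i := by
  rw [← bdiff_multichoose]
  cases i <;> simp only [bdiff_zero, bdiff_succ, singleDef]
  ring

theorem pairDef_succ (d n m : ℤ) (a a' b : ℕ → ℤ) (i : ℕ) :
    ((i : ℤ) + 1) * pairDef d n m b (i + 1) = (n + m - d - 1 + i) * pairDef d n m b i +
      (n * bdiff (singleDef d m a') i + m * bdiff (singleDef d n a) i +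
        pairSlack d n m a a' b i) := by
  rw [pairDef, pairDef, pairSlack, bdiff_singleDef, bdiff_singleDef]
  linear_combination succ_mul_multichoose (n + m - d - 1) i - succ_mul_multichoose (n - d - 1) i -
    succ_mul_multichoose (m - d - 1) i

theorem bdiff_pairDef (d n m : ℤ) (b : ℕ → ℤ) (i : ℕ) :
    bdiff (pairDef d n m b) i = Ring.multichoose (n + m - d - 2) i -
      Ring.multichoose (n - d - 2) i - Ring.multichoose (m - d - 2) i - bdiff b i := by
  rw [show n + m - d - 2 = n + m - d - 1 - 1 by ring, show n - d - 2 = n - d - 1 - 1 by ring,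
    show m - d - 2 = m - d - 1 - 1 by ring, ← bdiff_multichoose, ← bdiff_multichoose,
    ← bdiff_multichoose]
  cases i <;> simp only [bdiff_zero, bdiff_succ, pairDef]
  ring

/-- The extremal three-coloured `h`-vector. -/
def tripleMax (d n₁ n₂ n₃ : ℤ) (i : ℕ) : ℤ :=
  Ring.multichoose (n₁ + n₂ + n₃ - d - 2) i - Ring.multichoose (n₁ + n₂ - d - 2) i -
    Ring.multichoose (n₁ + n₃ - d - 2) i - Ring.multichoose (n₂ + n₃ - d - 2) i +
    Ring.multichoose (n₁ - d - 2) i + Ring.multichoose (n₂ - d - 2) i +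
    Ring.multichoose (n₃ - d - 2) i

namespace HSystem

variable {d n₁ n₂ n₃ : ℤ} {a₁ a₂ a₃ b₁₂ b₁₃ b₂₃ t : ℕ → ℤ}

theorem singleDef_mono {n : ℤ} {a : ℕ → ℤ} (hn : d + 1 ≤ n) (h0 : a 0 = 1)
    (h : ∀ i : ℕ, ((i : ℤ) + 1) * a (i + 1) ≤ (n - d + i) * a i) (i : ℕ) :
    0 ≤ singleDef d n a i ∧ singleDef d n a i ≤ singleDef d n a (i + 1) :=
  nonneg_and_mono_of_recursion (N := n - d) (by linarith)
    (by simp [singleDef, h0])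
    (fun i => sub_nonneg.2 (h i)) (singleDef_succ d n a) i

theorem bdiff_singleDef_nonneg {n : ℤ} {a : ℕ → ℤ} (hn : d + 1 ≤ n) (h0 : a 0 = 1)
    (h : ∀ i : ℕ, ((i : ℤ) + 1) * a (i + 1) ≤ (n - d + i) * a i) (i : ℕ) :
    0 ≤ bdiff (singleDef d n a) i :=
  bdiff_nonneg (singleDef_mono hn h0 h 0).1 (fun i => (singleDef_mono hn h0 h i).2) i

theorem bdiff_pairDef_nonneg {n m : ℤ} {a a' b : ℕ → ℤ} (hd : 2 ≤ d) (hn : d + 1 ≤ n)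
    (hm : d + 1 ≤ m) (h0 : a 0 = 1)
    (h : ∀ i : ℕ, ((i : ℤ) + 1) * a (i + 1) ≤ (n - d + i) * a i) (h0' : a' 0 = 1)
    (h' : ∀ i : ℕ, ((i : ℤ) + 1) * a' (i + 1) ≤ (m - d + i) * a' i) (hb0 : b 0 = -1)
    (hb : ∀ i : ℕ, ((i : ℤ) + 1) * b (i + 1) ≤ (n + m - d - 1 + i) * b i +
      n * bdiff a' i + m * bdiff a i) (i : ℕ) :
    0 ≤ bdiff (pairDef d n m b) i := by
  have key := nonneg_and_mono_of_recursion (A := pairDef d n m b) (N := n + m - d - 1)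
    (by linarith) (by simp [pairDef, hb0])
    (fun i => ?_) (pairDef_succ d n m a a' b)
  · exact bdiff_nonneg (key 0).1 (fun i => (key i).2) i
  · have h1 := bdiff_singleDef_nonneg hn h0 h i
    have h2 := bdiff_singleDef_nonneg hm h0' h' i
    have h3 : 0 ≤ pairSlack d n m a a' b i := sub_nonneg.2 (hb i)
    have h4 : 0 ≤ n := by linarith
    have h5 : 0 ≤ m := by linarith
    positivity

theorem le_tripleMax (S : HSystem d n₁ n₂ n₃ a₁ a₂ a₃ b₁₂ b₁₃ b₂₃ t) (i : ℕ) :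
    t i ≤ tripleMax d n₁ n₂ n₃ i := by
  have hd := S.d_pos
  have h1 := S.n₁_le
  have h2 := S.n₂_le
  have h3 := S.n₃_le
  have key := nonneg_and_mono_of_recursion (A := fun i => tripleMax d n₁ n₂ n₃ i - t i)
    (N := n₁ + n₂ + n₃ - d - 2)
    (s := fun i => n₁ * bdiff (pairDef d n₂ n₃ b₂₃) i + n₂ * bdiff (pairDef d n₁ n₃ b₁₃) i +
      n₃ * bdiff (pairDef d n₁ n₂ b₁₂) i + ((n₁ + n₂ + n₃ - d - 2 + i) * t i +
      n₁ * bdiff b₂₃ i + n₂ * bdiff b₁₃ i + n₃ * bdiff b₁₂ i - (i + 1) * t (i + 1)))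
    (by linarith) (by simp [tripleMax, S.t_zero]) (fun i => ?_)
    (fun i => ?_) i
  · linarith [key.1]
  · have e1 := bdiff_pairDef_nonneg hd h2 h3 S.a₂_zero S.a₂_le S.a₃_zero S.a₃_le S.b₂₃_zero
      S.b₂₃_le i
    have e2 := bdiff_pairDef_nonneg hd h1 h3 S.a₁_zero S.a₁_le S.a₃_zero S.a₃_le S.b₁₃_zero
      S.b₁₃_le i
    have e3 := bdiff_pairDef_nonneg hd h1 h2 S.a₁_zero S.a₁_le S.a₂_zero S.a₂_le S.b₁₂_zero
      S.b₁₂_le i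
    have e4 := sub_nonneg.2 (S.t_le i)
    have e5 : 0 ≤ n₁ := by linarith
    have e6 : 0 ≤ n₂ := by linarith
    have e7 : 0 ≤ n₃ := by linarith
    positivity
  · simp only [bdiff_pairDef, tripleMax]
    linear_combination succ_mul_multichoose (n₁ + n₂ + n₃ - d - 2) i -
      succ_mul_multichoose (n₁ + n₂ - d - 2) i - succ_mul_multichoose (n₁ + n₃ - d - 2) i -
      succ_mul_multichoose (n₂ + n₃ - d - 2) i + succ_mul_multichoose (n₁ - d - 2) i +
      succ_mul_multichoose (n₂ - d - 2) i + succ_mul_multichoose (n₃ - d - 2) i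

end HSystem

/-- The deficit of the reflected three-coloured `h`-vector. -/
def reflDef (d n₁ n₂ n₃ : ℤ) (a₁ a₂ a₃ b₁₂ b₁₃ b₂₃ t : ℕ → ℤ) (i : ℕ) : ℤ :=
  Ring.multichoose (n₁ + n₂ + n₃ - d - 2) i - (t i + (bdiff b₁₂ i + bdiff b₁₃ i + bdiff b₂₃ i) +
    (bdiff (bdiff a₁) i + bdiff (bdiff a₂) i + bdiff (bdiff a₃) i))

namespace HSystem

variable {d n₁ n₂ n₃ : ℤ} {a₁ a₂ a₃ b₁₂ b₁₃ b₂₃ t : ℕ → ℤ}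

/-- The slack of the three-coloured recursion. -/
def tripleSlack (d n₁ n₂ n₃ : ℤ) (b₁₂ b₁₃ b₂₃ t : ℕ → ℤ) (i : ℕ) : ℤ :=
  (n₁ + n₂ + n₃ - d - 2 + i) * t i +
    n₁ * bdiff b₂₃ i + n₂ * bdiff b₁₃ i + n₃ * bdiff b₁₂ i - (i + 1) * t (i + 1)

theorem bdiff_pair_succ (d n m : ℤ) (a a' b : ℕ → ℤ) (i : ℕ) :
    ((i : ℤ) + 1) * bdiff b (i + 1) = (n + m - d - 2 + i) * bdiff b i +
      n * bdiff (bdiff a') i + m * bdiff (bdiff a) i - bdiff (pairSlack d n m a a' b) i := by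
  cases i with
  | zero => simp [pairSlack]; ring
  | succ i => simp only [bdiff_succ, pairSlack]; push_cast; ring

theorem bdiff_bdiff_single_succ (d n : ℤ) (a : ℕ → ℤ) (i : ℕ) :
    ((i : ℤ) + 1) * bdiff (bdiff a) (i + 1) = (n - d - 2 + i) * bdiff (bdiff a) i -
      bdiff (bdiff (singleSlack d n a)) i := by
  rcases i with _ | _ | i <;> simp only [bdiff_succ, bdiff_zero, singleSlack] <;> push_cast <;> ring

theorem reflDef_succ (d n₁ n₂ n₃ : ℤ) (a₁ a₂ a₃ b₁₂ b₁₃ b₂₃ t : ℕ → ℤ) (i : ℕ) :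
    ((i : ℤ) + 1) * reflDef d n₁ n₂ n₃ a₁ a₂ a₃ b₁₂ b₁₃ b₂₃ t (i + 1) =
      (n₁ + n₂ + n₃ - d - 2 + i) * reflDef d n₁ n₂ n₃ a₁ a₂ a₃ b₁₂ b₁₃ b₂₃ t i +
      tripleSlack d n₁ n₂ n₃ b₁₂ b₁₃ b₂₃ t i +
      (bdiff (pairSlack d n₁ n₂ a₁ a₂ b₁₂) i + bdiff (pairSlack d n₁ n₃ a₁ a₃ b₁₃) i +
        bdiff (pairSlack d n₂ n₃ a₂ a₃ b₂₃) i) +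
      (bdiff (bdiff (singleSlack d n₁ a₁)) i + bdiff (bdiff (singleSlack d n₂ a₂)) i +
        bdiff (bdiff (singleSlack d n₃ a₃)) i) := by
  unfold reflDef tripleSlack
  linear_combination succ_mul_multichoose (n₁ + n₂ + n₃ - d - 2) i -
    bdiff_pair_succ d n₁ n₂ a₁ a₂ b₁₂ i - bdiff_pair_succ d n₁ n₃ a₁ a₃ b₁₃ i -
    bdiff_pair_succ d n₂ n₃ a₂ a₃ b₂₃ i - bdiff_bdiff_single_succ d n₁ a₁ i -
    bdiff_bdiff_single_succ d n₂ a₂ i - bdiff_bdiff_single_succ d n₃ a₃ i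

theorem le_reflDef_succ (S : HSystem d n₁ n₂ n₃ a₁ a₂ a₃ b₁₂ b₁₃ b₂₃ t) (i : ℕ)
    (hi : (i : ℤ) ≤ 2 * d) :
    (n₁ - d - 1) * singleDef d n₁ a₁ i + (n₂ - d - 1) * singleDef d n₂ a₂ i +
        (n₃ - d - 1) * singleDef d n₃ a₃ i + singleSlack d n₁ a₁ i + singleSlack d n₂ a₂ i +
        singleSlack d n₃ a₃ i + pairSlack d n₁ n₂ a₁ a₂ b₁₂ i + pairSlack d n₁ n₃ a₁ a₃ b₁₃ i +
        pairSlack d n₂ n₃ a₂ a₃ b₂₃ i + tripleSlack d n₁ n₂ n₃ b₁₂ b₁₃ b₂₃ t i ≤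
      ((i : ℤ) + 1) * reflDef d n₁ n₂ n₃ a₁ a₂ a₃ b₁₂ b₁₃ b₂₃ t (i + 1) := by
  have hd := S.d_pos
  have h1 := S.n₁_le
  have h2 := S.n₂_le
  have h3 := S.n₃_le
  have sa1 : ∀ i, 0 ≤ singleSlack d n₁ a₁ i := fun i => sub_nonneg.2 (S.a₁_le i)
  have sa2 : ∀ i, 0 ≤ singleSlack d n₂ a₂ i := fun i => sub_nonneg.2 (S.a₂_le i)
  have sa3 : ∀ i, 0 ≤ singleSlack d n₃ a₃ i := fun i => sub_nonneg.2 (S.a₃_le i)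
  have sb1 : ∀ i, 0 ≤ pairSlack d n₁ n₂ a₁ a₂ b₁₂ i := fun i => sub_nonneg.2 (S.b₁₂_le i)
  have sb2 : ∀ i, 0 ≤ pairSlack d n₁ n₃ a₁ a₃ b₁₃ i := fun i => sub_nonneg.2 (S.b₁₃_le i)
  have sb3 : ∀ i, 0 ≤ pairSlack d n₂ n₃ a₂ a₃ b₂₃ i := fun i => sub_nonneg.2 (S.b₂₃_le i)
  have st : ∀ i, 0 ≤ tripleSlack d n₁ n₂ n₃ b₁₂ b₁₃ b₂₃ t i := fun i => sub_nonneg.2 (S.t_le i)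
  have A1 := fun i => (singleDef_mono h1 S.a₁_zero S.a₁_le i).1
  have A2 := fun i => (singleDef_mono h2 S.a₂_zero S.a₂_le i).1
  have A3 := fun i => (singleDef_mono h3 S.a₃_zero S.a₃_le i).1
  have z1 : singleDef d n₁ a₁ 0 = 0 := by simp [singleDef, S.a₁_zero]
  have z2 : singleDef d n₂ a₂ 0 = 0 := by simp [singleDef, S.a₂_zero]
  have z3 : singleDef d n₃ a₃ 0 = 0 := by simp [singleDef, S.a₃_zero]
  have zY : reflDef d n₁ n₂ n₃ a₁ a₂ a₃ b₁₂ b₁₃ b₂₃ t 0 = 0 := by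
    simp [reflDef, S.a₁_zero, S.a₂_zero, S.a₃_zero, S.b₁₂_zero, S.b₁₃_zero, S.b₂₃_zero, S.t_zero]
  induction i with
  | zero =>
    rw [reflDef_succ, z1, z2, z3, zY]
    simp only [bdiff_zero]
    linarith
  | succ i ih =>
    have ih := ih (by push_cast at hi; linarith)
    have hY := reflDef_succ d n₁ n₂ n₃ a₁ a₂ a₃ b₁₂ b₁₃ b₂₃ t (i + 1)
    have r1 := singleDef_succ d n₁ a₁ i
    have r2 := singleDef_succ d n₂ a₂ i
    have r3 := singleDef_succ d n₃ a₃ i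
    have g : ∀ f : ℕ → ℤ, (∀ i, 0 ≤ f i) → f (i + 1) - 2 * f i ≤ bdiff (bdiff f) (i + 1) := by
      intro f hf
      cases i with
      | zero => simp only [zero_add, bdiff_succ, bdiff_zero]; linarith
      | succ i => simp only [bdiff_succ]; linarith [hf i]
    have g1 := g _ sa1
    have g2 := g _ sa2
    have g3 := g _ sa3
    rw [bdiff_succ (pairSlack d n₁ n₂ a₁ a₂ b₁₂), bdiff_succ (pairSlack d n₁ n₃ a₁ a₃ b₁₃),
      bdiff_succ (pairSlack d n₂ n₃ a₂ a₃ b₂₃)] at hY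
    have hi0 : (0 : ℤ) < (i : ℤ) + 1 := by positivity
    push_cast at hi hY ⊢
    set Y := reflDef d n₁ n₂ n₃ a₁ a₂ a₃ b₁₂ b₁₃ b₂₃ t (i + 1)
    set M := n₁ + n₂ + n₃ - d - 2 with hM
    suffices H : ((i : ℤ) + 1) * ((n₁ - d - 1) * singleDef d n₁ a₁ (i + 1) +
        (n₂ - d - 1) * singleDef d n₂ a₂ (i + 1) + (n₃ - d - 1) * singleDef d n₃ a₃ (i + 1) +
        2 * (singleSlack d n₁ a₁ i + singleSlack d n₂ a₂ i + singleSlack d n₃ a₃ i) +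
        (pairSlack d n₁ n₂ a₁ a₂ b₁₂ i + pairSlack d n₁ n₃ a₁ a₃ b₁₃ i +
          pairSlack d n₂ n₃ a₂ a₃ b₂₃ i)) ≤ ((i : ℤ) + 1) * ((M + (i + 1)) * Y) by
      have := le_of_mul_le_mul_left H hi0
      linarith
    have hMi : 0 ≤ M + (i + 1) := by linarith
    have e := mul_le_mul_of_nonneg_left ih hMi
    have f1 : 0 ≤ (M + 1 - (n₁ - d)) * ((n₁ - d - 1) * singleDef d n₁ a₁ i) :=
      mul_nonneg (by linarith) (mul_nonneg (by linarith) (A1 i))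
    have f2 : 0 ≤ (M + 1 - (n₂ - d)) * ((n₂ - d - 1) * singleDef d n₂ a₂ i) :=
      mul_nonneg (by linarith) (mul_nonneg (by linarith) (A2 i))
    have f3 : 0 ≤ (M + 1 - (n₃ - d)) * ((n₃ - d - 1) * singleDef d n₃ a₃ i) :=
      mul_nonneg (by linarith) (mul_nonneg (by linarith) (A3 i))
    have p1 : 0 ≤ (M - (i + 1) - (n₁ - d - 1)) * singleSlack d n₁ a₁ i :=
      mul_nonneg (by linarith) (sa1 i)
    have p2 : 0 ≤ (M - (i + 1) - (n₂ - d - 1)) * singleSlack d n₂ a₂ i :=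
      mul_nonneg (by linarith) (sa2 i)
    have p3 : 0 ≤ (M - (i + 1) - (n₃ - d - 1)) * singleSlack d n₃ a₃ i :=
      mul_nonneg (by linarith) (sa3 i)
    have q : 0 ≤ M * (pairSlack d n₁ n₂ a₁ a₂ b₁₂ i + pairSlack d n₁ n₃ a₁ a₃ b₁₃ i +
        pairSlack d n₂ n₃ a₂ a₃ b₂₃ i) :=
      mul_nonneg (by linarith) (by linarith [sb1 i, sb2 i, sb3 i])
    have q' := mul_nonneg hMi (st i)
    have r1' := congrArg (fun x => (n₁ - d - 1) * x) r1
    have r2' := congrArg (fun x => (n₂ - d - 1) * x) r2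
    have r3' := congrArg (fun x => (n₃ - d - 1) * x) r3
    linarith

theorem reflDef_nonneg (S : HSystem d n₁ n₂ n₃ a₁ a₂ a₃ b₁₂ b₁₃ b₂₃ t) (i : ℕ)
    (hi : (i : ℤ) ≤ 2 * d + 1) : 0 ≤ reflDef d n₁ n₂ n₃ a₁ a₂ a₃ b₁₂ b₁₃ b₂₃ t i := by
  have h1 := S.n₁_le
  have h2 := S.n₂_le
  have h3 := S.n₃_le
  cases i with
  | zero =>
    simp [reflDef, S.a₁_zero, S.a₂_zero, S.a₃_zero, S.b₁₂_zero, S.b₁₃_zero, S.b₂₃_zero, S.t_zero]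
  | succ i =>
    have key := S.le_reflDef_succ i (by push_cast at hi; linarith)
    have A1 := mul_nonneg (sub_nonneg.2 (le_sub_iff_add_le'.2 h1))
      (singleDef_mono h1 S.a₁_zero S.a₁_le i).1
    have A2 := mul_nonneg (sub_nonneg.2 (le_sub_iff_add_le'.2 h2))
      (singleDef_mono h2 S.a₂_zero S.a₂_le i).1
    have A3 := mul_nonneg (sub_nonneg.2 (le_sub_iff_add_le'.2 h3))
      (singleDef_mono h3 S.a₃_zero S.a₃_le i).1
    have s1 : 0 ≤ singleSlack d n₁ a₁ i := sub_nonneg.2 (S.a₁_le i)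
    have s2 : 0 ≤ singleSlack d n₂ a₂ i := sub_nonneg.2 (S.a₂_le i)
    have s3 : 0 ≤ singleSlack d n₃ a₃ i := sub_nonneg.2 (S.a₃_le i)
    have s4 : 0 ≤ pairSlack d n₁ n₂ a₁ a₂ b₁₂ i := sub_nonneg.2 (S.b₁₂_le i)
    have s5 : 0 ≤ pairSlack d n₁ n₃ a₁ a₃ b₁₃ i := sub_nonneg.2 (S.b₁₃_le i)
    have s6 : 0 ≤ pairSlack d n₂ n₃ a₂ a₃ b₂₃ i := sub_nonneg.2 (S.b₂₃_le i)
    have s7 : 0 ≤ tripleSlack d n₁ n₂ n₃ b₁₂ b₁₃ b₂₃ t i := sub_nonneg.2 (S.t_le i)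
    refine nonneg_of_mul_nonneg_right ?_ (show (0 : ℤ) < (i : ℤ) + 1 by positivity)
    linarith

theorem single_le_of_middle {n : ℤ} {a : ℕ → ℤ} {m : ℕ}
    (ha : a (m + 1) = a m) :
    ((m : ℤ) + 1) * Ring.multichoose (n - d - 1) (m + 1) =
      (n - d - 1) * singleDef d n a m + singleSlack d n a m := by
  rw [singleSlack, singleDef, ha, ← sub_one_mul_multichoose (n - d) m]
  ring

theorem le_reflDef_middle (S : HSystem d n₁ n₂ n₃ a₁ a₂ a₃ b₁₂ b₁₃ b₂₃ t) {m : ℕ}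
    (hmd : (m : ℤ) ≤ 2 * d) (ha₁ : a₁ (m + 1) = a₁ m) (ha₂ : a₂ (m + 1) = a₂ m)
    (ha₃ : a₃ (m + 1) = a₃ m) :
    Ring.multichoose (n₁ - d - 1) (m + 1) + Ring.multichoose (n₂ - d - 1) (m + 1) +
        Ring.multichoose (n₃ - d - 1) (m + 1) ≤
      reflDef d n₁ n₂ n₃ a₁ a₂ a₃ b₁₂ b₁₃ b₂₃ t (m + 1) := by
  have key := S.le_reflDef_succ m hmd
  have e1 := single_le_of_middle (d := d) (n := n₁) ha₁
  have e2 := single_le_of_middle (d := d) (n := n₂) ha₂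
  have e3 := single_le_of_middle (d := d) (n := n₃) ha₃
  have s4 : 0 ≤ pairSlack d n₁ n₂ a₁ a₂ b₁₂ m := sub_nonneg.2 (S.b₁₂_le m)
  have s5 : 0 ≤ pairSlack d n₁ n₃ a₁ a₃ b₁₃ m := sub_nonneg.2 (S.b₁₃_le m)
  have s6 : 0 ≤ pairSlack d n₂ n₃ a₂ a₃ b₂₃ m := sub_nonneg.2 (S.b₂₃_le m)
  have s7 : 0 ≤ tripleSlack d n₁ n₂ n₃ b₁₂ b₁₃ b₂₃ t m := sub_nonneg.2 (S.t_le m)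
  refine le_of_mul_le_mul_left ?_ (show (0 : ℤ) < (m : ℤ) + 1 by positivity)
  linarith

end HSystem
end Numerics

section Combination

open Polynomial

theorem bdiff_coeff (p : ℤ[X]) (i : ℕ) : bdiff p.coeff i = ((1 - X) * p).coeff i := by
  cases i with
  | zero => rw [bdiff_zero, coeff_one_sub_X_mul_zero]
  | succ i => rw [bdiff_succ, coeff_one_sub_X_mul_succ]

theorem bdiff_bdiff_coeff (p : ℤ[X]) (i : ℕ) :
    bdiff (bdiff p.coeff) i = ((1 - X) ^ 2 * p).coeff i := by
  rw [funext (bdiff_coeff p), bdiff_coeff, ← mul_assoc, ← sq]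

theorem ch_nonneg_eq {D m i : ℕ} (hi : i ≤ D) :
    ch ((D : ℤ) - i) ((m : ℤ) - i) = if i ≤ m then ((D - i).choose (m - i) : ℤ) else 0 := by
  unfold ch
  split_ifs with h1 h2 h2
  · rw [← Nat.cast_sub hi, ← Nat.cast_sub h2, Int.toNat_natCast, Ring.choose_natCast]
  · omega
  · omega
  · rfl

theorem ch_eq_multichoose (a : ℤ) (i : ℕ) : ch a i = Ring.multichoose (a - i + 1) i := by
  rw [ch, if_pos (by positivity), Int.toNat_natCast, Ring.choose]

namespace ColConfig

variable {d : ℕ} {ι : Type*} [Fintype ι] [DecidableEq ι] {C : ColConfig d (Fin 3) ι}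

theorem Gen.hSystem (hC : C.Gen) (hF : C.Full) (hd : 2 ≤ d) :
    HSystem d (C.cls 0).card (C.cls 1).card (C.cls 2).card (C.hmod {0}).coeff (C.hmod {1}).coeff
      (C.hmod {2}).coeff (C.hmod {0, 1}).coeff (C.hmod {0, 2}).coeff (C.hmod {1, 2}).coeff
      (C.hmod {0, 1, 2}).coeff where
  d_pos := by exact_mod_cast hd
  n₁_le := by exact_mod_cast hF 0
  n₂_le := by exact_mod_cast hF 1
  n₃_le := by exact_mod_cast hF 2
  a₁_zero := by rw [coeff_hmod_zero (by simp)]; simp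
  a₂_zero := by rw [coeff_hmod_zero (by simp)]; simp
  a₃_zero := by rw [coeff_hmod_zero (by simp)]; simp
  b₁₂_zero := by rw [coeff_hmod_zero (by simp)]; simp
  b₁₃_zero := by rw [coeff_hmod_zero (by simp)]; simp
  b₂₃_zero := by rw [coeff_hmod_zero (by simp)]; simp
  t_zero := by
    rw [coeff_hmod_zero (by simp), show ({0, 1, 2} : Finset (Fin 3)).card = 3 by decide]; norm_num
  a₁_le i := by
    have := hC.hmod_succ_le hF hd (R := {0}) i
    simpa [hmod_empty hd] using this
  a₂_le i := by
    have := hC.hmod_succ_le hF hd (R := {1}) i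
    simpa [hmod_empty hd] using this
  a₃_le i := by
    have := hC.hmod_succ_le hF hd (R := {2}) i
    simpa [hmod_empty hd] using this
  b₁₂_le i := by
    have := hC.hmod_succ_le hF hd (R := {0, 1}) i
    rw [sum_pair (by decide), sum_pair (by decide),
      show ({0, 1} : Finset (Fin 3)).card = 2 by decide,
      show ({0, 1} : Finset (Fin 3)).erase 0 = {1} by decide,
      show ({0, 1} : Finset (Fin 3)).erase 1 = {0} by decide] at this
    simp only [bdiff_coeff]
    push_cast at this
    linarith
  b₁₃_le i := by
    have := hC.hmod_succ_le hF hd (R := {0, 2}) i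
    rw [sum_pair (by decide), sum_pair (by decide),
      show ({0, 2} : Finset (Fin 3)).card = 2 by decide,
      show ({0, 2} : Finset (Fin 3)).erase 0 = {2} by decide,
      show ({0, 2} : Finset (Fin 3)).erase 2 = {0} by decide] at this
    simp only [bdiff_coeff]
    push_cast at this
    linarith
  b₂₃_le i := by
    have := hC.hmod_succ_le hF hd (R := {1, 2}) i
    rw [sum_pair (by decide), sum_pair (by decide),
      show ({1, 2} : Finset (Fin 3)).card = 2 by decide,
      show ({1, 2} : Finset (Fin 3)).erase 1 = {2} by decide,
      show ({1, 2} : Finset (Fin 3)).erase 2 = {1} by decide] at this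
    simp only [bdiff_coeff]
    push_cast at this
    linarith
  t_le i := by
    have := hC.hmod_succ_le hF hd (R := {0, 1, 2}) i
    rw [show ({0, 1, 2} : Finset (Fin 3)) = insert 0 {1, 2} from rfl, sum_insert (by decide),
      sum_pair (by decide), sum_insert (by decide), sum_pair (by decide),
      show (insert 0 {1, 2} : Finset (Fin 3)).card = 3 by decide,
      show (insert 0 {1, 2} : Finset (Fin 3)).erase 0 = {1, 2} by decide,
      show (insert 0 {1, 2} : Finset (Fin 3)).erase 1 = {0, 2} by decide,
      show (insert 0 {1, 2} : Finset (Fin 3)).erase 2 = {0, 1} by decide] at this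
    simp only [bdiff_coeff]
    push_cast at this
    linarith

theorem Gen.coeff_hmod_singleton_sub (hC : C.Gen) (hF : C.Full) (hd : 2 ≤ d) (a : Fin 3) {i : ℕ}
    (hi : i ≤ d) : (C.hmod {a}).coeff (d - i) = (C.hmod {a}).coeff i := by
  conv_rhs => rw [← hC.reflect_hmod_singleton hF hd a]
  rw [coeff_reflect, revAt_le hi]

/-- The bound on the `h`-coefficients of a three-coloured configuration. -/
theorem Gen.coeff_hmod_triple_le (hC : C.Gen) (hF : C.Full) (hd : 2 ≤ d) {i : ℕ}
    (hi : i ≤ d + 2) :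
    (C.hmod {0, 1, 2}).coeff i ≤
      Ring.multichoose ((C.cls 0).card + (C.cls 1).card + (C.cls 2).card - d - 2 : ℤ)
        (min i (d + 2 - i)) -
      (if i ≤ (d + 2) / 2 then Ring.multichoose
        ((C.cls 0).card + (C.cls 1).card + (C.cls 2).card - d - 2 : ℤ) i -
        tripleMax d (C.cls 0).card (C.cls 1).card (C.cls 2).card i else 0) -
      (if d % 2 = 1 ∧ i = d / 2 + 2 then
        Ring.multichoose ((C.cls 0).card - d - 1 : ℤ) (d / 2 + 1) +
        Ring.multichoose ((C.cls 1).card - d - 1 : ℤ) (d / 2 + 1) +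
        Ring.multichoose ((C.cls 2).card - d - 1 : ℤ) (d / 2 + 1) else 0) := by
  have S := hC.hSystem hF hd
  by_cases h : i ≤ (d + 2) / 2
  · rw [if_pos h, if_neg (by omega), min_eq_left (by omega)]
    linarith [S.le_tripleMax i]
  · rw [if_neg h, min_eq_right (by omega)]
    have key : (C.hmod {0, 1, 2}).coeff i =
        Ring.multichoose ((C.cls 0).card + (C.cls 1).card + (C.cls 2).card - d - 2 : ℤ)
        (d + 2 - i) - reflDef d (C.cls 0).card (C.cls 1).card (C.cls 2).card (C.hmod {0}).coeff
          (C.hmod {1}).coeff (C.hmod {2}).coeff (C.hmod {0, 1}).coeff (C.hmod {0, 2}).coeff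
          (C.hmod {1, 2}).coeff (C.hmod {0, 1, 2}).coeff (d + 2 - i) := by
      have := congrArg (fun p => p.coeff (d + 2 - i)) (hC.reflect_hmod_triple hF hd
        (a := 0) (b := 1) (c := 2) (by decide) (by decide) (by decide))
      simp only [coeff_reflect, revAt_le (Nat.sub_le (d + 2) i), Nat.sub_sub_self hi, mul_add,
        coeff_add] at this
      rw [reflDef]
      simp only [bdiff_bdiff_coeff, bdiff_coeff]
      rw [this]
      ring
    rw [key]
    split_ifs with h2
    · obtain ⟨h2, h3⟩ := h2
      have e : d + 2 - i = d / 2 + 1 := by omega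
      rw [e]
      have hs : ∀ a, (C.hmod {a}).coeff (d / 2 + 1) = (C.hmod {a}).coeff (d / 2) := fun a => by
        rw [← hC.coeff_hmod_singleton_sub hF hd a (i := d / 2) (by omega)]
        congr 1
        omega
      have := S.le_reflDef_middle (m := d / 2) (by omega) (hs 0) (hs 1) (hs 2)
      linarith
    · have := S.reflDef_nonneg (d + 2 - i) (by omega)
      linarith

theorem sum_proper_subsets (n : Fin 3 → ℕ) (d i : ℕ) :
    ∑ S ∈ (Finset.univ : Finset (Fin 3)).powerset.filter
      (fun S => S ≠ ∅ ∧ S ≠ Finset.univ),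
      (-1 : ℤ) ^ S.card * ch ((∑ j ∈ S, (n j : ℤ)) - (d : ℤ) - 3 + (i : ℤ)) (i : ℤ) =
    Ring.multichoose ((n 0 : ℤ) + n 1 + n 2 - d - 2) i - tripleMax d (n 0) (n 1) (n 2) i := by
  have e : (Finset.univ : Finset (Fin 3)).powerset.filter (fun S => S ≠ ∅ ∧ S ≠ Finset.univ) =
      {{0}, {1}, {2}, {0, 1}, {0, 2}, {1, 2}} := by decide
  have r : ∀ x : ℤ, x - d - 3 + i - i + 1 = x - d - 2 := fun x => by ring
  have six : ∀ f : Finset (Fin 3) → ℤ, ∑ S ∈ {{0}, {1}, {2}, {0, 1}, {0, 2}, {1, 2}}, f S =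
      f {0} + f {1} + f {2} + f {0, 1} + f {0, 2} + f {1, 2} := fun f => by
    rw [sum_insert (by decide), sum_insert (by decide), sum_insert (by decide),
      sum_insert (by decide), sum_pair (by decide)]
    ring
  rw [e, six]
  simp only [ch_eq_multichoose, r]
  have c2 : ({0, 1} : Finset (Fin 3)).card = 2 ∧ ({0, 2} : Finset (Fin 3)).card = 2 ∧
    ({1, 2} : Finset (Fin 3)).card = 2 := by decide
  rw [c2.1, c2.2.1, c2.2.2, sum_pair (by decide), sum_pair (by decide), sum_pair (by decide)]
  simp only [card_singleton, sum_singleton, tripleMax]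
  ring

theorem Gen.card_mixed_faces_le (hC : C.Gen) (hF : C.Full) (hd : 2 ≤ d) {n : Fin 3 → ℕ}
    (hn : ∀ j, (C.cls j).card = n j) {k : ℕ} (hk : k ≤ d) :
    (Nat.card {A // C.IsFace A ∧ C.colors A = univ ∧ A.card = k + 2} : ℤ) ≤
      ∑ i ∈ range (k + 2 + 1), Ring.multichoose ((n 0 : ℤ) + n 1 + n 2 - d - 2)
        (min i (d + 2 - i)) * ((d + 2 - i).choose (k + 2 - i) : ℤ) -
      (∑ i ∈ Finset.range ((d + 2) / 2 + 1),
        ch ((d : ℤ) + 2 - (i : ℤ)) ((k : ℤ) + 2 - (i : ℤ)) *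
          ∑ S ∈ (Finset.univ : Finset (Fin 3)).powerset.filter
              (fun S => S ≠ ∅ ∧ S ≠ Finset.univ),
            (-1 : ℤ) ^ S.card * ch ((∑ j ∈ S, (n j : ℤ)) - (d : ℤ) - 3 + (i : ℤ)) (i : ℤ)) -
      ((d : ℤ) - 2 * ((d / 2 : ℕ) : ℤ)) *
        ch (((d / 2 : ℕ) : ℤ) + 1) ((k : ℤ) - ((d / 2 : ℕ) : ℤ)) *
        ∑ i : Fin 3, ch ((n i : ℤ) - ((d / 2 : ℕ) : ℤ) - 2) (((d / 2 : ℕ) : ℤ) + 1) := by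
  have hu : (univ : Finset (Fin 3)) = {0, 1, 2} := by decide
  have hcard := hC.card_faces_eq hd (R := (univ : Finset (Fin 3))) (D := d + 2) (m := k + 2)
    (by simp) (by omega)
  rw [hcard]
  have hle : ∀ i ∈ range (k + 2 + 1), (C.hmod univ).coeff i *
      ((d + 2 - i).choose (k + 2 - i) : ℤ) ≤ _ := fun i hi =>
    mul_le_mul_of_nonneg_right (hu ▸ hC.coeff_hmod_triple_le hF hd (i := i)
      (by rw [mem_range] at hi; omega)) (by positivity)
  refine (sum_le_sum hle).trans (le_of_eq ?_)
  simp only [hn, sub_mul, sum_sub_distrib]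
  congr 1
  · congr 1
    have h1 : ∀ i ∈ range ((d + 2) / 2 + 1), ch ((d : ℤ) + 2 - (i : ℤ)) ((k : ℤ) + 2 - (i : ℤ)) =
        if i ≤ k + 2 then ((d + 2 - i).choose (k + 2 - i) : ℤ) else 0 := fun i hi => by
      rw [mem_range] at hi
      have := ch_nonneg_eq (D := d + 2) (m := k + 2) (i := i) (by omega)
      push_cast at this
      exact this
    rw [sum_congr (g := fun i => _ * (_ - _)) (s₁ := range ((d + 2) / 2 + 1)) rfl
      fun i hi => by rw [h1 i hi, sum_proper_subsets]]
    simp only [ite_mul, zero_mul, ← sum_filter]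
    refine sum_congr ?_ fun i _ => by ring
    ext i
    simp only [mem_filter, mem_range]
    omega
  · simp only [ite_mul, zero_mul, ← sum_filter]
    rcases Nat.even_or_odd' d with ⟨q, hq | hq⟩
    · rw [sum_eq_zero]
      · rw [show d / 2 = q by omega, hq]; push_cast; ring
      · intro i hi
        simp only [mem_filter] at hi
        omega
    · have e : d / 2 = q := by omega
      have e2 : ∀ a : ℤ, ch (a - q - 2) ((q : ℤ) + 1) =
          Ring.multichoose (a - d - 1) (q + 1) := fun a => by
        have := ch_eq_multichoose (a - q - 2) (q + 1)
        push_cast at this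
        rw [this, hq]; push_cast; congr 1; ring
      rw [e, Fin.sum_univ_three, e2, e2, e2]
      have e3 : ch ((q : ℤ) + 1) ((k : ℤ) - q) =
          if q + 2 ≤ k + 2 then ((d + 2 - (q + 2)).choose (k + 2 - (q + 2)) : ℤ) else 0 := by
        rw [← ch_nonneg_eq (by omega), hq]
        push_cast
        congr 1 <;> ring
      rw [e3]
      by_cases hqk : q ≤ k
      · have e4 : (range (k + 2 + 1)).filter (fun i => d % 2 = 1 ∧ i = q + 2) = {q + 2} := by
          ext i
          simp only [mem_filter, mem_range, mem_singleton]
          omega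
        rw [e4, sum_singleton, if_pos (by omega), hq]
        push_cast
        ring
      · rw [if_neg (by omega), sum_eq_zero]
        · ring
        · intro i hi
          simp only [mem_filter, mem_range] at hi
          omega

end ColConfig

end Combination

section Density

open Filter Topology

/-- The complement of a proper affine subspace, written in homogeneous coordinates, is dense. -/
theorem dense_elim_notMem {m n : Type*} [Fintype m] [Fintype n] {U : Submodule ℝ (m ⊕ n → ℝ)}
    {e : n → ℝ} {x₀ : m → ℝ} (h : Sum.elim x₀ e ∉ U) : Dense {x : m → ℝ | Sum.elim x e ∉ U} := by
  intro x
  by_cases hx : Sum.elim x e ∈ U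
  · have hlim : Tendsto (fun t : ℝ => x + t • (x₀ - x)) (𝓝[≠] 0) (𝓝 x) := by
      have : Continuous fun t : ℝ => x + t • (x₀ - x) := by fun_prop
      have h0 := this.tendsto 0
      simp only [zero_smul, add_zero] at h0
      exact h0.mono_left nhdsWithin_le_nhds
    refine mem_closure_of_tendsto hlim ?_
    filter_upwards [self_mem_nhdsWithin] with t ht
    intro hmem
    apply h
    have e1 : Sum.elim (x + t • (x₀ - x)) e = Sum.elim x e + t • (Sum.elim x₀ e - Sum.elim x e) := by
      ext (i | i) <;> simp
    rw [e1, Submodule.add_mem_iff_right _ hx, Submodule.smul_mem_iff _ ht,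
      Submodule.sub_mem_iff_left _ hx] at hmem
    exact hmem
  · exact subset_closure hx

theorem isOpen_elim_notMem {m n : Type*} [Fintype m] [Fintype n] (U : Submodule ℝ (m ⊕ n → ℝ))
    (e : n → ℝ) : IsOpen {x : m → ℝ | Sum.elim x e ∉ U} := by
  have hc : Continuous fun x : m → ℝ => (Sum.elim x e : m ⊕ n → ℝ) := by
    refine continuous_pi fun j => ?_
    rcases j with j | j
    · exact continuous_apply j
    · exact continuous_const
  exact (U.closed_of_finiteDimensional.isOpen_compl).preimage hc

namespace ColConfig

variable {d : ℕ} {κ ι : Type*} [Fintype κ] [DecidableEq κ] [Fintype ι] [DecidableEq ι]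

theorem exists_elim_notMem_spn {C : ColConfig d κ ι} {B : Finset ι} (c : κ)
    (hB : B.card < d + (C.colors B).card) :
    ∃ x : Fin d → ℝ, Sum.elim x (Pi.single c 1) ∉ C.spn B := by
  by_contra! h
  have h1 : ∀ i, (Pi.single (Sum.inl i) 1 : Fin d ⊕ κ → ℝ) ∈ C.spn B := fun i => by
    have := Submodule.sub_mem _ (h (Pi.single i 1)) (h 0)
    convert this using 1
    ext (j | j) <;> simp [Pi.single_apply]
  have h2 := C.le_finrank_of_forall_mem h1 (S := B) fun a ha => C.vec_mem_spn ha
  have h3 : Module.finrank ℝ (C.spn B) ≤ B.card := finrank_span_image_le _ _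
  omega

/-- Generic configurations are dense. -/
theorem exists_gen_near (C : ColConfig d κ ι) {ε : ℝ} (hε : 0 < ε) :
    ∃ p : ι → Fin d → ℝ, (∀ a, dist (p a) (C.pt a) < ε) ∧ (ColConfig.mk p C.col).Gen := by
  suffices H : ∀ S : Finset ι, ∃ p : ι → Fin d → ℝ, (∀ a, dist (p a) (C.pt a) < ε) ∧
      ∀ B ⊆ S, B.card ≤ d + (C.colors B).card →
        LinearIndepOn ℝ (ColConfig.mk p C.col).vec (B : Set ι) by
    obtain ⟨p, hp, h⟩ := H univ
    exact ⟨p, hp, fun B hB => h B (subset_univ _) hB⟩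
  intro S
  induction S using Finset.induction_on with
  | empty =>
    refine ⟨C.pt, fun a => by simpa using hε, fun B hB _ => ?_⟩
    rw [subset_empty.1 hB]
    simp
  | insert a S ha ih =>
    obtain ⟨p, hp, hS⟩ := ih
    let I := {B : Finset ι // B.card < d + (C.colors B).card}
    have hdense : Dense (⋂ B : I, {x : Fin d → ℝ | Sum.elim x (Pi.single (C.col a) 1) ∉
        (ColConfig.mk p C.col).spn B.1}) := by
      refine dense_iInter_of_isOpen (fun B => isOpen_elim_notMem _ _) fun B => ?_
      obtain ⟨x₀, hx₀⟩ := exists_elim_notMem_spn (C := ColConfig.mk p C.col) (C.col a) B.2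
      exact dense_elim_notMem hx₀
    obtain ⟨x, hx, hxd⟩ := hdense.exists_dist_lt (C.pt a) hε
    rw [dist_comm] at hxd
    rw [Set.mem_iInter] at hx
    have hvec : ∀ b, b ≠ a → (ColConfig.mk (Function.update p a x) C.col).vec b =
        (ColConfig.mk p C.col).vec b := fun b hb => by simp [vec, hb]
    refine ⟨Function.update p a x, fun b => ?_, fun B hB hcard => ?_⟩
    · by_cases hb : b = a
      · subst hb; simpa using hxd
      · simpa [hb] using hp b
    · have hcongr : ∀ T : Finset ι, a ∉ T → (LinearIndepOn ℝ (ColConfig.mk p C.col).vec (T : Set ι) →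
          LinearIndepOn ℝ (ColConfig.mk (Function.update p a x) C.col).vec (T : Set ι)) :=
        fun T hT h => h.congr fun b hb => (hvec b fun hba => hT (hba ▸ hb)).symm
      by_cases haB : a ∈ B
      swap
      · exact hcongr B haB (hS B ((subset_insert_iff_of_notMem haB).1 hB) hcard)
      have hBe : insert a (B.erase a) = B := insert_erase haB
      have hsub : B.erase a ⊆ S := subset_insert_iff.1 hB
      have hna : a ∉ B.erase a := notMem_erase a B
      have hcB : B.card = (B.erase a).card + 1 := by rw [← card_insert_of_notMem hna, hBe]
      have hcol : C.colors B = insert (C.col a) (C.colors (B.erase a)) := by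
        conv_lhs => rw [← hBe]
        exact image_insert _ _ _
      have himg : (ColConfig.mk (Function.update p a x) C.col).vec '' (B.erase a : Set ι) =
          (ColConfig.mk p C.col).vec '' (B.erase a : Set ι) :=
        Set.image_congr fun b hb => hvec b fun hba => hna (by subst hba; exact_mod_cast hb)
      rw [← hBe, coe_insert, linearIndepOn_insert (by exact_mod_cast hna), himg]
      by_cases hca : C.col a ∈ C.colors (B.erase a)
      · rw [insert_eq_of_mem hca] at hcol
        rw [hcol] at hcard
        refine ⟨hcongr _ hna (hS _ hsub (by omega)), ?_⟩
        have := hx ⟨B.erase a, by omega⟩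
        simpa [vec, spn] using this
      · rw [hcol, card_insert_of_notMem hca] at hcard
        refine ⟨hcongr _ hna (hS _ hsub (by omega)), fun hmem => ?_⟩
        have := dotProduct_eq_zero_of_mem_span (z := Pi.single (Sum.inr (C.col a)) 1) hmem
          fun b hb => ?_
        · simp [vec] at this
        · have : C.col b ≠ C.col a := fun h => hca (h ▸ C.col_mem_colors (by exact_mod_cast hb))
          simp [vec, this]

end ColConfig

end Density

section Perturbation

open Filter Topology

namespace ColConfig

variable {d : ℕ} {κ ι : Type*} [Fintype κ] [DecidableEq κ] [Fintype ι] [DecidableEq ι]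
variable {C : ColConfig d κ ι}

theorem not_proper_iff {y : Fin d ⊕ κ → ℝ} : ¬Proper y ↔ ∀ i, y (Sum.inl i) = 0 := by
  simp [Proper]

theorem dotProduct_vec_of_not_proper {y : Fin d ⊕ κ → ℝ} (hy : ¬Proper y) (a : ι) :
    y ⬝ᵥ C.vec a = y (Sum.inr (C.col a)) := by
  have : (fun i => y (Sum.inl i)) = 0 := funext (not_proper_iff.1 hy)
  rw [dotProduct_vec, this, zero_dotProduct, zero_add]

/-- The functional summing the colour coordinates. -/
def colorSum (d : ℕ) (κ : Type*) : Fin d ⊕ κ → ℝ := Sum.elim 0 1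

@[simp] theorem colorSum_dotProduct_vec (a : ι) : colorSum d κ ⬝ᵥ C.vec a = 1 := by
  rw [dotProduct_vec_of_not_proper (not_proper_iff.2 fun i => rfl)]
  rfl

theorem dotProduct_sum_smul_vec (y : Fin d ⊕ κ → ℝ) (γ : ι → ℝ) :
    y ⬝ᵥ ∑ a, γ a • C.vec a = ∑ a, γ a * (y ⬝ᵥ C.vec a) := by
  simp [dotProduct_sum, dotProduct_smul]

theorem dotProduct_sum_vec (y : Fin d ⊕ κ → ℝ) :
    y ⬝ᵥ ∑ a, C.vec a = ∑ a, y ⬝ᵥ C.vec a := dotProduct_sum _ _ _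

/-- The ray shooting lemma: the point where a ray leaves the cone over a configuration. -/
theorem Gen.exists_exit [Nonempty κ] (hC : C.Gen) (hF : C.Full) {γ : ι → ℝ} (hγ : ∀ a, 0 ≤ γ a)
    {τ : ℝ} (hτ : ∀ c, τ * (C.cls c).card ≤ ∑ a ∈ C.cls c, γ a) :
    ∃ (t : ℝ) (μ : ι → ℝ), 0 ≤ t ∧ t ≤ ∑ a, γ a ∧ (∀ a, 0 ≤ μ a ∧ μ a ≤ ∑ a, γ a) ∧
      (∀ x, C.Feas x → t * (x ⬝ᵥ ∑ a, C.vec a) ≤ x ⬝ᵥ ∑ a, γ a • C.vec a) ∧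
      (t < τ → ∑ a, γ a • C.vec a - t • ∑ a, C.vec a = ∑ a, μ a • C.vec a ∧
        ∃ Z, C.IsFace Z ∧ ∀ a, μ a ≠ 0 → a ∈ Z) := by
  classical
  have hsurj : ∀ c, ∃ a, C.col a = c := fun c => by
    obtain ⟨a, ha⟩ := card_pos.1 (lt_of_lt_of_le (Nat.succ_pos d) (hF c))
    exact ⟨a, by simpa [cls] using ha⟩
  have hΓ : 0 ≤ ∑ a, γ a := sum_nonneg fun a _ => hγ a
  have hpos : ∀ y, C.Feas y → (∀ a ∈ (∅ : Finset ι), y ⬝ᵥ C.vec a = 0) → y ≠ 0 →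
      0 < y ⬝ᵥ ∑ a, C.vec a := by
    intro y hy _ hne
    rw [dotProduct_sum_vec]
    refine lt_of_le_of_ne (sum_nonneg fun a _ => hy a) fun h => hne ?_
    have h0 : ∀ a, y ⬝ᵥ C.vec a = 0 := fun a =>
      (sum_eq_zero_iff_of_nonneg fun a _ => hy a).1 h.symm a (mem_univ a)
    obtain ⟨c⟩ := ‹Nonempty κ›
    refine eq_zero_of_not_proper (C := C) (hC.not_proper_of_cls hF c fun a _ => h0 a) fun c => ?_
    obtain ⟨a, ha⟩ := hsurj c
    exact ⟨a, ha, h0 a⟩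
  have hfeas : C.Feas (colorSum d κ) := fun a => by rw [colorSum_dotProduct_vec]; exact zero_le_one
  have hne0 : colorSum d κ ≠ 0 := by
    obtain ⟨c⟩ := ‹Nonempty κ›
    exact fun h => one_ne_zero (congrFun h (Sum.inr c))
  obtain ⟨y, hy, -, hy1, hmax, hfirst⟩ := C.exists_maximizer ∅ (∑ a, C.vec a)
    (-∑ a, γ a • C.vec a) hpos ⟨_, hfeas, by simp, hne0⟩
  set t := y ⬝ᵥ ∑ a, γ a • C.vec a with ht
  have ht0 : 0 ≤ t := by
    rw [ht, dotProduct_sum_smul_vec]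
    exact sum_nonneg fun a _ => mul_nonneg (hγ a) (hy a)
  have hmin : ∀ x, C.Feas x → t * (x ⬝ᵥ ∑ a, C.vec a) ≤ x ⬝ᵥ ∑ a, γ a • C.vec a := fun x hx => by
    have := hmax x hx (by simp)
    rw [dotProduct_neg, dotProduct_neg] at this
    linarith
  have hcs : ∀ ν : ι → ℝ, colorSum d κ ⬝ᵥ ∑ a, ν a • C.vec a = ∑ a, ν a := fun ν => by
    rw [dotProduct_sum_smul_vec]; simp
  have hcs1 : colorSum d κ ⬝ᵥ ∑ a, C.vec a = Fintype.card ι := by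
    rw [dotProduct_sum_vec]; simp
  have hι : (1 : ℝ) ≤ Fintype.card ι := by
    obtain ⟨c⟩ := ‹Nonempty κ›
    obtain ⟨a, -⟩ := hsurj c
    exact_mod_cast Fintype.card_pos_iff.2 ⟨a⟩
  have htΓ : t ≤ ∑ a, γ a := by
    have := hmin _ hfeas
    rw [hcs, hcs1] at this
    nlinarith
  by_cases hyP : Proper y
  swap
  · refine ⟨t, 0, ht0, htΓ, fun a => ⟨le_rfl, hΓ⟩, hmin, fun hlt => absurd hlt (not_lt.2 ?_)⟩
    have e1 : ∀ ν : ι → ℝ, y ⬝ᵥ ∑ a, ν a • C.vec a =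
        ∑ c, y (Sum.inr c) * ∑ a ∈ C.cls c, ν a := fun ν => by
      rw [dotProduct_sum_smul_vec, ← Finset.sum_fiberwise univ C.col]
      refine sum_congr rfl fun c _ => ?_
      rw [mul_sum]
      refine sum_congr rfl fun a ha => ?_
      rw [dotProduct_vec_of_not_proper hyP, (mem_filter.1 ha).2, mul_comm]
    have e2 : y ⬝ᵥ ∑ a, C.vec a = ∑ c, y (Sum.inr c) * (C.cls c).card := by
      have := e1 1
      simpa using this
    rw [ht, e1, ← mul_one τ, ← hy1, e2, mul_sum]
    refine sum_le_sum fun c _ => ?_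
    have hyc : 0 ≤ y (Sum.inr c) := by
      obtain ⟨a, ha⟩ := hsurj c
      have := hy a
      rwa [dotProduct_vec_of_not_proper hyP, ha] at this
    have := mul_le_mul_of_nonneg_left (hτ c) hyc
    linarith
  · have hZ : C.IsFace (C.zeros y) := ⟨y, hy, hyP, rfl⟩
    have hind := hC.indep hZ
    set x := ∑ a, γ a • C.vec a - t • ∑ a, C.vec a with hx
    have hfo : ∀ z, (∀ a ∈ C.zeros y, 0 ≤ z ⬝ᵥ C.vec a) → 0 ≤ z ⬝ᵥ x := fun z hz => by
      have := hfirst z (fun a ha => hz a (C.mem_zeros.2 ha)) (by simp)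
      rw [dotProduct_neg, dotProduct_neg, ← ht] at this
      rw [hx, dotProduct_sub, dotProduct_smul, smul_eq_mul]
      linarith
    have hspan : x ∈ Submodule.span ℝ (C.vec '' (C.zeros y : Set ι)) := by
      refine mem_span_image_of_forall fun z hz => le_antisymm ?_ (hfo z fun a ha => (hz a ha).ge)
      have := hfo (-z) fun a ha => by rw [neg_dotProduct, hz a ha, neg_zero]
      rw [neg_dotProduct] at this
      linarith
    obtain ⟨μ, hμ⟩ := exists_sum_of_mem_span hspan
    have hμ0 : ∀ a ∈ C.zeros y, 0 ≤ μ a := fun a ha => by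
      obtain ⟨z, hz⟩ := hind.exists_dotProduct_eq (Pi.single a 1)
      have h1 := hfo z fun b hb => by
        rw [hz b hb]
        by_cases hba : b = a
        · subst hba; simp
        · simp [hba]
      rw [hμ, dotProduct_sum] at h1
      rw [sum_eq_single a (fun b hb hba => by rw [dotProduct_smul, hz b hb]; simp [hba])
        (fun h => absurd ha h), dotProduct_smul, hz a ha] at h1
      simpa using h1
    have hμx : x = ∑ a, (if a ∈ C.zeros y then μ a else 0) • C.vec a := by
      simp only [ite_smul, zero_smul, sum_ite_mem, univ_inter, hμ]
    refine ⟨t, fun a => if a ∈ C.zeros y then μ a else 0, ht0, htΓ, fun a => ?_, hmin,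
      fun _ => ⟨hμx, _, hZ, fun a ha => by_contra fun h => ha (if_neg h)⟩⟩
    have hnn : ∀ a, 0 ≤ if a ∈ C.zeros y then μ a else 0 := fun a => by
      split_ifs with h
      exacts [hμ0 a h, le_rfl]
    refine ⟨hnn a, (single_le_sum (fun b _ => hnn b) (mem_univ a)).trans ?_⟩
    rw [← hcs, ← hμx, hx, dotProduct_sub, dotProduct_smul, hcs, hcs1, smul_eq_mul]
    nlinarith

/-- A positive combination avoiding all the proper subspaces spanned by subfamilies. -/
theorem exists_generic_combination (C : ColConfig d κ ι) (B : Finset ι) :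
    ∃ γ : ι → ℝ, (∀ a ∈ B, 0 < γ a) ∧ (∀ a ∉ B, γ a = 0) ∧
      ∀ T ⊆ B, ∑ a, γ a • C.vec a ∈ C.spn T → C.spn B ≤ C.spn T := by
  classical
  have key : ∀ T : Finset ι, ∀ᶠ ε : ℝ in 𝓝[>] 0,
      ∑ a ∈ B, ε ^ ((Fintype.equivFin ι a : ℕ) + 1) • C.vec a ∈ C.spn T → C.spn B ≤ C.spn T := by
    intro T
    by_cases hT : C.spn B ≤ C.spn T
    · exact Eventually.of_forall fun _ _ => hT
    have h1 : ∃ b ∈ B, C.vec b ∉ C.spn T := by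
      by_contra! h
      exact hT (Submodule.span_le.2 (by rintro _ ⟨b, hb, rfl⟩; exact h b hb))
    obtain ⟨b, hb, hbT⟩ := h1
    obtain ⟨z, hz, hzb⟩ : ∃ z : Fin d ⊕ κ → ℝ, (∀ u ∈ C.spn T, z ⬝ᵥ u = 0) ∧ z ⬝ᵥ C.vec b ≠ 0 := by
      by_contra! h
      exact hbT (mem_of_forall_dotProduct_eq_zero h)
    filter_upwards [eventually_sum_pow_ne_zero B (fun a => z ⬝ᵥ C.vec a)
      (fun a => (Fintype.equivFin ι a : ℕ))
      (fun x _ y _ hxy => (Fintype.equivFin ι).injective (Fin.ext hxy)) 0 hb hzb] with ε hε hmem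
    exfalso
    apply hε
    rw [zero_add, ← hz _ hmem, dotProduct_sum]
    exact sum_congr rfl fun a _ => by rw [dotProduct_smul, smul_eq_mul]
  obtain ⟨ε, hε, hε0⟩ := ((eventually_all.2 key).and self_mem_nhdsWithin).exists
  refine ⟨fun a => if a ∈ B then ε ^ ((Fintype.equivFin ι a : ℕ) + 1) else 0,
    fun a ha => by simpa [ha] using pow_pos hε0 _, fun a ha => by simp [ha], fun T _ hT => ?_⟩
  refine hε T ?_
  simpa only [ite_smul, zero_smul, sum_ite_mem, univ_inter] using hT

theorem exists_basis_subset (C : ColConfig d κ ι) (T : Finset ι) :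
    ∃ A ⊆ T, LinearIndepOn ℝ C.vec (A : Set ι) ∧ C.spn A = C.spn T := by
  obtain ⟨b, hbT, -, hspan, hb⟩ := exists_linearIndepOn_extension
    (linearIndepOn_empty ℝ C.vec) (Set.empty_subset (T : Set ι))
  have hfin : b.Finite := T.finite_toSet.subset hbT
  refine ⟨hfin.toFinset, by simpa using hbT, by simpa using hb, le_antisymm ?_ ?_⟩
  · exact Submodule.span_mono (Set.image_mono (by simpa using hbT))
  · refine Submodule.span_le.2 ?_
    simpa [spn] using hspan

theorem vec_tendsto {p : ℕ → ι → Fin d → ℝ} (hp : Tendsto p atTop (𝓝 C.pt)) (a : ι) :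
    Tendsto (fun j => (ColConfig.mk (p j) C.col).vec a) atTop (𝓝 (C.vec a)) := by
  rw [tendsto_pi_nhds] at hp ⊢
  rintro (i | c)
  · exact (tendsto_pi_nhds.1 (hp a)) i
  · exact tendsto_const_nhds

theorem dotProduct_tendsto {m : Type*} [Fintype m] {u : ℕ → m → ℝ} {v y : m → ℝ}
    (h : Tendsto u atTop (𝓝 v)) : Tendsto (fun j => y ⬝ᵥ u j) atTop (𝓝 (y ⬝ᵥ v)) := by
  simp_rw [dotProduct_comm y]
  exact ((continuous_dotProduct_right y).tendsto v).comp h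

/-- A face of a configuration contains a face of some nearby generic configuration having
the same linear span. -/
theorem exists_isFace_of_tendsto [Nonempty κ] (hF : C.Full) {p : ℕ → ι → Fin d → ℝ}
    (hp : Tendsto p atTop (𝓝 C.pt)) (hG : ∀ j, (ColConfig.mk (p j) C.col).Gen)
    {y : Fin d ⊕ κ → ℝ} (hy : C.Feas y) (hcol : C.colors (C.zeros y) = univ)
    {b : ι} (hb : y ⬝ᵥ C.vec b ≠ 0) :
    ∃ j, ∃ A ⊆ C.zeros y, (ColConfig.mk (p j) C.col).IsFace A ∧
      LinearIndepOn ℝ C.vec (A : Set ι) ∧ C.spn A = C.spn (C.zeros y) := by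
  classical
  obtain ⟨γ, hγpos, hγ0, hγgen⟩ := C.exists_generic_combination (C.zeros y)
  have hγ : ∀ a, 0 ≤ γ a := fun a => by
    by_cases ha : a ∈ C.zeros y
    exacts [(hγpos a ha).le, (hγ0 a ha).ge]
  have hcls : ∀ c, (0 : ℝ) < (C.cls c).card := fun c => by
    exact_mod_cast (Nat.succ_pos d).trans_le (hF c)
  have hsum : ∀ c, 0 < ∑ a ∈ C.cls c, γ a := fun c => by
    obtain ⟨a, ha, hac⟩ := mem_image.1 (hcol.symm ▸ mem_univ c : c ∈ C.colors (C.zeros y))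
    exact sum_pos' (fun b _ => hγ b) ⟨a, C.mem_cls.2 hac, hγpos a ha⟩
  obtain ⟨c₀, -, hc₀⟩ := exists_min_image univ
    (fun c => (∑ a ∈ C.cls c, γ a) / (C.cls c).card) univ_nonempty
  set τ := (∑ a ∈ C.cls c₀, γ a) / (C.cls c₀).card with hτ
  have hτ0 : 0 < τ := div_pos (hsum c₀) (hcls c₀)
  have hτc : ∀ c, τ * (C.cls c).card ≤ ∑ a ∈ C.cls c, γ a := fun c => by
    have := hc₀ c (mem_univ c)
    rwa [← le_div_iff₀ (hcls c)]
  choose t μ ht0 htΓ hμ hmin hexit using fun j =>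
    Gen.exists_exit (hG j) (show (ColConfig.mk (p j) C.col).Full from hF) hγ hτc
  set Γ := ∑ a, γ a with hΓ
  have hcomp : IsCompact (Set.Icc (0 : ℝ) Γ ×ˢ Set.univ.pi fun _ : ι => Set.Icc (0 : ℝ) Γ) :=
    isCompact_Icc.prod (isCompact_univ_pi fun _ => isCompact_Icc)
  obtain ⟨⟨t', μ'⟩, hmem, φ, hφ, hlim⟩ := hcomp.tendsto_subseq (x := fun j => (t j, μ j))
    fun j => ⟨⟨ht0 j, htΓ j⟩, fun a _ => ⟨(hμ j a).1, (hμ j a).2⟩⟩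
  have htl : Tendsto (fun j => t (φ j)) atTop (𝓝 t') := (continuous_fst.tendsto _).comp hlim
  have hμl : Tendsto (fun j => μ (φ j)) atTop (𝓝 μ') := (continuous_snd.tendsto _).comp hlim
  have hμl' : ∀ a, Tendsto (fun j => μ (φ j) a) atTop (𝓝 (μ' a)) := tendsto_pi_nhds.1 hμl
  have hw : ∀ a, Tendsto (fun j => (ColConfig.mk (p (φ j)) C.col).vec a) atTop (𝓝 (C.vec a)) :=
    fun a => vec_tendsto (hp.comp hφ.tendsto_atTop) a
  have hw0 : Tendsto (fun j => ∑ a, (ColConfig.mk (p (φ j)) C.col).vec a) atTop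
      (𝓝 (∑ a, C.vec a)) := tendsto_finsetSum _ fun a _ => hw a
  have hwγ : Tendsto (fun j => ∑ a, γ a • (ColConfig.mk (p (φ j)) C.col).vec a) atTop
      (𝓝 (∑ a, γ a • C.vec a)) := tendsto_finsetSum _ fun a _ => (hw a).const_smul _
  have hyγ : y ⬝ᵥ ∑ a, γ a • C.vec a = 0 := by
    rw [dotProduct_sum_smul_vec]
    refine sum_eq_zero fun a _ => ?_
    by_cases ha : a ∈ C.zeros y
    · rw [C.mem_zeros.1 ha, mul_zero]
    · rw [hγ0 a ha, zero_mul]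
  have hy0 : 0 < y ⬝ᵥ ∑ a, C.vec a := by
    rw [dotProduct_sum_vec]
    exact sum_pos' (fun a _ => hy a) ⟨b, mem_univ b, lt_of_le_of_ne (hy b) hb.symm⟩
  have ht'0 : 0 ≤ t' := hmem.1.1
  have hcs : colorSum d κ ⬝ᵥ ∑ a, γ a • C.vec a = Γ := by
    rw [dotProduct_sum_smul_vec]; simp [hΓ]
  have hcs0 : 0 ≤ colorSum d κ ⬝ᵥ ∑ a, C.vec a := by
    rw [dotProduct_sum_vec]; simp
  have hbound : ∀ η : ℝ, 0 < η → t' * (y ⬝ᵥ ∑ a, C.vec a) ≤ η * Γ := by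
    intro η hη
    set x := y + η • colorSum d κ with hx
    have hev : ∀ᶠ j in atTop, (ColConfig.mk (p (φ j)) C.col).Feas x := by
      refine eventually_all.2 fun a => ?_
      have h0 : 0 < x ⬝ᵥ C.vec a := by
        rw [hx, add_dotProduct, smul_dotProduct, colorSum_dotProduct_vec, smul_eq_mul, mul_one]
        linarith [hy a]
      filter_upwards [(dotProduct_tendsto (y := x) (hw a)).eventually (lt_mem_nhds h0)] with j hj
      exact hj.le
    have hle := le_of_tendsto_of_tendsto (htl.mul (dotProduct_tendsto (y := x) hw0))
      (dotProduct_tendsto (y := x) hwγ) (hev.mono fun j hj => hmin (φ j) x hj)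
    rw [hx, add_dotProduct, add_dotProduct, smul_dotProduct, smul_dotProduct, hyγ, hcs,
      smul_eq_mul, smul_eq_mul, mul_add] at hle
    have : 0 ≤ t' * (η * (colorSum d κ ⬝ᵥ ∑ a, C.vec a)) := by positivity
    linarith
  have ht' : t' = 0 := by
    by_contra h
    have hpos : 0 < t' * (y ⬝ᵥ ∑ a, C.vec a) :=
      mul_pos (lt_of_le_of_ne ht'0 (Ne.symm h)) hy0
    have hΓ0 : 0 ≤ Γ := sum_nonneg fun a _ => hγ a
    have := hbound (t' * (y ⬝ᵥ ∑ a, C.vec a) / (Γ + 1)) (by positivity)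
    rw [div_mul_eq_mul_div, le_div_iff₀ (by positivity)] at this
    nlinarith
  have hlt : ∀ᶠ j in atTop, t (φ j) < τ := htl.eventually (gt_mem_nhds (ht' ▸ hτ0))
  have heq : ∑ a, γ a • C.vec a = ∑ a, μ' a • C.vec a := by
    have h1 := hwγ.sub (htl.smul hw0)
    have h2 : Tendsto (fun j => ∑ a, μ (φ j) a • (ColConfig.mk (p (φ j)) C.col).vec a) atTop
      (𝓝 (∑ a, μ' a • C.vec a)) := tendsto_finsetSum _ fun a _ => (hμl' a).smul (hw a)
    have h3 := tendsto_nhds_unique_of_eventuallyEq h1 h2 (hlt.mono fun j hj => (hexit (φ j) hj).1)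
    rwa [ht', zero_smul, sub_zero] at h3
  have hμ'0 : ∀ a, 0 ≤ μ' a := fun a => (hmem.2 a trivial).1
  set T := univ.filter fun a => μ' a ≠ 0 with hT
  have hTB : T ⊆ C.zeros y := fun a ha => by
    have h1 : ∑ a, μ' a * (y ⬝ᵥ C.vec a) = 0 := by rw [← dotProduct_sum_smul_vec, ← heq, hyγ]
    have h2 := (sum_eq_zero_iff_of_nonneg fun a _ => mul_nonneg (hμ'0 a) (hy a)).1 h1 a (mem_univ a)
    exact C.mem_zeros.2 ((mul_eq_zero.1 h2).resolve_left (mem_filter.1 ha).2)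
  have hspn : C.spn (C.zeros y) ≤ C.spn T := by
    refine hγgen T hTB ?_
    rw [heq]
    refine Submodule.sum_mem _ fun a _ => ?_
    by_cases ha : μ' a = 0
    · simp [ha]
    · exact Submodule.smul_mem _ _ (C.vec_mem_spn (by simp [hT, ha]))
  obtain ⟨A, hAT, hA, hAspn⟩ := C.exists_basis_subset T
  have hne : ∀ᶠ j in atTop, ∀ a ∈ T, μ (φ j) a ≠ 0 := by
    refine (eventually_all_finset T).2 fun a ha => ?_
    exact (hμl' a).eventually_ne (mem_filter.1 ha).2
  obtain ⟨j, hj, hj'⟩ := (hlt.and hne).exists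
  obtain ⟨-, Z, hZ, hμZ⟩ := hexit (φ j) hj
  refine ⟨φ j, A, hAT.trans hTB, (hG _).isFace_subset hZ fun a ha => hμZ a (hj' a (hAT ha)), hA, ?_⟩
  exact hAspn.trans (le_antisymm (Submodule.span_mono (Set.image_mono (by exact_mod_cast hTB))) hspn)

/-- There is a generic configuration, with the same colours, such that every proper face of the
given configuration meeting all colours contains a face of the former with the same span. -/
theorem exists_gen_forall_face [Nonempty κ] (hF : C.Full) :
    ∃ p : ι → Fin d → ℝ, (ColConfig.mk p C.col).Gen ∧
      ∀ y, C.Feas y → C.colors (C.zeros y) = univ → (∃ b, y ⬝ᵥ C.vec b ≠ 0) →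
        ∃ A ⊆ C.zeros y, (ColConfig.mk p C.col).IsFace A ∧
          LinearIndepOn ℝ C.vec (A : Set ι) ∧ C.spn A = C.spn (C.zeros y) := by
  classical
  choose p hpd hpG using fun j : ℕ => C.exists_gen_near (Nat.one_div_pos_of_nat (α := ℝ) (n := j))
  have hp : Tendsto p atTop (𝓝 C.pt) := by
    refine tendsto_pi_nhds.2 fun a => tendsto_iff_dist_tendsto_zero.2 ?_
    exact squeeze_zero (fun _ => dist_nonneg) (fun j => (hpd j a).le)
      tendsto_one_div_add_atTop_nhds_zero_nat
  have key : ∀ B : Finset ι, ∀ᶠ j in atTop, (∃ y, C.Feas y ∧ C.colors (C.zeros y) = univ ∧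
      (∃ b, y ⬝ᵥ C.vec b ≠ 0) ∧ C.zeros y = B) → ∃ A ⊆ B, (ColConfig.mk (p j) C.col).IsFace A ∧
        LinearIndepOn ℝ C.vec (A : Set ι) ∧ C.spn A = C.spn B := by
    intro B
    by_contra hcon
    obtain ⟨φ, hφ, h⟩ := extraction_of_frequently_atTop (not_eventually.1 hcon)
    simp only [Classical.not_imp] at h
    obtain ⟨y, hy, hcol, ⟨b, hb⟩, rfl⟩ := (h 0).1
    obtain ⟨j, hj⟩ := exists_isFace_of_tendsto hF (hp.comp hφ.tendsto_atTop)
      (fun j => hpG (φ j)) hy hcol hb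
    exact (h j).2 hj
  obtain ⟨j, hj⟩ := (eventually_all.2 key).exists
  exact ⟨p j, hpG j, fun y hy hcol hb => hj _ ⟨y, hy, hcol, hb, rfl⟩⟩

end ColConfig

end Perturbation

section Hull

/-- The points of a convex hull minimizing a linear functional form the convex hull
of the generators minimizing it. -/
theorem sep_convexHull {E : Type*} [AddCommGroup E] [Module ℝ E] {s : Set E} (l : E →ₗ[ℝ] ℝ)
    {m : ℝ} (h : ∀ x ∈ s, m ≤ l x) :
    {x ∈ convexHull ℝ s | l x = m} = convexHull ℝ {x ∈ s | l x = m} := by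
  have hm : convexHull ℝ {x ∈ s | l x = m} ⊆ {x | l x = m} :=
    convexHull_min (fun x hx => hx.2) (convex_hyperplane l.isLinear m)
  refine Set.Subset.antisymm ?_ fun x hx => ⟨convexHull_mono (fun x hx => hx.1) hx, hm hx⟩
  have hT : convexHull ℝ s ⊆ {x | m < l x ∨ x ∈ convexHull ℝ {x ∈ s | l x = m}} := by
    refine convexHull_min (fun x hx => ?_) (convex_iff_forall_pos.2 ?_)
    · rcases (h x hx).lt_or_eq with h' | h'
      exacts [Or.inl h', Or.inr (subset_convexHull ℝ _ ⟨hx, h'.symm⟩)]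
    · have hle : ∀ x, (m < l x ∨ x ∈ convexHull ℝ {x ∈ s | l x = m}) → m ≤ l x := fun x hx =>
        hx.elim le_of_lt fun hx => (hm hx).ge
      intro x hx y hy a b ha hb hab
      have hx' := hle x hx
      have hy' := hle y hy
      simp only [Set.mem_ofPred_eq, map_add, map_smul, smul_eq_mul]
      have hmab : m = a * m + b * m := by rw [← add_mul, hab, one_mul]
      rcases hx with hx | hx
      · left; nlinarith
      rcases hy with hy | hy
      · left; nlinarith
      · exact Or.inr (convex_convexHull ℝ _ hx hy ha.le hb.le hab)
  intro x hx
  exact (hT hx.1).resolve_left fun h' => h'.ne' hx.2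

namespace ColConfig

variable {d : ℕ} {κ ι : Type*} [Fintype κ] [DecidableEq κ] [Fintype ι] [DecidableEq ι]
variable (C : ColConfig d κ ι)

/-- The sums of one point of each colour, chosen among the members of `B`. -/
def selSum (B : Finset ι) : Set (Fin d → ℝ) :=
  (fun f : κ → ι => ∑ c, C.pt (f c)) '' {f | ∀ c, f c ∈ B ∧ C.col (f c) = c}

/-- The Minkowski sum of the convex hulls of the colour classes of `B`. -/
def hull (B : Finset ι) : Set (Fin d → ℝ) := convexHull ℝ (C.selSum B)

variable {C}

theorem sum_dotProduct_vec_selection (y : Fin d ⊕ κ → ℝ) {f : κ → ι} (hf : ∀ c, C.col (f c) = c) :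
    ∑ c, y ⬝ᵥ C.vec (f c) =
      (fun i => y (Sum.inl i)) ⬝ᵥ (∑ c, C.pt (f c)) + ∑ c, y (Sum.inr c) := by
  rw [dotProduct_sum, ← sum_add_distrib]
  exact sum_congr rfl fun c _ => by rw [dotProduct_vec, hf]

theorem selSum_nonempty {B : Finset ι} (hB : C.colors B = univ) : (C.selSum B).Nonempty := by
  have : ∀ c, ∃ a ∈ B, C.col a = c := fun c =>
    mem_image.1 (hB.symm ▸ mem_univ c : c ∈ C.colors B)
  choose f hf using this
  exact ⟨_, f, hf, rfl⟩

theorem hull_nonempty {B : Finset ι} (hB : C.colors B = univ) : (C.hull B).Nonempty :=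
  convexHull_nonempty_iff.2 (selSum_nonempty hB)

theorem neg_sum_le_of_mem_selSum {y : Fin d ⊕ κ → ℝ} (hy : C.Feas y) {x : Fin d → ℝ}
    (hx : x ∈ C.selSum univ) :
    -∑ c, y (Sum.inr c) ≤ (fun i => y (Sum.inl i)) ⬝ᵥ x := by
  obtain ⟨f, hf, rfl⟩ := hx
  have h1 := sum_dotProduct_vec_selection y fun c => (hf c).2
  have h2 : 0 ≤ ∑ c, y ⬝ᵥ C.vec (f c) := sum_nonneg fun c _ => hy _
  simp only
  linarith

theorem neg_sum_le_of_mem_hull {y : Fin d ⊕ κ → ℝ} (hy : C.Feas y) {x : Fin d → ℝ}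
    (hx : x ∈ C.hull univ) :
    -∑ c, y (Sum.inr c) ≤ (fun i => y (Sum.inl i)) ⬝ᵥ x :=
  convexHull_min (fun _ h => neg_sum_le_of_mem_selSum hy h)
    (convex_halfSpace_ge (dotProductBilin ℝ ℝ (fun i => y (Sum.inl i))).isLinear _) hx

/-- The face of a Minkowski sum cut out by a supporting functional. -/
theorem hull_zeros {y : Fin d ⊕ κ → ℝ} (hy : C.Feas y) :
    C.hull (C.zeros y) =
      {x ∈ C.hull univ | (fun i => y (Sum.inl i)) ⬝ᵥ x = -∑ c, y (Sum.inr c)} := by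
  have h := sep_convexHull (dotProductBilin ℝ ℝ (fun i => y (Sum.inl i)))
    (s := C.selSum univ) (m := -∑ c, y (Sum.inr c)) fun x hx => neg_sum_le_of_mem_selSum hy hx
  refine Eq.trans ?_ h.symm
  unfold hull
  congr 1
  ext x
  constructor
  · rintro ⟨f, hf, rfl⟩
    refine ⟨⟨f, fun c => ⟨mem_univ _, (hf c).2⟩, rfl⟩, ?_⟩
    have h1 := sum_dotProduct_vec_selection y fun c => (hf c).2
    rw [sum_eq_zero fun c _ => C.mem_zeros.1 (hf c).1] at h1
    simp only [dotProductBilin_apply_apply]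
    linarith
  · rintro ⟨⟨f, hf, rfl⟩, hx⟩
    refine ⟨f, fun c => ⟨C.mem_zeros.2 ?_, (hf c).2⟩, rfl⟩
    have h1 := sum_dotProduct_vec_selection y fun c => (hf c).2
    simp only [dotProductBilin_apply_apply] at hx
    rw [hx, neg_add_cancel] at h1
    exact (sum_eq_zero_iff_of_nonneg fun c _ => hy _).1 h1 c (mem_univ c)

theorem isExposed_hull_zeros {y : Fin d ⊕ κ → ℝ} (hy : C.Feas y)
    (hcol : C.colors (C.zeros y) = univ) : IsExposed ℝ (C.hull univ) (C.hull (C.zeros y)) := by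
  intro _
  refine ⟨-LinearMap.toContinuousLinearMap (dotProductBilin ℝ ℝ (fun i => y (Sum.inl i))), ?_⟩
  obtain ⟨x₀, hx₀⟩ := hull_nonempty hcol
  rw [hull_zeros hy] at hx₀ ⊢
  ext x
  simp only [Set.mem_ofPred_eq, neg_apply,
    LinearMap.coe_toContinuousLinearMap', dotProductBilin_apply_apply, neg_le_neg_iff]
  refine and_congr_right fun hx => ⟨fun h z hz => h ▸ neg_sum_le_of_mem_hull hy hz, fun h => ?_⟩
  exact le_antisymm (hx₀.2 ▸ h x₀ hx₀.1) (neg_sum_le_of_mem_hull hy hx)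

theorem exists_eq_hull_zeros (hsurj : ∀ c, ∃ a, C.col a = c) {F : Set (Fin d → ℝ)}
    (hF : IsExposed ℝ (C.hull univ) F) (hne : F.Nonempty) :
    ∃ y, C.Feas y ∧ C.colors (C.zeros y) = univ ∧ F = C.hull (C.zeros y) := by
  obtain ⟨l, rfl⟩ := hF hne
  have hl : ∀ x, l x = (fun i => l (Pi.single i 1)) ⬝ᵥ x := fun x => by
    conv_lhs => rw [pi_eq_sum_univ' x]
    rw [map_sum]
    exact sum_congr rfl fun i _ => by simp [mul_comm]
  have hmax : ∀ c, ∃ a, C.col a = c ∧ ∀ b, C.col b = c → l (C.pt b) ≤ l (C.pt a) := fun c => by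
    obtain ⟨a, ha, h⟩ := exists_max_image (C.cls c) (fun a => l (C.pt a))
      (by obtain ⟨a, ha⟩ := hsurj c; exact ⟨a, C.mem_cls.2 ha⟩)
    exact ⟨a, C.mem_cls.1 ha, fun b hb => h b (C.mem_cls.2 hb)⟩
  choose f hf hfmax using hmax
  set y : Fin d ⊕ κ → ℝ := Sum.elim (-fun i => l (Pi.single i 1)) fun c => l (C.pt (f c)) with hy
  have hval : ∀ a, y ⬝ᵥ C.vec a = l (C.pt (f (C.col a))) - l (C.pt a) := fun a => by
    rw [dotProduct_vec, hl (C.pt a)]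
    simp only [hy, Sum.elim_inl, Sum.elim_inr, Pi.neg_apply]
    rw [show (fun i => -l (Pi.single i 1)) = -fun i => l (Pi.single i 1) from rfl, neg_dotProduct]
    ring
  have hfeas : C.Feas y := fun a => by rw [hval]; linarith [hfmax _ a rfl]
  have hcol : C.colors (C.zeros y) = univ := eq_univ_of_forall fun c =>
    mem_image.2 ⟨f c, C.mem_zeros.2 (by rw [hval, hf, sub_self]), hf c⟩
  refine ⟨y, hfeas, hcol, ?_⟩
  have hyl : ∀ x, (fun i => y (Sum.inl i)) ⬝ᵥ x = -l x := fun x => by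
    rw [hl x, ← neg_dotProduct]; rfl
  obtain ⟨x₀, hx₀⟩ := hull_nonempty hcol
  rw [hull_zeros hfeas] at hx₀ ⊢
  ext x
  simp only [Set.mem_ofPred_eq]
  refine and_congr_right fun hx => ⟨fun h => ?_, fun h z hz => ?_⟩
  · refine le_antisymm ?_ (neg_sum_le_of_mem_hull hfeas hx)
    rw [← hx₀.2, hyl, hyl, neg_le_neg_iff]
    exact h x₀ hx₀.1
  · rw [hyl] at h
    have := neg_sum_le_of_mem_hull hfeas hz
    rw [hyl, ← h] at this
    linarith

theorem exists_of_mem_spn {B : Finset ι} {x : Fin d ⊕ κ → ℝ} (hx : x ∈ C.spn B) :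
    ∃ μ : ι → ℝ, (∀ i, x (Sum.inl i) = ∑ a ∈ B, μ a * C.pt a i) ∧
      ∀ c, x (Sum.inr c) = ∑ a ∈ B with C.col a = c, μ a := by
  obtain ⟨μ, rfl⟩ := exists_sum_of_mem_span hx
  refine ⟨μ, fun i => by simp [Finset.sum_apply, vec], fun c => ?_⟩
  rw [Finset.sum_apply, sum_filter]
  refine sum_congr rfl fun a _ => ?_
  simp [vec, Pi.single_apply, eq_comm]

/-- The dimension of a Minkowski sum in terms of the Cayley lift. -/
theorem finrank_spn_eq {B : Finset ι} (hB : C.colors B = univ) :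
    Module.finrank ℝ (C.spn B) =
      Module.finrank ℝ (vectorSpan ℝ (C.selSum B)) + Fintype.card κ := by
  have hex : ∀ c, ∃ a ∈ B, C.col a = c := fun c =>
    mem_image.1 (hB.symm ▸ mem_univ c : c ∈ C.colors B)
  choose b hbB hbc using hex
  set π : (Fin d ⊕ κ → ℝ) →ₗ[ℝ] κ → ℝ := LinearMap.funLeft ℝ ℝ Sum.inr with hπ
  set φ : (Fin d → ℝ) →ₗ[ℝ] Fin d ⊕ κ → ℝ :=
    LinearMap.pi (Sum.elim (fun i => LinearMap.proj i) fun _ => 0) with hφ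
  have hφl : ∀ x i, φ x (Sum.inl i) = x i := fun x i => rfl
  have hφr : ∀ x c, φ x (Sum.inr c) = 0 := fun x i => rfl
  have hφinj : Function.Injective φ := fun x y h => funext fun i => by
    rw [← hφl x, h, hφl]
  have hsurj : LinearMap.range (π.domRestrict (C.spn B)) = ⊤ := by
    refine LinearMap.range_eq_top.2 fun z => ⟨⟨∑ c, z c • C.vec (b c), ?_⟩, ?_⟩
    · exact Submodule.sum_mem _ fun c _ => Submodule.smul_mem _ _ (C.vec_mem_spn (hbB c))
    · ext c
      simp [hπ, LinearMap.funLeft_apply, Finset.sum_apply, vec, hbc, Pi.single_apply]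
  have hker : (LinearMap.ker (π.domRestrict (C.spn B))).map (C.spn B).subtype =
      (vectorSpan ℝ (C.selSum B)).map φ := by
    apply le_antisymm
    · rintro _ ⟨⟨x, hxB⟩, hx, rfl⟩
      obtain ⟨μ, hμ1, hμ2⟩ := exists_of_mem_spn hxB
      have hx0 : ∀ c, x (Sum.inr c) = 0 := fun c => congrFun (LinearMap.mem_ker.1 hx) c
      have hxμ : x = φ (∑ a ∈ B, μ a • (C.pt a - C.pt (b (C.col a)))) := by
        ext (i | c)
        · rw [hφl, hμ1, Finset.sum_apply]
          simp only [Pi.smul_apply, Pi.sub_apply, smul_eq_mul, mul_sub, sum_sub_distrib]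
          rw [eq_comm, sub_eq_self, ← Finset.sum_fiberwise B C.col]
          refine sum_eq_zero fun c _ => ?_
          rw [sum_congr rfl (g := fun a => μ a * C.pt (b c) i)
            fun a ha => by rw [(mem_filter.1 ha).2], ← sum_mul, ← hμ2, hx0, zero_mul]
        · rw [hφr, hx0]
      refine ⟨_, Submodule.sum_mem _ fun a ha => Submodule.smul_mem _ _ ?_, hxμ.symm⟩
      have h1 : (∑ c, C.pt (Function.update b (C.col a) a c)) ∈ C.selSum B := by
        refine ⟨_, fun c => ?_, rfl⟩
        by_cases hc : c = C.col a
        · subst hc; simp [ha]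
        · simp [hc, hbB, hbc]
      have h2 : (∑ c, C.pt (b c)) ∈ C.selSum B := ⟨b, fun c => ⟨hbB c, hbc c⟩, rfl⟩
      have h3 := vsub_mem_vectorSpan ℝ h1 h2
      rwa [vsub_eq_sub, ← sum_sub_distrib, sum_eq_single (C.col a)
        (fun c _ hc => by rw [Function.update_of_ne hc, sub_self])
        (fun h => absurd (mem_univ _) h), Function.update_self] at h3
    · rw [Submodule.map_le_iff_le_comap, vectorSpan_def, Submodule.span_le]
      rintro _ ⟨_, ⟨f, hf, rfl⟩, _, ⟨g, hg, rfl⟩, rfl⟩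
      have hx : φ ((∑ c, C.pt (f c)) -ᵥ ∑ c, C.pt (g c)) =
          ∑ c, (C.vec (f c) - C.vec (g c)) := by
        ext (i | c)
        · simp [hφl, Finset.sum_apply, vec]
        · simp [hφr, Finset.sum_apply, vec, (hf _).2, (hg _).2]
      have hmem : φ ((∑ c, C.pt (f c)) -ᵥ ∑ c, C.pt (g c)) ∈ C.spn B := by
        rw [hx]
        exact Submodule.sum_mem _ fun c _ =>
          Submodule.sub_mem _ (C.vec_mem_spn (hf c).1) (C.vec_mem_spn (hg c).1)
      exact ⟨⟨_, hmem⟩, LinearMap.mem_ker.2 (funext fun c => rfl), rfl⟩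
  have h1 := LinearMap.finrank_range_add_finrank_ker (π.domRestrict (C.spn B))
  have h2 := (Submodule.equivMapOfInjective (C.spn B).subtype (Submodule.subtype_injective _)
    (LinearMap.ker (π.domRestrict (C.spn B)))).finrank_eq
  have h3 := (Submodule.equivMapOfInjective φ hφinj (vectorSpan ℝ (C.selSum B))).finrank_eq
  rw [hsurj, finrank_top, Module.finrank_fintype_fun_eq_card, h2, hker, ← h3] at h1
  omega

theorem sdim_hull {B : Finset ι} (hB : C.colors B = univ) :
    sdim (C.hull B) = (Module.finrank ℝ (C.spn B) : ℤ) - Fintype.card κ := by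
  rw [sdim, if_neg (hull_nonempty hB).ne_empty, hull, affineSpan_convexHull, direction_affineSpan,
    finrank_spn_eq hB]
  push_cast
  ring

theorem colors_eq_univ_of_spn_eq {A B : Finset ι} (h : C.spn A = C.spn B)
    (hB : C.colors B = univ) : C.colors A = univ := by
  refine eq_univ_of_forall fun c => by_contra fun hc => ?_
  obtain ⟨b, hb, hbc⟩ := mem_image.1 (hB.symm ▸ mem_univ c : c ∈ C.colors B)
  have h1 : C.vec b ∈ C.spn A := h ▸ C.vec_mem_spn hb
  have h2 := dotProduct_eq_zero_of_mem_span (z := Pi.single (Sum.inr c) 1) h1 fun a ha => by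
    have : c ≠ C.col a := fun h => hc (h ▸ C.col_mem_colors ha)
    simp [vec, this]
  simp [vec, hbc] at h2

theorem mem_zeros_iff_vec_mem_spn {y : Fin d ⊕ κ → ℝ} {a : ι} :
    a ∈ C.zeros y ↔ C.vec a ∈ C.spn (C.zeros y) :=
  ⟨fun h => C.vec_mem_spn h, fun h => C.mem_zeros.2
    (dotProduct_eq_zero_of_mem_span h fun _ hb => C.mem_zeros.1 hb)⟩

theorem finite_exposed_hull (hsurj : ∀ c, ∃ a, C.col a = c) :
    {F | IsExposed ℝ (C.hull univ) F ∧ F.Nonempty}.Finite := by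
  refine (Set.finite_range C.hull).subset fun F hF => ?_
  obtain ⟨y, -, -, rfl⟩ := exists_eq_hull_zeros hsurj hF.1 hF.2
  exact ⟨_, rfl⟩

/-- Faces of a Minkowski sum are at most as numerous as the mixed faces of the Cayley lift
of some generic configuration. -/
theorem exists_gen_fPoly_le [Nonempty κ] (hF : C.Full) (k : ℕ) :
    ∃ p : ι → Fin d → ℝ, (ColConfig.mk p C.col).Gen ∧
      fPoly (C.hull univ) ((k : ℤ) - Fintype.card κ) ≤
        Nat.card {A // (ColConfig.mk p C.col).IsFace A ∧
          (ColConfig.mk p C.col).colors A = univ ∧ A.card = k} := by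
  obtain ⟨p, hp, hface⟩ := exists_gen_forall_face hF
  refine ⟨p, hp, ?_⟩
  have hsurj : ∀ c, ∃ a, C.col a = c := fun c => by
    obtain ⟨a, ha⟩ := card_pos.1 (lt_of_lt_of_le (Nat.succ_pos d) (hF c))
    exact ⟨a, C.mem_cls.1 ha⟩
  have key : ∀ F : {F // IsProperFace (C.hull univ) F ∧ sdim F = (k : ℤ) - Fintype.card κ},
      ∃ y A, F.1 = C.hull (C.zeros y) ∧ (ColConfig.mk p C.col).IsFace A ∧
        C.spn A = C.spn (C.zeros y) ∧ C.colors A = univ ∧ A.card = k := by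
    rintro ⟨F, ⟨hexp, hne, hFne⟩, hdim⟩
    obtain ⟨y, hy, hcol, rfl⟩ := exists_eq_hull_zeros hsurj hexp hne
    have hb : ∃ b, y ⬝ᵥ C.vec b ≠ 0 := by
      by_contra! h
      exact hFne (congrArg C.hull (eq_univ_of_forall fun a => C.mem_zeros.2 (h a)))
    obtain ⟨A, -, hA, hAind, hAspn⟩ := hface y hy hcol hb
    refine ⟨y, A, rfl, hA, hAspn, colors_eq_univ_of_spn_eq hAspn hcol, ?_⟩
    have h1 := hAind.finrank_span_image
    change Module.finrank ℝ (C.spn A) = _ at h1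
    rw [sdim_hull hcol, ← hAspn, h1] at hdim
    omega
  choose y A hFy hA hspn hcol hcard using key
  refine Nat.card_le_card_of_injective (fun F => ⟨A F, hA F, hcol F, hcard F⟩) fun F G h => ?_
  have hAG : A F = A G := congrArg Subtype.val h
  refine Subtype.ext ?_
  rw [hFy F, hFy G]
  congr 1
  ext a
  rw [mem_zeros_iff_vec_mem_spn, mem_zeros_iff_vec_mem_spn, ← hspn, ← hspn, hAG]

end ColConfig

end Hull

section Cyclic

/-- The Chu–Vandermonde identity for multiset coefficients. -/
theorem add_multichoose (x y : ℤ) (m : ℕ) :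
    Ring.multichoose (x + y) m =
      ∑ i ∈ range (m + 1), Ring.multichoose x i * Ring.multichoose y (m - i) := by
  have hmc : ∀ (z : ℤ) (i : ℕ), Ring.multichoose z i = (-1) ^ i * Ring.choose (-z) i := by
    intro z i
    rw [Ring.choose_neg', Units.smul_def, smul_eq_mul, ← mul_assoc]
    have h : ((Int.negOnePow i : ℤˣ) : ℤ) = (-1) ^ i := by simp [Int.negOnePow_def]
    rw [h, ← mul_pow, neg_one_mul, neg_neg, one_pow, one_mul]
  rw [hmc, neg_add, Ring.add_choose_eq m (Commute.all _ _), Nat.sum_antidiagonal_eq_sum_range_succ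
    (fun i j => Ring.choose (-x) i * Ring.choose (-y) j), mul_sum]
  refine sum_congr rfl fun i hi => ?_
  rw [hmc, hmc, ← pow_mul_pow_sub (-1 : ℤ) (Nat.lt_succ_iff.1 (mem_range.1 hi))]
  ring

theorem natCast_choose_eq_multichoose (a i : ℕ) :
    (a.choose i : ℤ) = Ring.multichoose ((a : ℤ) - i + 1) i := by
  rw [Ring.multichoose_eq, ← Ring.choose_natCast]
  congr 1
  ring

theorem sum_multichoose_mul_choose {N D m : ℕ} (hm : m ≤ D) :
    ∑ i ∈ range (m + 1), Ring.multichoose ((N : ℤ) - D) i * ((D - i).choose (m - i) : ℤ) =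
      N.choose m := by
  rw [natCast_choose_eq_multichoose,
    show (N : ℤ) - m + 1 = (N - D) + (D - m + 1) by ring, add_multichoose]
  refine sum_congr rfl fun i hi => ?_
  have hi' := mem_range.1 hi
  rw [natCast_choose_eq_multichoose, Nat.cast_sub (by omega), Nat.cast_sub (by omega)]
  congr 2
  ring

namespace ColConfig

section General

variable {d : ℕ} {κ ι : Type*} [Fintype κ] [DecidableEq κ] [Fintype ι] [DecidableEq ι]
variable {C : ColConfig d κ ι}

theorem mem_zeros_of_hull_subset {y : Fin d ⊕ κ → ℝ} (hy : C.Feas y) {B : Finset ι}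
    (hB : C.colors B = univ) (h : C.hull B ⊆ C.hull (C.zeros y)) : B ⊆ C.zeros y := by
  intro a ha
  have hex : ∀ c, ∃ a ∈ B, C.col a = c := fun c =>
    mem_image.1 (hB.symm ▸ mem_univ c : c ∈ C.colors B)
  choose f hfB hfc using hex
  have hg : ∀ c, Function.update f (C.col a) a c ∈ B ∧
      C.col (Function.update f (C.col a) a c) = c := fun c => by
    by_cases hc : c = C.col a
    · subst hc; simp [ha]
    · simp [hc, hfB, hfc]
  have hx := h (subset_convexHull ℝ _ ⟨_, hg, rfl⟩)
  rw [hull_zeros hy] at hx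
  have h1 := sum_dotProduct_vec_selection y fun c => (hg c).2
  have h2 := hx.2
  simp only at h2
  rw [h2, neg_add_cancel] at h1
  have h3 := (sum_eq_zero_iff_of_nonneg fun c _ => hy _).1 h1 (C.col a) (mem_univ _)
  rw [Function.update_self] at h3
  exact C.mem_zeros.2 h3

/-- The mixed faces of the Cayley lift of a generic configuration yield faces of the
Minkowski sum. -/
theorem Gen.card_faces_le_fPoly [Nonempty κ] (hC : C.Gen) (hF : C.Full) (k : ℕ) :
    Nat.card {A // C.IsFace A ∧ C.colors A = univ ∧ A.card = k} ≤
      fPoly (C.hull univ) ((k : ℤ) - Fintype.card κ) := by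
  have hsurj : ∀ c, ∃ a, C.col a = c := fun c => by
    obtain ⟨a, ha⟩ := card_pos.1 (lt_of_lt_of_le (Nat.succ_pos d) (hF c))
    exact ⟨a, C.mem_cls.1 ha⟩
  have huniv : C.colors univ = univ := eq_univ_of_forall fun c => by
    obtain ⟨a, ha⟩ := hsurj c
    exact mem_image.2 ⟨a, mem_univ a, ha⟩
  have hmap : ∀ A : {A // C.IsFace A ∧ C.colors A = univ ∧ A.card = k},
      IsProperFace (C.hull univ) (C.hull A.1) ∧
        sdim (C.hull A.1) = (k : ℤ) - Fintype.card κ := by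
    rintro ⟨A, hA, hcol, hcard⟩
    have hfin := (hC.indep hA).finrank_span_image
    obtain ⟨y, hy, hyp, rfl⟩ := id hA
    refine ⟨⟨isExposed_hull_zeros hy hcol, hull_nonempty hcol, fun h => ?_⟩, ?_⟩
    · obtain ⟨c⟩ := ‹Nonempty κ›
      exact hC.not_proper_of_cls hF c
        (fun a _ => C.mem_zeros.1 (mem_zeros_of_hull_subset hy huniv h.ge (mem_univ a))) hyp
    · rw [sdim_hull hcol, ← hcard, ← hfin]
      rfl
  have hfinite : Finite {F // IsProperFace (C.hull univ) F ∧
      sdim F = (k : ℤ) - Fintype.card κ} :=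
    ((finite_exposed_hull hsurj).subset fun F hF => ⟨hF.1.1, hF.1.2.1⟩).to_subtype
  refine Nat.card_le_card_of_injective (fun A => ⟨C.hull A.1, hmap A⟩) ?_
  rintro ⟨A, ⟨y, hy, hyp, rfl⟩, hcol, hcard⟩ ⟨B, ⟨z, hz, hzp, rfl⟩, hcol', hcard'⟩ h
  have h' : C.hull (C.zeros y) = C.hull (C.zeros z) := congrArg Subtype.val h
  exact Subtype.ext (Subset.antisymm (mem_zeros_of_hull_subset hz hcol h'.le)
    (mem_zeros_of_hull_subset hy hcol' h'.ge))

end General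

/-- The vertices of a cyclic polytope. -/
def cyclic (D N : ℕ) : ColConfig D Unit (Fin N) where
  pt j := momentCurve D ((j : ℕ) + 1)
  col _ := ()

variable {D N : ℕ}

theorem hull_cyclic : (cyclic D N).hull univ = cyclicPolytope D N := by
  unfold hull cyclicPolytope
  congr 1
  ext x
  constructor
  · rintro ⟨f, -, rfl⟩
    exact ⟨f (), by simp [cyclic]⟩
  · rintro ⟨j, rfl⟩
    exact ⟨fun _ => j, fun _ => ⟨mem_univ _, rfl⟩, by simp [cyclic]⟩

theorem cls_cyclic (c : Unit) : (cyclic D N).cls c = univ :=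
  eq_univ_of_forall fun _ => (cyclic D N).mem_cls.2 rfl

open Polynomial

/-- The functional evaluating a polynomial along the moment curve. -/
def polyFun (D : ℕ) (p : ℝ[X]) : Fin D ⊕ Unit → ℝ :=
  Sum.elim (fun i => p.coeff (i + 1)) fun _ => p.coeff 0

theorem polyFun_dotProduct_vec {p : ℝ[X]} (hp : p.natDegree ≤ D) (a : Fin N) :
    polyFun D p ⬝ᵥ (cyclic D N).vec a = p.eval ((a : ℝ) + 1) := by
  rw [dotProduct_vec, eval_eq_sum_range' (Nat.lt_succ_iff.2 hp), sum_range_succ',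
    ← Fin.sum_univ_eq_sum_range (fun i => p.coeff (i + 1) * ((a : ℝ) + 1) ^ (i + 1))]
  simp [dotProduct, polyFun, cyclic, momentCurve]

theorem gen_cyclic : (cyclic D N).Gen := by
  classical
  intro B hB
  refine linearIndepOn_finset_iff.2 fun g hg a ha => ?_
  set p : ℝ[X] := ∏ b ∈ B.erase a, (X - C ((b : ℝ) + 1)) with hp
  have hcol : ((cyclic D N).colors B).card ≤ 1 := (card_le_univ _).trans (by simp)
  have hdeg : p.natDegree ≤ D := by
    rw [hp, natDegree_finsetProd_X_sub_C_eq_card, card_erase_of_mem ha]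
    omega
  have h1 := congrArg (fun v => polyFun D p ⬝ᵥ v) hg
  simp only [dotProduct_sum, dotProduct_smul, polyFun_dotProduct_vec hdeg, dotProduct_zero,
    smul_eq_mul] at h1
  rw [sum_eq_single_of_mem a ha fun b hb hba => by
    rw [hp, eval_prod, prod_eq_zero (mem_erase.2 ⟨hba, hb⟩) (by simp), mul_zero]] at h1
  refine (mul_eq_zero.1 h1).resolve_right ?_
  rw [hp, eval_prod]
  refine prod_ne_zero_iff.2 ?_
  intro b hb
  have hne : (a : ℕ) ≠ b := fun h => (mem_erase.1 hb).1 (Fin.ext h.symm)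
  simp only [eval_sub, eval_X, eval_C, add_sub_add_right_eq_sub, sub_ne_zero]
  exact_mod_cast hne

theorem isFace_cyclic {A : Finset (Fin N)} (h1 : 1 ≤ A.card) (h2 : 2 * A.card ≤ D) :
    (cyclic D N).IsFace A := by
  set p : ℝ[X] := ∏ b ∈ A, (X - C ((b : ℝ) + 1)) with hp
  have hmonic : p.Monic := monic_prod_X_sub_C _ _
  have hdeg : (p ^ 2).natDegree = 2 * A.card := by
    rw [hmonic.natDegree_pow, hp, natDegree_finsetProd_X_sub_C_eq_card]
  have hval := fun a : Fin N => polyFun_dotProduct_vec (hdeg.le.trans h2) a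
  refine ⟨polyFun D (p ^ 2), fun a => ?_, ⟨⟨2 * A.card - 1, by omega⟩, ?_⟩, ?_⟩
  · rw [hval, eval_pow]
    positivity
  · have h := (hmonic.pow 2).coeff_natDegree
    rw [hdeg] at h
    simp only [polyFun, Sum.elim_inl]
    rw [show 2 * A.card - 1 + 1 = 2 * A.card by omega, h]
    exact one_ne_zero
  · ext a
    rw [mem_zeros, hval, eval_pow, sq_eq_zero_iff, hp, eval_prod, prod_eq_zero_iff]
    constructor
    · rintro ⟨b, hb, h⟩
      simp only [eval_sub, eval_X, eval_C, add_sub_add_right_eq_sub, sub_eq_zero] at h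
      have : (a : ℕ) = b := by exact_mod_cast h
      rwa [Fin.ext this]
    · exact fun ha => ⟨a, ha, by simp⟩

theorem colors_cyclic {A : Finset (Fin N)} (h : 1 ≤ A.card) : (cyclic D N).colors A = univ := by
  obtain ⟨a, ha⟩ := card_pos.1 h
  exact eq_univ_of_forall fun c => mem_image.2 ⟨a, ha, rfl⟩

theorem coeff_hmod_cyclic_of_le (hD : 2 ≤ D) {i : ℕ} (hi : 2 * i ≤ D) :
    ((cyclic D N).hmod univ).coeff i = Ring.multichoose ((N : ℤ) - D) i := by
  induction i using Nat.strong_induction_on with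
  | _ m ih =>
  rcases Nat.eq_zero_or_pos m with rfl | hm
  · rw [coeff_hmod_zero univ_nonempty, Ring.multichoose_zero_right]
    simp
  have h1 := gen_cyclic (D := D) (N := N) |>.card_faces_eq hD (R := univ) (D := D) (m := m)
    (by simp) hm
  have h2 : Nat.card {A : Finset (Fin N) // (cyclic D N).IsFace A ∧
      (cyclic D N).colors A = univ ∧ A.card = m} = N.choose m := by
    rw [Nat.card_congr (Equiv.subtypeEquivRight (q := fun A => A.card = m)
      fun A => ⟨fun h => h.2.2, fun h => ⟨isFace_cyclic (by omega) (by omega),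
        colors_cyclic (by omega), h⟩⟩), Nat.card_eq_fintype_card, Fintype.card_finset_len,
      Fintype.card_fin]
  rw [h2, ← sum_multichoose_mul_choose (by omega : m ≤ D), sum_range_succ, sum_range_succ,
    sum_congr rfl fun i hi => by rw [← ih i (mem_range.1 hi) (by
      have := mem_range.1 hi; omega)]] at h1
  simpa using h1.symm

theorem coeff_hmod_cyclic (hD : 2 ≤ D) (hN : D + 1 ≤ N) {i : ℕ} (hi : i ≤ D) :
    ((cyclic D N).hmod univ).coeff i = Ring.multichoose ((N : ℤ) - D) (min i (D - i)) := by
  have hF : (cyclic D N).Full := fun c => by rw [cls_cyclic]; simpa using hN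
  rcases le_total (2 * i) D with h | h
  · rw [coeff_hmod_cyclic_of_le hD h, min_eq_left (by omega)]
  · rw [min_eq_right (by omega), ← coeff_hmod_cyclic_of_le hD (by omega)]
    have h1 := gen_cyclic.reflect_hmod_singleton hF hD ()
    have h2 : ({()} : Finset Unit) = univ := rfl
    rw [h2] at h1
    conv_lhs => rw [← h1, coeff_reflect, revAt_le hi]

theorem le_fPoly_cyclicPolytope (hD : 2 ≤ D) (hN : D + 1 ≤ N) {m : ℕ} (hm : 1 ≤ m) (hmD : m ≤ D) :
    ∑ i ∈ range (m + 1), Ring.multichoose ((N : ℤ) - D) (min i (D - i)) *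
      ((D - i).choose (m - i) : ℤ) ≤ fPoly (cyclicPolytope D N) ((m : ℤ) - 1) := by
  have hF : (cyclic D N).Full := fun c => by rw [cls_cyclic]; simpa using hN
  have h1 := gen_cyclic.card_faces_le_fPoly hF m
  have h2 := gen_cyclic (D := D) (N := N) |>.card_faces_eq hD (R := univ) (D := D) (m := m)
    (by simp) hm
  rw [hull_cyclic, Fintype.card_unit, Nat.cast_one] at h1
  rw [sum_congr rfl fun i hi => by
    rw [coeff_hmod_cyclic hD hN (by have := mem_range.1 hi; omega : i ≤ D)]] at h2
  rw [← h2]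
  exact_mod_cast h1

end ColConfig

end Cyclic

/-- The coloured configuration of the vertices of a family of polytopes. -/
def vertexConfig {d : ℕ} {κ : Type*} (V : κ → Finset (Vec d)) : ColConfig d κ (Σ i, V i) where
  pt a := a.2
  col := Sigma.fst

theorem card_cls_vertexConfig {d : ℕ} {κ : Type*} [Fintype κ] [DecidableEq κ]
    (V : κ → Finset (Vec d)) (c : κ) : ((vertexConfig V).cls c).card = (V c).card := by
  have h : (vertexConfig V).cls c = univ.map (Function.Embedding.sigmaMk (β := fun i => V i) c) := by
    ext ⟨i, v⟩
    rw [ColConfig.mem_cls, mem_map]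
    constructor
    · rintro rfl
      exact ⟨v, mem_univ _, rfl⟩
    · rintro ⟨w, -, h⟩
      exact (congrArg Sigma.fst h).symm
  rw [h, card_map, card_univ, Fintype.card_coe]

theorem hull_vertexConfig {d : ℕ} (V : Fin 3 → Finset (Vec d)) :
    (vertexConfig V).hull univ = convexHull ℝ (V 0 : Set (Vec d)) +
      convexHull ℝ (V 1 : Set (Vec d)) + convexHull ℝ (V 2 : Set (Vec d)) := by
  rw [← convexHull_add, ← convexHull_add, ColConfig.hull]
  congr 1
  ext x
  constructor
  · have hmem : ∀ a c, (vertexConfig V).col a = c → (vertexConfig V).pt a ∈ V c := by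
      rintro a _ rfl
      exact a.2.2
    rintro ⟨f, hf, rfl⟩
    simp only [Fin.sum_univ_three]
    exact Set.add_mem_add (Set.add_mem_add (hmem _ 0 (hf 0).2) (hmem _ 1 (hf 1).2))
      (hmem _ 2 (hf 2).2)
  · rintro ⟨_, ⟨u, hu, v, hv, rfl⟩, w, hw, rfl⟩
    refine ⟨Fin.cons ⟨0, u, hu⟩ (Fin.cons ⟨1, v, hv⟩ (Fin.cons ⟨2, w, hw⟩ finZeroElim)),
      fun c => ⟨mem_univ _, ?_⟩, ?_⟩
    · fin_cases c <;> rfl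
    · simp only [Fin.sum_univ_three]
      rfl

/-- Tight upper bound on the number of `(k-1)`-faces of the Minkowski sum
of three `d`-polytopes in `ℝ^d` in terms of the numbers of vertices of the summands. -/
theorem minkowski_sum_three_upper_bound
    (d : ℕ) (hd : 2 ≤ d)
    (P : Fin 3 → Set (Vec d)) (V : Fin 3 → Finset (Vec d)) (n : Fin 3 → ℕ)
    (hPV : ∀ i, IsPolytopeWithVertexSet (P i) (V i))
    (hdim : ∀ i, sdim (P i) = (d : ℤ))
    (hcard : ∀ i, (V i).card = n i)
    (hn : ∀ i, d + 1 ≤ n i) :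
    ∀ k : ℕ, 1 ≤ k → k ≤ d →
      (fPoly (P 0 + P 1 + P 2) ((k : ℤ) - 1) : ℤ) ≤ UB3 d n k := by
  intro k _ hkd
  have hF : (vertexConfig V).Full := fun c => by rw [card_cls_vertexConfig, hcard]; exact hn c
  obtain ⟨p, hp, hle⟩ := ColConfig.exists_gen_fPoly_le hF (k + 2)
  have hmix := hp.card_mixed_faces_le (show (ColConfig.mk p (vertexConfig V).col).Full from hF) hd
    (n := n) (fun j => (card_cls_vertexConfig V j).trans (hcard j)) hkd
  have h0 := hn 0
  have h1 := hn 1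
  have h2 := hn 2
  have hcyc := ColConfig.le_fPoly_cyclicPolytope (D := d + 2) (N := n 0 + n 1 + n 2) (m := k + 2)
    (by omega) (by omega) (by omega) (by omega)
  rw [hull_vertexConfig, ← (hPV 0).1, ← (hPV 1).1, ← (hPV 2).1, Fintype.card_fin] at hle
  push_cast at hle hcyc
  rw [show (k : ℤ) + 2 - 3 = k - 1 by ring] at hle
  rw [show (k : ℤ) + 2 - 1 = k + 1 by ring,
    show (n 0 : ℤ) + n 1 + n 2 - (d + 2) = n 0 + n 1 + n 2 - d - 2 by ring] at hcyc
  unfold UB3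
  have hle' := hmix.trans' (Int.ofNat_le.2 hle)
  linarith
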